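/- Let M : ℕ → ℝ be the increasing enumeration of the eigenvalues of the problem (α,β) with α = 0 and β = 2a/b, and let Λ : ℕ → ℝ be the increasing enumeration of the eigenvalues of the problem (α,β) with α = 0 and β = 2/b. Then the partial sums of the series Σ_{n≥1} |ln M(κ·(n+1) − 1) − ln M(κ·n)| and of the series Σ_{n≥1} |ln Λ(κ·n) − ln M(κ·n)| are bounded, i.e. both series converge. -/

import Mathlib

open Set Filter

/-- First derivative on `[0,1]` (one-sided at the endpoints). -/
noncomputable def Y1 (y : ℝ → ℝ) : ℝ → ℝ := derivWithin y (Set.Icc 0 1)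
/-- Second derivative on `[0,1]`. -/
noncomputable def Y2 (y : ℝ → ℝ) : ℝ → ℝ := iteratedDerivWithin 2 y (Set.Icc 0 1)
/-- Third derivative on `[0,1]`. -/
noncomputable def Y3 (y : ℝ → ℝ) : ℝ → ℝ := iteratedDerivWithin 3 y (Set.Icc 0 1)

/-- `y` is a solution on `[0,1]` of `[y''' - λ P y]' + λ P y' = 0`:
`y ∈ C³[0,1]` and `y''' - λ P y` is (continuously) differentiable on `[0,1]`
with derivative `-λ P y'`. -/
def SolutionOn (P : ℝ → ℝ) (lam : ℝ) (y : ℝ → ℝ) : Prop :=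
  ContDiffOn ℝ 3 y (Set.Icc 0 1) ∧
  ∀ x ∈ Set.Icc (0:ℝ) 1,
    HasDerivWithinAt (fun t => Y3 y t - lam * P t * y t)
      (-(lam * P x * Y1 y x)) (Set.Icc 0 1) x

/-- `y` is not identically zero on `[0,1]`. -/
def Nontrivial01 (y : ℝ → ℝ) : Prop := ∃ x ∈ Set.Icc (0:ℝ) 1, y x ≠ 0

/-- The boundary conditions of the problem `(α, β)`. -/
def BC (α β : ℝ) (y : ℝ → ℝ) : Prop :=
  Y2 y 0 + α * y 0 - β * Y1 y 0 = 0 ∧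
  -β * Y3 y 0 + α * Y2 y 0 = 0 ∧
  Y2 y 1 + α * y 1 + β * Y1 y 1 = 0 ∧
  -β * Y3 y 1 - α * Y2 y 1 = 0

/-- `y` is an eigenfunction of the problem `(α, β)` with eigenvalue `lam`. -/
def Eigenfunction (P : ℝ → ℝ) (α β lam : ℝ) (y : ℝ → ℝ) : Prop :=
  Nontrivial01 y ∧ SolutionOn P lam y ∧ BC α β y

/-- `lam` is an eigenvalue of the problem `(α, β)`. -/
def IsEigenvalue (P : ℝ → ℝ) (α β lam : ℝ) : Prop :=
  ∃ y : ℝ → ℝ, Eigenfunction P α β lam y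

/-- The number `b = (1 - κ a)/(κ - 1)`. -/
noncomputable def bb (κ : ℕ) (a : ℝ) : ℝ := (1 - κ * a) / (κ - 1)

/-- `P` is a nondecreasing continuous function on `[0,1]` with `P 0 = 0`, `P 1 = 1`,
self-similar of Cantor type with parameters `κ ≥ 2` and `0 < a < 1/κ`. -/
def CantorSelfSimilar (P : ℝ → ℝ) (κ : ℕ) (a : ℝ) : Prop :=
  ContinuousOn P (Set.Icc 0 1) ∧ MonotoneOn P (Set.Icc 0 1) ∧
  P 0 = 0 ∧ P 1 = 1 ∧ 2 ≤ κ ∧ 0 < a ∧ a < 1 / κ ∧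
  (∀ k : ℕ, k < κ → ∃ c : ℝ, ∀ x ∈ Set.Icc (0:ℝ) 1,
      (κ : ℝ) * P (k * (a + bb κ a) + a * x) = P x + c) ∧
  (∀ k : ℕ, 1 ≤ k → k < κ →
      ∀ x ∈ Set.Ioo ((k:ℝ) * (a + bb κ a) - bb κ a) ((k:ℝ) * (a + bb κ a)),
      ∀ x' ∈ Set.Ioo ((k:ℝ) * (a + bb κ a) - bb κ a) ((k:ℝ) * (a + bb κ a)),
      P x = P x')

open scoped RealInnerProductSpace in
/-- Courant–Fischer combined with Gibbs' inequality: if the quadratic form of `T` is bounded below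
by `t i` on the common kernel of `i` functionals, then the logarithms of the `t i / d i` are
controlled by the diagonal entries of `T`. -/
theorem sum_log_div_le_sum_diag {N : ℕ}
    {T : EuclideanSpace ℝ (Fin N) →ₗ[ℝ] EuclideanSpace ℝ (Fin N)} (hT : T.IsSymmetric)
    {d t : Fin N → ℝ} (hd : ∀ i, 0 < d i) (ht : ∀ i, 0 < t i)
    (h : ∀ i : Fin N, ∃ L : Fin i → (EuclideanSpace ℝ (Fin N) →ₗ[ℝ] ℝ),
      ∀ x, (∀ j, L j x = 0) → t i * ‖x‖ ^ 2 ≤ ⟪T x, x⟫) :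
    ∑ i, Real.log (t i / d i) ≤
      ∑ i, (⟪T (EuclideanSpace.basisFun (Fin N) ℝ i), EuclideanSpace.basisFun (Fin N) ℝ i⟫ / d i
        - 1) := by
  have hn : Module.finrank ℝ (EuclideanSpace ℝ (Fin N)) = N := by simp
  set w := (hT.eigenvectorBasis hn).reindex Fin.revPerm with hw
  set θ : Fin N → ℝ := fun i => hT.eigenvalues hn (Fin.rev i) with hθ
  have hTw : ∀ i, T (w i) = θ i • w i := by
    intro i
    simp [hw, hθ, hT.apply_eigenvectorBasis hn]
  have hmono : Monotone θ := fun i j hij => hT.eigenvalues_antitone hn (Fin.rev_le_rev.2 hij)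
  have hquad : ∀ x, ⟪T x, x⟫ = ∑ k, θ k * ⟪w k, x⟫ ^ 2 := by
    intro x
    rw [← w.sum_inner_mul_inner]
    refine Finset.sum_congr rfl fun k _ => ?_
    rw [hT, hTw, real_inner_smul_right, real_inner_comm x (w k)]
    ring
  have hnorm : ∀ x, ‖x‖ ^ 2 = ∑ k, ⟪w k, x⟫ ^ 2 := by
    intro x
    rw [← real_inner_self_eq_norm_sq, ← w.sum_inner_mul_inner]
    refine Finset.sum_congr rfl fun k _ => ?_
    rw [real_inner_comm x (w k)]
    ring
  have htθ : ∀ i, t i ≤ θ i := by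
    intro i
    obtain ⟨L, hL⟩ := h i
    let A : (Fin (i + 1) → ℝ) →ₗ[ℝ] EuclideanSpace ℝ (Fin N) :=
      ∑ l : Fin (i + 1), (LinearMap.proj l).smulRight (w (Fin.castLE i.2 l))
    have hA : ∀ c, A c = ∑ l : Fin (i + 1), c l • w (Fin.castLE i.2 l) := by
      intro c; simp [A]
    have hlt : Module.finrank ℝ (Fin i → ℝ) < Module.finrank ℝ (Fin (i + 1) → ℝ) := by simp
    obtain ⟨c, hc, hc0⟩ := Submodule.exists_mem_ne_zero_of_ne_bot
      (LinearMap.ker_ne_bot_of_finrank_lt (f := (LinearMap.pi fun j => L j ∘ₗ A)) hlt)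
    have hLc : ∀ j, L j (A c) = 0 := fun j => by
      have := congrFun (LinearMap.mem_ker.1 hc) j
      simpa using this
    have hin : ∀ l : Fin (i + 1), ⟪w (Fin.castLE i.2 l), A c⟫ = c l := by
      intro l
      rw [hA, inner_sum]
      simp only [real_inner_smul_right, w.inner_eq_ite]
      simp [Fin.ext_iff]
      simp [← Fin.ext_iff]
    have hin' : ∀ k : Fin N, i < k → ⟪w k, A c⟫ = 0 := by
      intro k hk
      rw [hA, inner_sum]
      refine Finset.sum_eq_zero fun l _ => ?_
      have : k ≠ Fin.castLE i.2 l := by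
        intro h'
        have h1 := l.2
        have h2 : (k : ℕ) = l := by rw [h']; rfl
        have h3 : (i : ℕ) < k := hk
        omega
      simp [real_inner_smul_right, w.inner_eq_ite, this]
    have hle : ⟪T (A c), A c⟫ ≤ θ i * ‖A c‖ ^ 2 := by
      rw [hquad, hnorm, Finset.mul_sum]
      refine Finset.sum_le_sum fun k _ => ?_
      rcases le_or_gt k i with hk | hk
      · exact mul_le_mul_of_nonneg_right (hmono hk) (sq_nonneg _)
      · simp [hin' k hk]
    have hne : A c ≠ 0 := by
      intro h0
      refine hc0 (funext fun l => ?_)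
      rw [← hin l, h0]; simp
    have hpos : 0 < ‖A c‖ ^ 2 := by positivity
    exact le_of_mul_le_mul_right ((hL _ hLc).trans hle) hpos
  set e := EuclideanSpace.basisFun (Fin N) ℝ with he
  have hrow : ∀ k, ∑ i, ⟪w k, e i⟫ ^ 2 = 1 := by
    intro k
    have := e.sum_inner_mul_inner (w k) (w k)
    rw [real_inner_self_eq_norm_sq, w.norm_eq_one, one_pow] at this
    rw [← this]
    refine Finset.sum_congr rfl fun i _ => ?_
    rw [real_inner_comm (w k) (e i)]; ring
  have hcol : ∀ i, ∑ k, ⟪w k, e i⟫ ^ 2 = 1 := by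
    intro i
    rw [← hnorm, e.norm_eq_one, one_pow]
  have hθ0 : ∀ k, 0 < θ k := fun k => (ht k).trans_le (htθ k)
  calc ∑ i, Real.log (t i / d i)
      ≤ ∑ i, (Real.log (θ i) - Real.log (d i)) := by
        refine Finset.sum_le_sum fun i _ => ?_
        rw [Real.log_div (ht i).ne' (hd i).ne']
        exact sub_le_sub_right (Real.log_le_log (ht i) (htθ i)) _
    _ = ∑ i, ∑ k, ⟪w k, e i⟫ ^ 2 * (Real.log (θ k) - Real.log (d i)) := by
        simp only [mul_sub, Finset.sum_sub_distrib, ← Finset.sum_mul, hcol, one_mul]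
        rw [Finset.sum_comm]
        simp only [← Finset.sum_mul, hrow, one_mul]
    _ ≤ ∑ i, ∑ k, ⟪w k, e i⟫ ^ 2 * (θ k / d i - 1) := by
        refine Finset.sum_le_sum fun i _ => Finset.sum_le_sum fun k _ => ?_
        refine mul_le_mul_of_nonneg_left ?_ (sq_nonneg _)
        rw [← Real.log_div (hθ0 k).ne' (hd i).ne']
        exact Real.log_le_sub_one_of_pos (div_pos (hθ0 k) (hd i))
    _ = _ := by
        refine Finset.sum_congr rfl fun i _ => ?_
        simp only [mul_sub, Finset.sum_sub_distrib, mul_one, hcol]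
        rw [hquad, Finset.sum_div]
        congr 1
        exact Finset.sum_congr rfl fun k _ => by ring

/-- `lam`, `u` are the eigenvalues and `m`-orthonormal eigenvectors of the form `Q` relative to `m`,
together with the variational lower bound expressing completeness. -/
structure SpectralData {X : Type*} [AddCommGroup X] [Module ℝ X] (Q m : LinearMap.BilinForm ℝ X)
    (lam : ℕ → ℝ) (u : ℕ → X) : Prop where
  nonneg : ∀ i, 0 ≤ lam i
  orthonormal : ∀ i j, m (u i) (u j) = if i = j then 1 else 0
  diagonal : ∀ i j, Q (u i) (u j) = if i = j then lam i else 0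
  lower_bound : ∀ i φ, (∀ j < i, m φ (u j) = 0) → lam i * m φ φ ≤ Q φ φ

namespace SpectralData

variable {X : Type*} [AddCommGroup X] [Module ℝ X] {Q Q' m : LinearMap.BilinForm ℝ X}
  {lam lam' : ℕ → ℝ} {u u' : ℕ → X}

theorem apply_sum (h : SpectralData Q m lam u) (s : Finset ℕ) (c : ℕ → ℝ) :
    m (∑ i ∈ s, c i • u i) (∑ i ∈ s, c i • u i) = ∑ i ∈ s, c i ^ 2 ∧
      Q (∑ i ∈ s, c i • u i) (∑ i ∈ s, c i • u i) = ∑ i ∈ s, lam i * c i ^ 2 := by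
  constructor
  all_goals
    simp only [map_sum, map_smul, LinearMap.sum_apply, LinearMap.smul_apply, h.orthonormal,
      h.diagonal, smul_eq_mul, mul_ite, mul_one, mul_zero, Finset.sum_ite_eq']
    refine Finset.sum_congr rfl fun i hi => ?_
    simp only [hi, if_true]
    ring

theorem bessel (h : SpectralData Q m lam u) {I : X → ℝ} (hI : ∀ φ, I φ ≤ Q φ φ)
    {l : X →ₗ[ℝ] ℝ} {C : ℝ} (hC : 0 ≤ C) (hl : ∀ φ, l φ ^ 2 ≤ C * (I φ + m φ φ)) (s : Finset ℕ) :
    ∑ i ∈ s, l (u i) ^ 2 / (lam i + 1) ≤ C := by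
  set c : ℕ → ℝ := fun i => l (u i) / (lam i + 1) with hc
  have hpos : ∀ i, 0 < lam i + 1 := fun i => by linarith [h.nonneg i]
  set S := ∑ i ∈ s, l (u i) ^ 2 / (lam i + 1) with hS
  have hS0 : 0 ≤ S := Finset.sum_nonneg fun i _ => div_nonneg (sq_nonneg _) (hpos i).le
  have h1 : l (∑ i ∈ s, c i • u i) = S := by
    simp only [map_sum, map_smul, smul_eq_mul, hS, hc]
    exact Finset.sum_congr rfl fun i _ => by ring
  have h2 := h.apply_sum s c
  have h3 := hl (∑ i ∈ s, c i • u i)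
  have h4 : S ^ 2 ≤ C * S := by
    rw [h1] at h3
    refine h3.trans (mul_le_mul_of_nonneg_left ?_ hC)
    have := hI (∑ i ∈ s, c i • u i)
    rw [h2.2] at this
    rw [h2.1]
    refine (add_le_add_left this _).trans_eq ?_
    rw [← Finset.sum_add_distrib, hS]
    refine Finset.sum_congr rfl fun i _ => ?_
    have := (hpos i).ne'
    simp only [hc]
    field_simp
  by_contra! hlt
  nlinarith

open scoped RealInnerProductSpace in
theorem sum_posPart_log_le (h : SpectralData Q m lam u) (h' : SpectralData Q' m lam' u')
    {I : X → ℝ} {ι : Type*} {s : Finset ι} {l : ι → X →ₗ[ℝ] ℝ} {K C : ℝ} (hK : 0 ≤ K) (hC : 0 ≤ C)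
    (hI : ∀ φ, I φ ≤ Q φ φ) (hQ' : ∀ φ, Q' φ φ ≤ I φ + K * ∑ k ∈ s, l k φ ^ 2)
    (hl : ∀ k φ, l k φ ^ 2 ≤ C * (I φ + m φ φ)) (N : ℕ) :
    ∑ i ∈ Finset.range N, max 0 (Real.log (lam' i + 1) - Real.log (lam i + 1)) ≤
      K * (s.card * C) := by
  have hpos : ∀ i, 0 < lam i + 1 := fun i => by linarith [h.nonneg i]
  have hpos' : ∀ i, 0 < lam' i + 1 := fun i => by linarith [h'.nonneg i]
  let Φ : EuclideanSpace ℝ (Fin N) →ₗ[ℝ] X :=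
    ∑ i : Fin N, (EuclideanSpace.proj i : _ →L[ℝ] ℝ).toLinearMap.smulRight (u i)
  have hΦ : ∀ x, Φ x = ∑ i ∈ Finset.range N, (if hi : i < N then x ⟨i, hi⟩ else 0) • u i := by
    intro x
    simp [Φ, Finset.sum_range]
  let e := EuclideanSpace.basisFun (Fin N) ℝ
  have hΦe : ∀ i : Fin N, Φ (e i) = u i := by
    intro i
    simp [Φ, e, ite_smul, PiLp.single_apply]
  let T : EuclideanSpace ℝ (Fin N) →ₗ[ℝ] EuclideanSpace ℝ (Fin N) :=
    ∑ i : Fin N, ((lam i + 1) • (EuclideanSpace.proj i : _ →L[ℝ] ℝ).toLinearMap +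
      K • ∑ k ∈ s, l k (u i) • (l k ∘ₗ Φ)).smulRight (e i)
  have hT : ∀ x y, ⟪T x, y⟫ =
      ∑ i : Fin N, (lam i + 1) * (x i * y i) + K * ∑ k ∈ s, l k (Φ x) * l k (Φ y) := by
    intro x y
    have hy : ∀ k, l k (Φ y) = ∑ i : Fin N, y i * l k (u i) := by
      intro k; simp [Φ]
    have hey : ∀ i, ⟪e i, y⟫ = y i := fun i => by
      simp [e, EuclideanSpace.inner_single_left]
    have : ⟪T x, y⟫ = ∑ i : Fin N, ((lam i + 1) * x i + K * ∑ k ∈ s, l k (u i) * l k (Φ x)) * y i := by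
      simp only [T, LinearMap.sum_apply, sum_inner]
      refine Finset.sum_congr rfl fun i _ => ?_
      rw [LinearMap.smulRight_apply, real_inner_smul_left, hey]
      simp
    rw [this]
    simp only [hy, add_mul, Finset.sum_add_distrib, mul_assoc]
    congr 1
    rw [← Finset.mul_sum]
    congr 1
    simp only [Finset.mul_sum, Finset.sum_mul]
    rw [Finset.sum_comm]
    refine Finset.sum_congr rfl fun k _ => Finset.sum_congr rfl fun i _ => ?_
    ring
  have hTs : T.IsSymmetric := by
    intro x y
    rw [hT, real_inner_comm, hT]
    simp only [mul_comm]
  have hm : ∀ x, m (Φ x) (Φ x) = ‖x‖ ^ 2 := by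
    intro x
    rw [hΦ, (h.apply_sum _ _).1, Finset.sum_range, EuclideanSpace.norm_sq_eq]
    simp
  have hQT : ∀ x, ⟪T x, x⟫ = Q (Φ x) (Φ x) + m (Φ x) (Φ x) + K * ∑ k ∈ s, l k (Φ x) ^ 2 := by
    intro x
    rw [hT, hΦ, (h.apply_sum _ _).1, (h.apply_sum _ _).2, ← Finset.sum_add_distrib]
    congr 1
    · rw [Finset.sum_range]
      refine Finset.sum_congr rfl fun i _ => ?_
      simp
      ring
    · congr 1
      exact Finset.sum_congr rfl fun k _ => by ring
  have hKs : ∀ x, 0 ≤ K * ∑ k ∈ s, l k (Φ x) ^ 2 := fun x =>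
    mul_nonneg hK (Finset.sum_nonneg fun k _ => sq_nonneg _)
  have key := sum_log_div_le_sum_diag hTs (d := fun i => lam i + 1)
    (t := fun i => max (lam i + 1) (lam' i + 1)) (fun i => hpos i)
    (fun i => (hpos i).trans_le (le_max_left _ _)) (fun i => by
      rcases le_total (lam i + 1) (lam' i + 1) with hle | hle
      · refine ⟨fun j => (m.flip (u' j)) ∘ₗ Φ, fun x hx => ?_⟩
        rw [max_eq_right hle, hQT, ← hm]
        have h1 := h'.lower_bound i (Φ x) fun j hj => hx ⟨j, hj⟩
        have h2 := hQ' (Φ x)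
        have h3 := hI (Φ x)
        linarith
      · refine ⟨fun j => (m.flip (u j)) ∘ₗ Φ, fun x hx => ?_⟩
        rw [max_eq_left hle, hQT, ← hm]
        have h1 := h.lower_bound i (Φ x) fun j hj => hx ⟨j, hj⟩
        have h2 := hKs x
        linarith)
  rw [Finset.sum_range]
  calc _ = ∑ i : Fin N, Real.log (max (lam i + 1) (lam' i + 1) / (lam i + 1)) := by
        refine Finset.sum_congr rfl fun i _ => ?_
        rw [Real.log_div ((hpos i).trans_le (le_max_left _ _)).ne' (hpos i).ne']
        rcases le_total (lam i + 1) (lam' i + 1) with hle | hle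
        · rw [max_eq_right hle, max_eq_right]
          exact sub_nonneg.2 (Real.log_le_log (hpos i) hle)
        · rw [max_eq_left hle, sub_self, max_eq_left]
          exact sub_nonpos.2 (Real.log_le_log (hpos' i) hle)
    _ ≤ _ := key
    _ = K * ∑ k ∈ s, ∑ i : Fin N, l k (u i) ^ 2 / (lam i + 1) := by
        rw [Finset.sum_comm, Finset.mul_sum]
        refine Finset.sum_congr rfl fun i _ => ?_
        change ⟪T (e i), e i⟫ / (lam i + 1) - 1 = _
        rw [hT, hΦe, ← Finset.sum_div]
        have : ∑ j : Fin N, (lam j + 1) * ((e i) j * (e i) j) = lam i + 1 := by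
          simp [e, PiLp.single_apply]
        rw [this]
        have := (hpos i).ne'
        field_simp
        ring
    _ ≤ K * ∑ k ∈ s, C := by
        refine mul_le_mul_of_nonneg_left (Finset.sum_le_sum fun k _ => ?_) hK
        rw [← Finset.sum_range (fun i => l k (u i) ^ 2 / (lam i + 1))]
        exact h.bessel hI hC (hl k) _
    _ = _ := by simp

/-- Two forms which differ by finitely many bounded functionals have eigenvalue sequences whose
logarithms differ by a summable sequence. -/
theorem summable_abs_log_sub (h : SpectralData Q m lam u) (h' : SpectralData Q' m lam' u')
    {I : X → ℝ} {ι : Type*} {s : Finset ι} {l : ι → X →ₗ[ℝ] ℝ} {K C : ℝ} (hK : 0 ≤ K) (hC : 0 ≤ C)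
    (hI : ∀ φ, I φ ≤ Q φ φ) (hQ : ∀ φ, Q φ φ ≤ I φ + K * ∑ k ∈ s, l k φ ^ 2)
    (hI' : ∀ φ, I φ ≤ Q' φ φ) (hQ' : ∀ φ, Q' φ φ ≤ I φ + K * ∑ k ∈ s, l k φ ^ 2)
    (hl : ∀ k φ, l k φ ^ 2 ≤ C * (I φ + m φ φ)) :
    Summable fun i => |Real.log (lam' i + 1) - Real.log (lam i + 1)| := by
  refine summable_of_sum_range_le (c := K * (s.card * C) + K * (s.card * C))
    (fun _ => abs_nonneg _) fun N => ?_
  refine le_trans (le_of_eq ?_) (add_le_add (h.sum_posPart_log_le h' hK hC hI hQ' hl N)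
    (h'.sum_posPart_log_le h hK hC hI' hQ hl N))
  rw [← Finset.sum_add_distrib]
  refine Finset.sum_congr rfl fun i _ => ?_
  generalize Real.log (lam' i + 1) = x
  generalize Real.log (lam i + 1) = y
  rcases le_total x y with hxy | hxy
  · rw [abs_of_nonpos, max_eq_left, max_eq_right] <;> linarith
  · rw [abs_of_nonneg, max_eq_right, max_eq_left] <;> linarith

end SpectralData

section Parts

open MeasureTheory intervalIntegral

/-- Integration by parts for an integral against a finite measure without atoms. -/
theorem integral_mul_eq_sub_of_hasDerivAt {μ : Measure ℝ} [IsFiniteMeasure μ]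
    {f φ φ' : ℝ → ℝ} {l r : ℝ} (hlr : l ≤ r)
    (hf : Integrable f μ) (hφ : ∀ x, HasDerivAt φ (φ' x) x) (hφ' : Continuous φ') :
    ∫ s in l..r, f s * φ s ∂μ =
      φ r * (∫ s in l..r, f s ∂μ) - ∫ t in l..r, φ' t * ∫ s in l..t, f s ∂μ := by
  have hφc : Continuous φ := continuous_iff_continuousAt.2 fun x => (hφ x).continuousAt
  have hfφ : IntervalIntegrable (fun s => f s * φ s) μ l r :=
    (hf.intervalIntegrable).mul_continuousOn hφc.continuousOn
  have h1 : φ r * (∫ s in l..r, f s ∂μ) - ∫ s in l..r, f s * φ s ∂μ =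
      ∫ s in l..r, f s * (φ r - φ s) ∂μ := by
    rw [← intervalIntegral.integral_const_mul, ← intervalIntegral.integral_sub
      (hf.intervalIntegrable.const_mul _) hfφ]
    congr 1; ext s; ring
  rw [eq_sub_iff_add_eq, ← eq_sub_iff_add_eq', h1]
  set k : ℝ → ℝ → ℝ := fun s t => if s ≤ t then f s * φ' t else 0 with hk
  have hL : ∫ s in l..r, f s * (φ r - φ s) ∂μ =
      ∫ s in Ioc l r, (∫ t in Ioc l r, k s t) ∂μ := by
    rw [integral_of_le hlr]
    refine setIntegral_congr_fun measurableSet_Ioc fun s hs => ?_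
    have h2 : (∫ t in Ioc l r, k s t) = ∫ t in Icc s r, f s * φ' t := by
      have : (fun t => k s t) = (Ici s).indicator fun t => f s * φ' t := by
        ext t; simp [hk, indicator_apply]
      rw [this, setIntegral_indicator (measurableSet_Ici (a := s))]
      congr 2
      ext t
      simp only [mem_inter_iff, mem_Ioc, mem_Ici, mem_Icc]
      exact ⟨fun h => ⟨h.2, h.1.2⟩, fun h => ⟨⟨hs.1.trans_le h.1, h.2⟩, h.1⟩⟩
    change _ = ∫ t in Ioc l r, k s t
    rw [h2, integral_Icc_eq_integral_Ioc, ← integral_of_le hs.2,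
      intervalIntegral.integral_const_mul, integral_eq_sub_of_hasDerivAt (fun x _ => hφ x)
        (hφ'.intervalIntegrable _ _)]
  have hR : (∫ t in l..r, φ' t * ∫ s in l..t, f s ∂μ) =
      ∫ t in Ioc l r, ∫ s in Ioc l r, k s t ∂μ := by
    rw [integral_of_le hlr]
    refine setIntegral_congr_fun measurableSet_Ioc fun t ht => ?_
    have h2 : (∫ s in Ioc l r, k s t ∂μ) = ∫ s in Ioc l t, f s * φ' t ∂μ := by
      have : (fun s => k s t) = (Iic t).indicator fun s => f s * φ' t := by
        ext s; simp [hk, indicator_apply]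
      rw [this, setIntegral_indicator (measurableSet_Iic (a := t))]
      congr 2
      ext s
      simp only [mem_inter_iff, mem_Ioc, mem_Iic]
      exact ⟨fun h => ⟨h.1.1, h.2⟩, fun h => ⟨⟨h.1, h.2.trans ht.2⟩, h.2⟩⟩
    change _ = ∫ s in Ioc l r, k s t ∂μ
    rw [h2, MeasureTheory.integral_mul_const, integral_of_le ht.1.le, mul_comm]
  rw [hL, hR]
  refine (integral_integral_swap ?_).symm
  have hprod : Integrable (fun p : ℝ × ℝ => f p.1 * φ' p.2)
      ((μ.restrict (Ioc l r)).prod (volume.restrict (Ioc l r))) :=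
    Integrable.mul_prod (hf.restrict) (hφ'.integrableOn_Ioc)
  have : (Function.uncurry k) = {p : ℝ × ℝ | p.1 ≤ p.2}.indicator fun p => f p.1 * φ' p.2 := by
    ext p; simp [hk, indicator_apply, Function.uncurry]
  rw [this]
  exact hprod.indicator (measurableSet_le measurable_fst measurable_snd)

theorem continuous_cumulative {μ : Measure ℝ} [NullSingletonClass μ]
    {f : ℝ → ℝ} (hf : Integrable f μ) (c : ℝ) :
    Continuous fun t => ∫ s in c..t, f s ∂μ :=
  intervalIntegral.continuous_primitive (fun _ _ => hf.intervalIntegrable) c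

end Parts

section Solution

open MeasureTheory intervalIntegral

/-- `z` is a weak solution of `z'''' = f μ` on `[0,1]` with the boundary conditions
`z'' (0) = β z' (0)`, `z'''(0) = 0`, `z''(1) = -β z'(1)`, `z'''(1) = 0`. -/
structure IsWeakSol (μ : Measure ℝ) (β : ℝ) (f z : ℝ → ℝ) : Prop where
  contDiff : ContDiff ℝ 2 z
  second : ∀ x ∈ Icc (0 : ℝ) 1,
    deriv (deriv z) x = deriv (deriv z) 0 + ∫ t in (0 : ℝ)..x, ∫ s in (0 : ℝ)..t, f s ∂μ
  mean : ∫ s in (0 : ℝ)..1, f s ∂μ = 0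
  left : deriv (deriv z) 0 = β * deriv z 0
  right : deriv (deriv z) 1 = -(β * deriv z 1)

theorem ContDiff.deriv_facts {z : ℝ → ℝ} (hz : ContDiff ℝ 2 z) :
    (∀ x, HasDerivAt z (deriv z x) x) ∧ (∀ x, HasDerivAt (deriv z) (deriv (deriv z) x) x) ∧
      Continuous z ∧ Continuous (deriv z) ∧ Continuous (deriv (deriv z)) := by
  have h1 : ContDiff ℝ 1 (deriv z) := by
    rw [show (2 : WithTop ℕ∞) = 1 + 1 by norm_num, contDiff_succ_iff_deriv] at hz
    exact hz.2.2
  exact ⟨fun x => (hz.differentiable (by norm_num) x).hasDerivAt,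
    fun x => (h1.differentiable (by norm_num) x).hasDerivAt, hz.continuous, h1.continuous,
    h1.continuous_deriv le_rfl⟩

variable {μ : Measure ℝ} [IsFiniteMeasure μ] [NullSingletonClass μ] {β : ℝ} {f z φ : ℝ → ℝ}

theorem IsWeakSol.integral_second_mul (h : IsWeakSol μ β f z) (hf : Integrable f μ)
    (hφ : ContDiff ℝ 2 φ) {l r : ℝ} (hl : 0 ≤ l) (hlr : l ≤ r) (hr : r ≤ 1) :
    ∫ x in l..r, deriv (deriv z) x * deriv (deriv φ) x =
      (deriv (deriv z) r * deriv φ r - (∫ s in (0 : ℝ)..r, f s ∂μ) * φ r) -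
      (deriv (deriv z) l * deriv φ l - (∫ s in (0 : ℝ)..l, f s ∂μ) * φ l) +
      ∫ s in l..r, f s * φ s ∂μ := by
  obtain ⟨hφ1, hφ2, hφc, hφc1, hφc2⟩ := hφ.deriv_facts
  have hFc := continuous_cumulative hf 0
  set F : ℝ → ℝ := fun t => ∫ s in (0 : ℝ)..t, f s ∂μ with hF
  set G : ℝ → ℝ := fun x => deriv (deriv z) 0 + ∫ t in (0 : ℝ)..x, F t with hG
  have hGd : ∀ x, HasDerivAt G (F x) x := fun x =>
    (hFc.integral_hasStrictDerivAt 0 x).hasDerivAt.const_add _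
  have hsub : ∀ x ∈ Icc l r, deriv (deriv z) x = G x := fun x hx =>
    h.second x ⟨hl.trans hx.1, hx.2.trans hr⟩
  have h1 : ∫ x in l..r, deriv (deriv z) x * deriv (deriv φ) x =
      ∫ x in l..r, G x * deriv (deriv φ) x := by
    refine intervalIntegral.integral_congr fun x hx => ?_
    rw [uIcc_of_le hlr] at hx
    simp only [hsub x hx]
  have h2 := intervalIntegral.integral_mul_deriv_eq_deriv_mul (a := l) (b := r) (fun x _ => hGd x)
    (fun x _ => hφ2 x) (hFc.intervalIntegrable _ _) (hφc2.intervalIntegrable _ _)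
  have h3 := integral_mul_eq_sub_of_hasDerivAt hlr hf hφ1 hφc1
  have h4 : ∀ t, ∫ s in l..t, f s ∂μ = F t - F l := fun t => by
    rw [hF, integral_interval_sub_left hf.intervalIntegrable hf.intervalIntegrable]
  simp only [h4] at h3
  have h5 : ∫ t in l..r, deriv φ t * (F t - F l) =
      (∫ t in l..r, F t * deriv φ t) - F l * (φ r - φ l) := by
    have h6 := intervalIntegral.integral_sub ((hFc.mul hφc1).intervalIntegrable l r (μ := volume))
      ((continuous_const (y := F l).mul hφc1).intervalIntegrable l r)
    simp only [Pi.mul_apply, intervalIntegral.integral_const_mul] at h6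
    rw [← intervalIntegral.integral_eq_sub_of_hasDerivAt (fun x _ => hφ1 x)
      (hφc1.intervalIntegrable _ _), ← h6]
    congr 1; ext t; ring
  rw [h1, h2, h3, h5, hsub l ⟨le_rfl, hlr⟩, hsub r ⟨hlr, le_rfl⟩]
  change _ = (G r * deriv φ r - F r * φ r) - (G l * deriv φ l - F l * φ l) + _
  ring

theorem IsWeakSol.weak_form (h : IsWeakSol μ β f z) (hf : Integrable f μ) (hφ : ContDiff ℝ 2 φ) :
    (∫ x in (0 : ℝ)..1, deriv (deriv z) x * deriv (deriv φ) x) +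
      β * (deriv z 0 * deriv φ 0 + deriv z 1 * deriv φ 1) = ∫ s in (0 : ℝ)..1, f s * φ s ∂μ := by
  rw [h.integral_second_mul hf hφ le_rfl zero_le_one le_rfl, h.mean, h.left, h.right,
    intervalIntegral.integral_same]
  ring

end Solution

open scoped RealInnerProductSpace in
/-- Variational upper bound for the quadratic form of a compact symmetric operator whose eigenvectors
for nonzero eigenvalues are all proportional to members of the orthonormal sequence `e`. -/
theorem inner_le_of_isCompactOperator {E : Type*} [NormedAddCommGroup E] [InnerProductSpace ℝ E]
    [CompleteSpace E] {T : E →L[ℝ] E} (hTc : IsCompactOperator T)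
    (hTs : (T : E →ₗ[ℝ] E).IsSymmetric) {e : ℕ → E} (he : Orthonormal ℝ e) {ν : ℕ → ℝ}
    (hν : Antitone ν) (hpos : ∀ i, 0 < ν i)
    (hev : ∀ c f, c ≠ 0 → f ≠ 0 → T f = c • f → ∃ j, c = ν j ∧ ∃ r : ℝ, f = r • e j)
    (i : ℕ) {f : E} (hf : ∀ j < i, ⟪e j, f⟫ = 0) : ⟪T f, f⟫ ≤ ν i * ‖f‖ ^ 2 := by
  set G : Set ℕ := {j | T (e j) = ν j • e j} with hG
  have htop : (LinearMap.ker (T : E →ₗ[ℝ] E) ⊔ Submodule.span ℝ (e '' G)).topologicalClosure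
      = ⊤ := by
    rw [← Submodule.topologicalClosure_eq_top_iff.2
      (T.orthogonalComplement_iSup_eigenspaces_eq_bot hTc hTs)]
    refine le_antisymm (by
      rw [Submodule.topologicalClosure_eq_top_iff.2
        (T.orthogonalComplement_iSup_eigenspaces_eq_bot hTc hTs)]
      exact le_top) (Submodule.topologicalClosure_mono (iSup_le fun c g hg => ?_))
    rw [Module.End.mem_eigenspace_iff] at hg
    replace hg : T g = c • g := hg
    by_cases hc : c = 0
    · refine Submodule.mem_sup_left ?_
      simp [LinearMap.mem_ker, hg, hc]
    by_cases hg0 : g = 0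
    · simp [hg0]
    obtain ⟨j, hcj, r, rfl⟩ := hev c g hc hg0 hg
    refine Submodule.mem_sup_right (Submodule.smul_mem _ _ (Submodule.subset_span ⟨j, ?_, rfl⟩))
    have hr : r ≠ 0 := fun h => hg0 (by simp [h])
    rw [map_smul, smul_comm] at hg
    rw [hG, mem_ofPred_eq, ← hcj]
    exact smul_right_injective E hr hg
  have hclosed : IsClosed {g : E | ⟪T g, g⟫ ≤ ν i * ‖g‖ ^ 2 +
      ν 0 * ∑ j ∈ Finset.range i, ⟪e j, g⟫ ^ 2} := by
    refine isClosed_le (by fun_prop) (by fun_prop)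
  have hall : ∀ g : E, ⟪T g, g⟫ ≤ ν i * ‖g‖ ^ 2 +
      ν 0 * ∑ j ∈ Finset.range i, ⟪e j, g⟫ ^ 2 := by
    intro g
    have hg : g ∈ closure
        ((LinearMap.ker (T : E →ₗ[ℝ] E) ⊔ Submodule.span ℝ (e '' G) : Submodule ℝ E) : Set E) := by
      rw [← Submodule.topologicalClosure_coe, htop]; trivial
    refine (closure_minimal ?_ hclosed) hg
    intro g hg
    obtain ⟨a, ha, b, hb, rfl⟩ := Submodule.mem_sup.1 hg
    replace ha : T a = 0 := ha
    obtain ⟨c, hcG, rfl⟩ := (Finsupp.mem_span_image_iff_linearCombination ℝ).1 hb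
    rw [Finsupp.mem_supported] at hcG
    rw [Finsupp.linearCombination_apply, Finsupp.sum]
    set s := c.support
    have hTe : ∀ j ∈ s, T (e j) = ν j • e j := fun j hj => hcG hj
    have hae : ∀ j ∈ s, ⟪e j, a⟫ = 0 := by
      intro j hj
      have h1 : ⟪T (e j), a⟫ = ⟪e j, T a⟫ := hTs (e j) a
      rw [hTe j hj, ha, inner_zero_right, real_inner_smul_left] at h1
      exact (mul_eq_zero.1 h1).resolve_left (hpos j).ne'
    have hsa : ⟪∑ j ∈ s, c j • e j, a⟫ = 0 := by
      rw [sum_inner]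
      exact Finset.sum_eq_zero fun j hj => by rw [real_inner_smul_left, hae j hj, mul_zero]
    have hej : ∀ j ∈ s, ⟪e j, a + ∑ k ∈ s, c k • e k⟫ = c j := by
      intro j hj
      rw [inner_add_right, hae j hj, he.inner_right_sum c hj, zero_add]
    have hTf : T (a + ∑ j ∈ s, c j • e j) = ∑ j ∈ s, (c j * ν j) • e j := by
      rw [map_add, ha, zero_add, map_sum]
      exact Finset.sum_congr rfl fun j hj => by rw [map_smul, hTe j hj, smul_smul]
    have h1 : ⟪T (a + ∑ j ∈ s, c j • e j), a + ∑ j ∈ s, c j • e j⟫ = ∑ j ∈ s, ν j * c j ^ 2 := by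
      rw [hTf, sum_inner]
      refine Finset.sum_congr rfl fun j hj => ?_
      rw [real_inner_smul_left, hej j hj]; ring
    have h2 : ‖a + ∑ j ∈ s, c j • e j‖ ^ 2 = ‖a‖ ^ 2 + ∑ j ∈ s, c j ^ 2 := by
      rw [norm_add_sq_real, real_inner_comm, hsa, ← real_inner_self_eq_norm_sq
        (∑ j ∈ s, c j • e j), he.inner_sum]
      simp [pow_two]
    rw [mem_ofPred_eq, h1, h2]
    have h3 : ∑ j ∈ s, ν j * c j ^ 2 ≤
        ∑ j ∈ s, (ν i * c j ^ 2 + ν 0 * if j < i then c j ^ 2 else 0) := by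
      refine Finset.sum_le_sum fun j _ => ?_
      have hsq := sq_nonneg (c j)
      split_ifs with hji
      · have := mul_le_mul_of_nonneg_right (hν (Nat.zero_le j)) hsq
        have := mul_nonneg (hpos i).le hsq
        linarith
      · have := mul_le_mul_of_nonneg_right (hν (not_lt.1 hji)) hsq
        linarith
    rw [Finset.sum_add_distrib, ← Finset.mul_sum, ← Finset.mul_sum, ← Finset.sum_filter] at h3
    have h4 : ∑ j ∈ s with j < i, c j ^ 2 ≤
        ∑ j ∈ Finset.range i, ⟪e j, a + ∑ k ∈ s, c k • e k⟫ ^ 2 := by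
      calc _ = ∑ j ∈ s with j < i, ⟪e j, a + ∑ k ∈ s, c k • e k⟫ ^ 2 :=
            Finset.sum_congr rfl fun j hj => by rw [hej j (Finset.mem_filter.1 hj).1]
        _ ≤ _ := Finset.sum_le_sum_of_subset_of_nonneg
            (fun j hj => Finset.mem_range.2 (Finset.mem_filter.1 hj).2) fun _ _ _ => sq_nonneg _
    have h5 := mul_le_mul_of_nonneg_left h4 (hpos 0).le
    have h6 := mul_nonneg (hpos i).le (sq_nonneg ‖a‖)
    linarith
  refine (hall f).trans_eq ?_
  rw [Finset.sum_eq_zero fun j hj => by rw [hf j (Finset.mem_range.1 hj)]; norm_num]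
  ring

section LipschitzOperator

open MeasureTheory

/-- A linear map from `L²(μ)` to functions that are Lipschitz on `[0,1]` with controlled constant
induces a compact operator on `L²(μ)`. -/
theorem exists_isCompactOperator_of_lipschitz {μ : Measure ℝ} [IsProbabilityMeasure μ]
    (hμ : ∀ᵐ x ∂μ, x ∈ Ioc (0 : ℝ) 1) (A : Lp ℝ 2 μ →ₗ[ℝ] (ℝ → ℝ)) (hc : ∀ f, Continuous (A f))
    (h0 : ∀ f, A f 0 = 0) {L : ℝ} (hL : 0 ≤ L)
    (hA : ∀ f, ∀ x ∈ Icc (0 : ℝ) 1, ∀ y ∈ Icc (0 : ℝ) 1, |A f x - A f y| ≤ L * ‖f‖ * |x - y|) :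
    ∃ T : Lp ℝ 2 μ →L[ℝ] Lp ℝ 2 μ, IsCompactOperator T ∧ ∀ f, T f =ᵐ[μ] A f := by
  have hbd : ∀ f, ∀ x ∈ Icc (0 : ℝ) 1, |A f x| ≤ L * ‖f‖ := fun f x hx => by
    have := hA f x hx 0 ⟨le_rfl, zero_le_one⟩
    rw [h0, sub_zero, sub_zero, abs_of_nonneg hx.1] at this
    exact this.trans (mul_le_of_le_one_right (by positivity) hx.2)
  have hmem : ∀ f, MemLp (A f) 2 μ := fun f =>
    MemLp.of_bound (hc f).aestronglyMeasurable (L * ‖f‖)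
      (hμ.mono fun x hx => hbd f x ⟨hx.1.le, hx.2⟩)
  have hnorm : ∀ (g : Lp ℝ 2 μ) {C : ℝ}, 0 ≤ C → (∀ᵐ x ∂μ, |g x| ≤ C) → ‖g‖ ≤ C := fun g C h h' => by
    simpa [measureUnivNNReal] using Lp.norm_le_of_ae_bound (f := g) h (by simpa using h')
  let T₀ : Lp ℝ 2 μ →ₗ[ℝ] Lp ℝ 2 μ :=
    { toFun := fun f => (hmem f).toLp
      map_add' := fun f g => by
        rw [← MemLp.toLp_add]
        exact MemLp.toLp_congr _ _ (by rw [map_add])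
      map_smul' := fun r f => by
        rw [RingHom.id_apply, ← MemLp.toLp_const_smul]
        exact MemLp.toLp_congr _ _ (by rw [map_smul]) }
  have hT₀ : ∀ f, T₀ f =ᵐ[μ] A f := fun f => (hmem f).coeFn_toLp
  let T : Lp ℝ 2 μ →L[ℝ] Lp ℝ 2 μ := T₀.mkContinuous L fun f =>
    hnorm _ (by positivity) (by
      filter_upwards [hT₀ f, hμ] with x hx hx1
      rw [hx]; exact hbd f x ⟨hx1.1.le, hx1.2⟩)
  refine ⟨T, ?_, hT₀⟩
  let ev : ∀ x : ℝ, x ∈ Icc (0 : ℝ) 1 → (Lp ℝ 2 μ →L[ℝ] ℝ) := fun x hx =>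
    ((LinearMap.proj x : (ℝ → ℝ) →ₗ[ℝ] ℝ) ∘ₗ A).mkContinuous L fun f => hbd f x hx
  have hdiv : ∀ (n : ℕ) (k : Fin n), ((k : ℕ) : ℝ) / n ∈ Icc (0 : ℝ) 1 := fun n k => by
    have : (0 : ℝ) < n := by exact_mod_cast k.pos
    exact ⟨by positivity, by rw [div_le_one this]; exact_mod_cast k.2.le⟩
  let χ : ∀ n : ℕ, Fin n → Lp ℝ 2 μ := fun n k => indicatorConstLp 2
    (measurableSet_Ioc : MeasurableSet (Ioc ((k : ℝ) / n) (((k : ℝ) + 1) / n)))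
    (measure_ne_top μ _) 1
  let Tn : ℕ → (Lp ℝ 2 μ →L[ℝ] Lp ℝ 2 μ) := fun n =>
    ∑ k : Fin n, (ev _ (hdiv n k)).smulRight (χ n k)
  have hTnc : ∀ n, IsCompactOperator (Tn n) := fun n => by
    simp only [Tn]
    refine Finset.sum_induction _ (fun S : Lp ℝ 2 μ →L[ℝ] Lp ℝ 2 μ => IsCompactOperator S)
      (fun S S' h h' => by simpa using h.add h') (by simpa using isCompactOperator_zero)
      fun k _ => ?_
    exact (isCompactOperator_of_locallyCompactSpace_rng
      ((ContinuousLinearMap.id ℝ ℝ).smulRight (χ n k))).comp_clm (ev _ (hdiv n k))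
  have hTn : ∀ n f, (Tn n f : ℝ → ℝ) =ᵐ[μ] fun x => ∑ k : Fin n,
      (Ioc ((k : ℝ) / n) (((k : ℝ) + 1) / n)).indicator (fun _ => A f ((k : ℝ) / n)) x := by
    intro n f
    have : ∀ s : Finset (Fin n), ((∑ k ∈ s, A f ((k : ℝ) / n) • χ n k : Lp ℝ 2 μ) : ℝ → ℝ) =ᵐ[μ]
        fun x => ∑ k ∈ s, (Ioc ((k : ℝ) / n) (((k : ℝ) + 1) / n)).indicator
          (fun _ => A f ((k : ℝ) / n)) x := by
      intro s
      induction s using Finset.cons_induction with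
      | empty =>
        simp only [Finset.sum_empty]
        exact Lp.coeFn_zero ℝ 2 μ
      | cons k s hk ih =>
        rw [Finset.sum_cons]
        filter_upwards [ih, Lp.coeFn_add (A f ((k : ℝ) / n) • χ n k)
          (∑ k ∈ s, A f ((k : ℝ) / n) • χ n k), Lp.coeFn_smul (A f ((k : ℝ) / n)) (χ n k),
          indicatorConstLp_coeFn (p := 2) (c := (1 : ℝ)) (μ := μ)
            (hs := (measurableSet_Ioc : MeasurableSet (Ioc ((k : ℝ) / n) (((k : ℝ) + 1) / n))))
            (hμs := measure_ne_top μ _)] with x h1 h2 h3 h4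
        rw [h2, Pi.add_apply, h1, h3, Finset.sum_cons, Pi.smul_apply]
        simp only [χ]
        rw [h4]
        simp [indicator_apply]
    have h2 : Tn n f = ∑ k : Fin n, A f ((k : ℝ) / n) • χ n k := by
      simp only [Tn, _root_.sum_apply]
      rfl
    rw [h2]
    exact this Finset.univ
  refine isCompactOperator_of_tendsto (l := atTop) (F := fun n => Tn (n + 1)) ?_
    (Eventually.of_forall fun n => hTnc _)
  rw [tendsto_iff_norm_sub_tendsto_zero]
  refine squeeze_zero (fun _ => norm_nonneg _) (fun n => ?_)
    (tendsto_const_div_atTop_nhds_zero_nat L |>.comp (tendsto_add_atTop_nat 1))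
  refine ContinuousLinearMap.opNorm_le_bound _ (by simp; positivity) fun f => ?_
  refine hnorm _ (by simp; positivity) ?_
  filter_upwards [hTn (n + 1) f, hT₀ f, hμ, Lp.coeFn_sub (Tn (n + 1) f) (T f)] with x h1 h2 h3 h4
  change |(Tn (n + 1) f - T f : Lp ℝ 2 μ) x| ≤ _
  rw [h4, Pi.sub_apply, h1, show (T f : ℝ → ℝ) x = A f x from h2]
  have hn : (0 : ℝ) < ((n + 1 : ℕ) : ℝ) := by positivity
  set m : ℕ := n + 1 with hm
  have hceil : 0 < ⌈x * m⌉₊ := Nat.ceil_pos.2 (mul_pos h3.1 hn)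
  have hceil' : ⌈x * m⌉₊ ≤ m := Nat.ceil_le.2 (mul_le_of_le_one_left hn.le h3.2)
  obtain ⟨k, hk⟩ : ∃ k, ⌈x * m⌉₊ = k + 1 := ⟨_, (Nat.succ_pred_eq_of_pos hceil).symm⟩
  have hkm : k < m := by omega
  obtain ⟨hk1, hk2⟩ := (Nat.ceil_eq_iff (by omega)).1 hk
  have hxk : x ∈ Ioc ((k : ℝ) / m) (((k : ℝ) + 1) / m) := by
    rw [mem_Ioc, div_lt_iff₀ hn, le_div_iff₀ hn]
    exact ⟨by simpa using hk1, by simpa using hk2⟩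
  rw [Finset.sum_eq_single (⟨k, hkm⟩ : Fin m), indicator_of_mem hxk]
  · refine (hA f _ (hdiv m ⟨k, hkm⟩) x ⟨h3.1.le, h3.2⟩).trans ?_
    have : |(k : ℝ) / m - x| ≤ 1 / m := by
      rw [abs_sub_comm, abs_of_pos (sub_pos.2 hxk.1)]
      have := hxk.2
      rw [add_div] at this
      linarith
    calc L * ‖f‖ * |(k : ℝ) / m - x| ≤ L * ‖f‖ * (1 / m) := by gcongr
      _ = L / m * ‖f‖ := by ring
  · rintro ⟨j, hj⟩ - hjk
    refine indicator_of_notMem (fun hx => hjk ?_) _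
    simp only [mem_Ioc, div_lt_iff₀ hn, le_div_iff₀ hn] at hx
    have : ⌈x * m⌉₊ = j + 1 := (Nat.ceil_eq_iff (by omega)).2 ⟨by simpa using hx.1, by simpa using hx.2⟩
    simp only [Fin.mk.injEq]
    omega
  · simp

end LipschitzOperator

section Solver

open MeasureTheory intervalIntegral

/-- The primitive of `g` vanishing at `0`. -/
noncomputable def prim (g : ℝ → ℝ) (x : ℝ) : ℝ := ∫ t in (0 : ℝ)..x, g t

theorem hasDerivAt_prim {g : ℝ → ℝ} (hg : Continuous g) (x : ℝ) : HasDerivAt (prim g) (g x) x :=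
  (hg.integral_hasStrictDerivAt 0 x).hasDerivAt

theorem continuous_prim {g : ℝ → ℝ} (hg : Continuous g) : Continuous (prim g) :=
  continuous_iff_continuousAt.2 fun x => (hasDerivAt_prim hg x).continuousAt

theorem prim_add {g h : ℝ → ℝ} (hg : Continuous g) (hh : Continuous h) :
    prim (g + h) = prim g + prim h :=
  funext fun x => integral_add (hg.intervalIntegrable 0 x) (hh.intervalIntegrable 0 x)

theorem prim_smul (r : ℝ) (g : ℝ → ℝ) : prim (r • g) = r • prim g :=
  funext fun _ => intervalIntegral.integral_smul r g

@[simp] theorem prim_zero_right (g : ℝ → ℝ) : prim g 0 = 0 := integral_same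

theorem abs_prim_le {g : ℝ → ℝ} {N x : ℝ} (hg : ∀ t ∈ Icc (0 : ℝ) 1, |g t| ≤ N)
    (hx : x ∈ Icc (0 : ℝ) 1) : |prim g x| ≤ N := by
  have h := norm_integral_le_of_norm_le_const (a := 0) (b := x) (f := g) (C := N) fun t ht => by
    rw [uIoc_of_le hx.1] at ht
    exact hg t ⟨ht.1.le, ht.2.trans hx.2⟩
  have hN : 0 ≤ N := (abs_nonneg _).trans (hg 0 ⟨le_rfl, zero_le_one⟩)
  rw [sub_zero, abs_of_nonneg hx.1] at h
  exact h.trans (mul_le_of_le_one_right hN hx.2)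

theorem contDiff_two_of_hasDerivAt {z z' z'' : ℝ → ℝ} (h1 : ∀ x, HasDerivAt z (z' x) x)
    (h2 : ∀ x, HasDerivAt z' (z'' x) x) (hc : Continuous z'') : ContDiff ℝ 2 z := by
  have e1 : deriv z = z' := funext fun x => (h1 x).deriv
  have e2 : deriv z' = z'' := funext fun x => (h2 x).deriv
  rw [show (2 : WithTop ℕ∞) = 1 + 1 by norm_num, contDiff_succ_iff_deriv, e1, contDiff_one_iff_deriv,
    e2]
  exact ⟨fun x => (h1 x).differentiableAt, by simp, fun x => (h2 x).differentiableAt, hc⟩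

/-- The function `x ↦ ∫_{(0,x]} f dμ`. -/
noncomputable def cumulative (μ : Measure ℝ) (f : ℝ → ℝ) (x : ℝ) : ℝ := ∫ s in (0 : ℝ)..x, f s ∂μ

/-- The initial slope of `solve μ β f`. -/
noncomputable def solveSlope (μ : Measure ℝ) (β : ℝ) (f : ℝ → ℝ) : ℝ :=
  -(prim (cumulative μ f) 1 + β * prim (prim (cumulative μ f)) 1) / (2 * β + β ^ 2)

/-- The weak solution of `z'''' = f μ` with `z 0 = 0`, for `f` of mean zero. -/
noncomputable def solve (μ : Measure ℝ) (β : ℝ) (f : ℝ → ℝ) (x : ℝ) : ℝ :=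
  solveSlope μ β f * (x + β * x ^ 2 / 2) + prim (prim (prim (cumulative μ f))) x

theorem solve_congr_ae {μ : Measure ℝ} {f g : ℝ → ℝ} (β : ℝ) (h : f =ᵐ[μ] g) :
    solve μ β f = solve μ β g := by
  have : cumulative μ f = cumulative μ g := funext fun x =>
    integral_congr_ae (h.mono fun _ h _ => h)
  unfold solve solveSlope
  rw [this]

theorem solve_smul (μ : Measure ℝ) (β r : ℝ) (f : ℝ → ℝ) : solve μ β (r • f) = r • solve μ β f := by
  have h : cumulative μ (r • f) = r • cumulative μ f := funext fun x =>
    intervalIntegral.integral_smul r f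
  ext x
  simp only [solve, solveSlope, h, prim_smul, Pi.smul_apply, smul_eq_mul]
  ring

theorem continuous_cumulative' {μ : Measure ℝ} [NullSingletonClass μ] {f : ℝ → ℝ}
    (hf : Integrable f μ) : Continuous (cumulative μ f) :=
  continuous_cumulative hf 0

theorem solve_add {μ : Measure ℝ} [NullSingletonClass μ] {f g : ℝ → ℝ} (β : ℝ)
    (hf : Integrable f μ) (hg : Integrable g μ) :
    solve μ β (f + g) = solve μ β f + solve μ β g := by
  have c0 := continuous_cumulative' hf
  have c0' := continuous_cumulative' hg
  have h : cumulative μ (f + g) = cumulative μ f + cumulative μ g := funext fun x =>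
    integral_add hf.intervalIntegrable hg.intervalIntegrable
  have c1 := continuous_prim c0
  have c1' := continuous_prim c0'
  ext x
  simp only [solve, solveSlope, h, prim_add c0 c0', prim_add c1 c1',
    prim_add (continuous_prim c1) (continuous_prim c1'), Pi.add_apply]
  ring

variable {μ : Measure ℝ} [NullSingletonClass μ] {β : ℝ} {f : ℝ → ℝ}

theorem solve_hasDerivAt (β : ℝ) (hf : Integrable f μ) :
    (∀ x, HasDerivAt (solve μ β f)
      (solveSlope μ β f * (1 + β * x) + prim (prim (cumulative μ f)) x) x) ∧
    (∀ x, HasDerivAt (fun x => solveSlope μ β f * (1 + β * x) + prim (prim (cumulative μ f)) x)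
      (solveSlope μ β f * β + prim (cumulative μ f) x) x) := by
  have c0 := continuous_cumulative' hf
  have c1 := continuous_prim c0
  have c2 := continuous_prim c1
  refine ⟨fun x => ?_, fun x => ?_⟩
  · have : HasDerivAt (fun x : ℝ => solveSlope μ β f * (x + β * x ^ 2 / 2))
        (solveSlope μ β f * (1 + β * x)) x := by
      refine HasDerivAt.const_mul _ (HasDerivAt.add (hasDerivAt_id x) ?_)
      have := ((hasDerivAt_pow 2 x).const_mul β).div_const 2
      exact this.congr_deriv (by norm_num; ring)
    exact this.add (hasDerivAt_prim c2 x)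
  · have : HasDerivAt (fun x : ℝ => solveSlope μ β f * (1 + β * x)) (solveSlope μ β f * β) x := by
      refine HasDerivAt.const_mul _ ?_
      simpa using ((hasDerivAt_id x).const_mul β).const_add 1
    exact this.add (hasDerivAt_prim c1 x)

theorem continuous_solve (β : ℝ) (hf : Integrable f μ) : Continuous (solve μ β f) :=
  continuous_iff_continuousAt.2 fun x => ((solve_hasDerivAt β hf).1 x).continuousAt

@[simp] theorem solve_zero_right (μ : Measure ℝ) (β : ℝ) (f : ℝ → ℝ) : solve μ β f 0 = 0 := by
  simp [solve]

theorem isWeakSol_solve (hβ : 0 < β) (hf : Integrable f μ) (h0 : ∫ s in (0 : ℝ)..1, f s ∂μ = 0)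
    (c : ℝ) : IsWeakSol μ β f fun x => solve μ β f x + c := by
  obtain ⟨h1, h2⟩ := solve_hasDerivAt β hf
  have c0 := continuous_cumulative' hf
  replace h1 := fun x => (h1 x).add_const c
  have e1 := funext fun x => (h1 x).deriv
  have e2 := funext fun x => (h2 x).deriv
  refine ⟨contDiff_two_of_hasDerivAt h1 h2 (by
    have := continuous_prim c0
    fun_prop), ?_, h0, ?_, ?_⟩
  · intro x _
    rw [e1, e2]
    simp only [prim_zero_right, add_zero]
    rfl
  · rw [e1, e2]; simp; ring
  · rw [e1, e2, solveSlope]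
    simp only
    have : 0 < 2 * β + β ^ 2 := by positivity
    field_simp
    ring

theorem exists_lipschitz_solve (μ : Measure ℝ) [IsFiniteMeasure μ] [NullSingletonClass μ]
    (hβ : 0 < β) : ∃ L, 0 ≤ L ∧ ∀ f, Integrable f μ →
    ∀ x ∈ Icc (0 : ℝ) 1, ∀ y ∈ Icc (0 : ℝ) 1,
      |solve μ β f x - solve μ β f y| ≤ L * (∫ s, |f s| ∂μ) * |x - y| := by
  have hD : 0 < 2 * β + β ^ 2 := by positivity
  refine ⟨(1 + β) / (2 * β + β ^ 2) * (1 + β) + 1, by positivity, fun f hf x hx y hy => ?_⟩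
  set N := ∫ s, |f s| ∂μ with hN
  have b0 : ∀ t ∈ Icc (0 : ℝ) 1, |cumulative μ f t| ≤ N := fun t ht => by
    rw [cumulative, integral_of_le ht.1]
    exact (MeasureTheory.norm_integral_le_integral_norm _).trans
      (setIntegral_le_integral hf.norm (ae_of_all _ fun s => norm_nonneg _))
  have b1 : ∀ t ∈ Icc (0 : ℝ) 1, _ := fun t ht => abs_prim_le b0 ht
  have b2 : ∀ t ∈ Icc (0 : ℝ) 1, _ := fun t ht => abs_prim_le b1 ht
  have h1 : (1 : ℝ) ∈ Icc (0 : ℝ) 1 := ⟨zero_le_one, le_rfl⟩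
  have hp : |solveSlope μ β f| ≤ (1 + β) / (2 * β + β ^ 2) * N := by
    rw [solveSlope, abs_div, abs_neg, abs_of_pos hD, div_mul_eq_mul_div]
    gcongr
    calc _ ≤ |prim (cumulative μ f) 1| + β * |prim (prim (cumulative μ f)) 1| := by
          simpa [abs_mul, abs_of_pos hβ] using
            abs_add_le (prim (cumulative μ f) 1) (β * prim (prim (cumulative μ f)) 1)
      _ ≤ N + β * N := by gcongr <;> [exact b1 1 h1; exact b2 1 h1]
      _ = (1 + β) * N := by ring
  have := Convex.norm_image_sub_le_of_norm_hasDerivWithin_le (s := Icc (0 : ℝ) 1)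
    (C := ((1 + β) / (2 * β + β ^ 2) * (1 + β) + 1) * N)
    (fun t _ => ((solve_hasDerivAt β hf).1 t).hasDerivWithinAt) (fun t ht => ?_) (convex_Icc _ _)
    hy hx
  · exact this
  · have ht' : |1 + β * t| ≤ 1 + β := by
      rw [abs_of_nonneg (by have := mul_nonneg hβ.le ht.1; linarith)]
      have := mul_le_of_le_one_right hβ.le ht.2
      linarith
    calc _ ≤ |solveSlope μ β f| * |1 + β * t| + |prim (prim (cumulative μ f)) t| := by
          rw [← abs_mul]; exact abs_add_le _ _
      _ ≤ ((1 + β) / (2 * β + β ^ 2) * N) * (1 + β) + N := by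
          gcongr
          exact b2 t ht
      _ = _ := by ring

end Solver

section SolveBound

open MeasureTheory

theorem intervalIntegral_zero_one_eq {μ : Measure ℝ} (hμ : ∀ᵐ x ∂μ, x ∈ Ioc (0 : ℝ) 1)
    (g : ℝ → ℝ) : ∫ s in (0 : ℝ)..1, g s ∂μ = ∫ s, g s ∂μ := by
  rw [intervalIntegral.integral_of_le zero_le_one, Measure.restrict_eq_self_of_ae_mem hμ]

theorem IsWeakSol.congr_ae {μ : Measure ℝ} {β : ℝ} {f g z : ℝ → ℝ} (h : IsWeakSol μ β f z)
    (hfg : f =ᵐ[μ] g) : IsWeakSol μ β g z := by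
  have : ∀ t, ∫ s in (0 : ℝ)..t, f s ∂μ = ∫ s in (0 : ℝ)..t, g s ∂μ := fun t =>
    intervalIntegral.integral_congr_ae (hfg.mono fun _ h _ => h)
  refine ⟨h.contDiff, fun x hx => ?_, (this 1).symm.trans h.mean, h.left, h.right⟩
  simp only [← this]
  exact h.second x hx

open scoped RealInnerProductSpace in
theorem L2_inner_eq_integral {μ : Measure ℝ} {f g : Lp ℝ 2 μ} {F G : ℝ → ℝ} (hf : f =ᵐ[μ] F)
    (hg : g =ᵐ[μ] G) : ⟪f, g⟫ = ∫ s, F s * G s ∂μ := by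
  rw [L2.inner_def]
  refine integral_congr_ae ?_
  filter_upwards [hf, hg] with x h1 h2
  rw [h1, h2]
  simp [mul_comm]

open scoped RealInnerProductSpace in
/-- If the eigenfunctions `V j` exhaust the positive spectrum, then the solution operator is bounded
by `1 / lam i` on functions orthogonal to the constants and to `V 0, …, V (i - 1)`. -/
theorem integral_solve_mul_le {μ : Measure ℝ} [IsProbabilityMeasure μ] [NullSingletonClass μ]
    (hμ : ∀ᵐ x ∂μ, x ∈ Ioc (0 : ℝ) 1) {β : ℝ} (hβ : 0 < β) {V : ℕ → ℝ → ℝ} {lam : ℕ → ℝ}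
    (hpos : ∀ j, 0 < lam j) (hmono : Monotone lam) (hV : ∀ j, MemLp (V j) 2 μ)
    (horth : ∀ i j, ∫ s, V i s * V j s ∂μ = if i = j then 1 else 0)
    (hcomp : ∀ c z, 0 < c → IsWeakSol μ β (c • z) z → (∃ x ∈ Icc (0 : ℝ) 1, z x ≠ 0) →
      ∃ j, c = lam j ∧ ∃ r : ℝ, ∀ x ∈ Icc (0 : ℝ) 1, z x = r * V j x)
    (i : ℕ) {f : ℝ → ℝ} (hf : MemLp f 2 μ) (hf0 : ∫ s, f s ∂μ = 0)
    (hfV : ∀ j < i, ∫ s, V j s * f s ∂μ = 0) :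
    ∫ s, solve μ β f s * f s ∂μ ≤ (lam i)⁻¹ * ∫ s, f s ^ 2 ∂μ := by
  have hint : ∀ f : Lp ℝ 2 μ, Integrable f μ := fun f => (Lp.memLp f).integrable (by norm_num)
  obtain ⟨L, hL, hLip⟩ := exists_lipschitz_solve μ hβ
  have hN : ∀ f : Lp ℝ 2 μ, ∫ s, |f s| ∂μ ≤ ‖f‖ := fun f => by
    have h1 := Lp.memLp f
    have h2 := eLpNorm_le_eLpNorm_of_exponent_le (p := 1) (q := 2) (by norm_num) h1.1
    have h3 := ENNReal.toReal_mono h1.2.ne h2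
    rw [eLpNorm_one_eq_lintegral_enorm, ← integral_norm_eq_lintegral_enorm h1.1] at h3
    exact h3
  let A : Lp ℝ 2 μ →ₗ[ℝ] (ℝ → ℝ) :=
    { toFun := fun f => solve μ β f
      map_add' := fun f g => by
        rw [solve_congr_ae β (Lp.coeFn_add f g), solve_add β (hint f) (hint g)]
      map_smul' := fun r f => by
        rw [solve_congr_ae β (Lp.coeFn_smul r f), solve_smul, RingHom.id_apply] }
  obtain ⟨S, hSc, hS⟩ := exists_isCompactOperator_of_lipschitz hμ A
    (fun f => continuous_solve β (hint f)) (fun f => solve_zero_right _ _ _) hL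
    (fun f x hx y hy => (hLip f (hint f) x hx y hy).trans (by gcongr; exact hN f))
  change ∀ f : Lp ℝ 2 μ, S f =ᵐ[μ] solve μ β f at hS
  let one : Lp ℝ 2 μ := (memLp_const (1 : ℝ)).toLp
  have hone : one =ᵐ[μ] fun _ => 1 := MemLp.coeFn_toLp _
  have hone_norm : ⟪one, one⟫ = 1 := by rw [L2_inner_eq_integral hone hone]; simp
  let R : Lp ℝ 2 μ →L[ℝ] Lp ℝ 2 μ :=
    ContinuousLinearMap.id ℝ _ - (innerSL ℝ one).smulRight one
  have hR : ∀ f, R f = f - ⟪one, f⟫ • one := fun f => rfl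
  have hRid : ∀ f, ⟪one, f⟫ = 0 → R f = f := fun f h => by rw [hR, h, zero_smul, sub_zero]
  have hRorth : ∀ f, ⟪one, R f⟫ = 0 := fun f => by
    rw [hR, inner_sub_right, inner_smul_right, hone_norm, mul_one, sub_self]
  have hRsymm : ∀ f g, ⟪R f, g⟫ = ⟪f, R g⟫ := fun f g => by
    rw [hR, hR, inner_sub_left, inner_sub_right, inner_smul_left, inner_smul_right,
      real_inner_comm one f]
    simp [mul_comm]
  have hmean : ∀ f : Lp ℝ 2 μ, ⟪one, f⟫ = 0 → ∫ s in (0 : ℝ)..1, f s ∂μ = 0 := fun f h => by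
    rw [intervalIntegral_zero_one_eq hμ]
    simpa [L2_inner_eq_integral hone (ae_eq_refl f)] using h
  have hweak : ∀ f : Lp ℝ 2 μ, ⟪one, f⟫ = 0 → ∀ c, IsWeakSol μ β f fun x => solve μ β f x + c :=
    fun f h c => isWeakSol_solve hβ (hint f) (hmean f h) c
  have hSsymm : ∀ f g : Lp ℝ 2 μ, ⟪one, f⟫ = 0 → ⟪one, g⟫ = 0 → ⟪S f, g⟫ = ⟪f, S g⟫ := by
    intro f g h h'
    have w := hweak f h 0
    have w' := hweak g h' 0
    simp only [add_zero] at w w'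
    have e := w.weak_form (hint f) w'.contDiff
    have e' := w'.weak_form (hint g) w.contDiff
    rw [intervalIntegral_zero_one_eq hμ] at e e'
    rw [real_inner_comm, L2_inner_eq_integral (ae_eq_refl g) (hS f),
      L2_inner_eq_integral (ae_eq_refl f) (hS g)]
    change ∫ s, g s * solve μ β f s ∂μ = ∫ s, f s * solve μ β g s ∂μ
    rw [← e, ← e']
    congr 1
    · congr 1; ext x; ring
    · ring
  let T : Lp ℝ 2 μ →L[ℝ] Lp ℝ 2 μ := R.comp (S.comp R)
  have hT : ∀ f, T f = R (S (R f)) := fun f => rfl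
  have hTc : IsCompactOperator T := (hSc.comp_clm R).clm_comp R
  have hTs : (T : Lp ℝ 2 μ →ₗ[ℝ] Lp ℝ 2 μ).IsSymmetric := fun f g => by
    change ⟪R (S (R f)), g⟫ = ⟪f, R (S (R g))⟫
    rw [hRsymm, hSsymm _ _ (hRorth f) (hRorth g), hRsymm]
  let e : ℕ → Lp ℝ 2 μ := fun j => (hV j).toLp
  have he' : ∀ j, e j =ᵐ[μ] V j := fun j => (hV j).coeFn_toLp
  have he : Orthonormal ℝ e := by
    rw [orthonormal_iff_ite]
    intro j k
    rw [L2_inner_eq_integral (he' j) (he' k), horth]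
  have key := inner_le_of_isCompactOperator hTc hTs he (ν := fun j => (lam j)⁻¹)
    (fun j k hjk => by
      have := hpos j
      have := hmono hjk
      simp only
      gcongr) (fun j => inv_pos.2 (hpos j)) ?_ i (f := hf.toLp) ?_
  · have hf' : hf.toLp =ᵐ[μ] f := hf.coeFn_toLp
    have h1 : ⟪one, hf.toLp⟫ = 0 := by
      rw [L2_inner_eq_integral hone hf']; simpa using hf0
    rw [hT, hRsymm, hRid _ h1, ← real_inner_self_eq_norm_sq, L2_inner_eq_integral hf' hf',
      L2_inner_eq_integral (hS _) hf', solve_congr_ae β hf'] at key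
    simpa [sq] using key
  · intro c f hc hf0 hTf
    have h1 : ⟪one, f⟫ = 0 := by
      have := hRorth (S (R f))
      rw [← hT, hTf, inner_smul_right] at this
      exact (mul_eq_zero.1 this).resolve_left hc
    rw [hT, hRid f h1, hR] at hTf
    set m := ⟪one, S f⟫ with hm
    set z : ℝ → ℝ := fun x => solve μ β f x + -m with hz
    have w : IsWeakSol μ β f z := hweak f h1 (-m)
    have hzf : z =ᵐ[μ] c • (f : ℝ → ℝ) := by
      filter_upwards [hS f, hone, Lp.coeFn_sub (S f) (m • one), Lp.coeFn_smul m one,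
        Lp.coeFn_smul c f] with x h1 h2 h3 h4 h5
      rw [← h5, ← hTf, h3, Pi.sub_apply, h4, Pi.smul_apply, h1, h2, hz]
      simp [sub_eq_add_neg]
    have hfz : (f : ℝ → ℝ) =ᵐ[μ] c⁻¹ • z := by
      filter_upwards [hzf] with x hx
      rw [Pi.smul_apply, hx, Pi.smul_apply, smul_smul, inv_mul_cancel₀ hc, one_smul]
    have hcpos : 0 < c := by
      have e := w.weak_form (hint f) w.contDiff
      have h2 : 0 ≤ (∫ x in (0 : ℝ)..1, deriv (deriv z) x * deriv (deriv z) x) +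
          β * (deriv z 0 * deriv z 0 + deriv z 1 * deriv z 1) := by
        have : 0 ≤ ∫ x in (0 : ℝ)..1, deriv (deriv z) x * deriv (deriv z) x :=
          intervalIntegral.integral_nonneg zero_le_one fun x _ => mul_self_nonneg _
        have := mul_self_nonneg (deriv z 0)
        have := mul_self_nonneg (deriv z 1)
        positivity
      have h3 : ∫ s, f s * z s ∂μ = c * ⟪f, f⟫ := by
        rw [L2_inner_eq_integral (ae_eq_refl f) (ae_eq_refl f), ← integral_const_mul]
        refine integral_congr_ae ?_
        filter_upwards [hzf] with x hx
        rw [hx, Pi.smul_apply, smul_eq_mul]; ring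
      rw [e, intervalIntegral_zero_one_eq hμ, h3] at h2
      have h4 : 0 < ⟪f, f⟫ := real_inner_self_pos.2 hf0
      exact (nonneg_of_mul_nonneg_left h2 h4).lt_of_ne hc.symm
    obtain ⟨j, hj, r, hr⟩ := hcomp c⁻¹ z (inv_pos.2 hcpos) (w.congr_ae hfz) (by
      by_contra! hcon
      refine hf0 ((Lp.eq_zero_iff_ae_eq_zero).2 ?_)
      filter_upwards [hfz, hμ] with x hx hx1
      rw [hx, Pi.smul_apply, hcon x ⟨hx1.1.le, hx1.2⟩]
      simp)
    refine ⟨j, by rw [← hj, inv_inv], c⁻¹ * r, Lp.ext ?_⟩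
    filter_upwards [hfz, hμ, he' j, Lp.coeFn_smul (c⁻¹ * r) (e j)] with x h1 h2 h3 h4
    rw [h1, h4, Pi.smul_apply, Pi.smul_apply, h3, hr x ⟨h2.1.le, h2.2⟩]
    simp [mul_assoc]
  · intro j hj
    rw [L2_inner_eq_integral (he' j) hf.coeFn_toLp]
    exact hfV j hj

end SolveBound

section EigenSystems

open MeasureTheory

/-- The space of `C²` functions on the line. -/
def C2 : Submodule ℝ (ℝ → ℝ) where
  carrier := {z | ContDiff ℝ 2 z}
  add_mem' h h' := by
    rw [mem_ofPred_eq] at *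
    exact h.add h'
  zero_mem' := by
    rw [mem_ofPred_eq]
    exact contDiff_const
  smul_mem' r _ h := by
    rw [mem_ofPred_eq] at *
    exact contDiff_const.smul h

theorem mem_C2 {z : ℝ → ℝ} : z ∈ C2 ↔ ContDiff ℝ 2 z := by
  change z ∈ {z | ContDiff ℝ 2 z} ↔ _
  rw [mem_ofPred_eq]

theorem C2.contDiff (z : C2) : ContDiff ℝ 2 (z : ℝ → ℝ) := mem_C2.1 z.2

/-- `W` is an orthonormal sequence of eigenfunctions of the weak problem `z'''' = ℓ z μ`, starting
with the constant `1`, that exhausts the eigenfunctions with positive eigenvalue. -/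
structure EigenSystem (μ : Measure ℝ) (β : ℝ) (ℓ : ℕ → ℝ) (W : ℕ → C2) : Prop where
  zero : ℓ 0 = 0
  const : ∀ x, (W 0 : ℝ → ℝ) x = 1
  mono : StrictMono ℓ
  weak : ∀ j, IsWeakSol μ β (ℓ j • (W j : ℝ → ℝ)) (W j)
  orth : ∀ i j, ∫ s, (W i : ℝ → ℝ) s * (W j : ℝ → ℝ) s ∂μ = if i = j then 1 else 0
  complete : ∀ c z, 0 < c → IsWeakSol μ β (c • z) z → (∃ x ∈ Icc (0 : ℝ) 1, z x ≠ 0) →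
    ∃ j, c = ℓ j ∧ ∃ r : ℝ, ∀ x ∈ Icc (0 : ℝ) 1, z x = r * (W j : ℝ → ℝ) x

variable {μ : Measure ℝ} [IsProbabilityMeasure μ] [NullSingletonClass μ]

theorem _root_.Continuous.memLp_of_ae_mem_Ioc {μ : Measure ℝ} [IsFiniteMeasure μ]
    (hμ : ∀ᵐ x ∂μ, x ∈ Ioc (0 : ℝ) 1) {g : ℝ → ℝ} (hg : Continuous g)
    (p : ENNReal) : MemLp g p μ := by
  obtain ⟨C, hC⟩ := (isCompact_Icc (a := (0 : ℝ)) (b := 1)).exists_bound_of_continuousOn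
    hg.continuousOn
  exact MemLp.of_bound hg.aestronglyMeasurable C (hμ.mono fun x hx => hC x ⟨hx.1.le, hx.2⟩)

theorem EigenSystem.spectralData {β : ℝ} {ℓ : ℕ → ℝ} {W : ℕ → C2} (h : EigenSystem μ β ℓ W)
    (hμ : ∀ᵐ x ∂μ, x ∈ Ioc (0 : ℝ) 1) (hβ : 0 < β)
    {Y : Type*} [AddCommGroup Y] [Module ℝ Y] {Q m : LinearMap.BilinForm ℝ Y}
    {J : Y → ℝ → ℝ} {R : C2 → Y} (hQsymm : ∀ φ ψ, Q φ ψ = Q ψ φ) (hQpos : ∀ φ, 0 ≤ Q φ φ)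
    (hQ : ∀ f (z : C2), Integrable f μ → IsWeakSol μ β f z → ∀ φ, Q (R z) φ = ∫ s, f s * J φ s ∂μ)
    (hJ : ∀ φ, MemLp (J φ) 2 μ) (hJR : ∀ z, J (R z) =ᵐ[μ] z)
    (hm : ∀ φ ψ, m φ ψ = ∫ s, J φ s * J ψ s ∂μ) : SpectralData Q m ℓ (fun i => R (W i)) := by
  have hWc : ∀ j, Continuous (W j : ℝ → ℝ) := fun j => (C2.contDiff (W j)).continuous
  have hWi : ∀ j, Integrable (ℓ j • (W j : ℝ → ℝ)) μ := fun j =>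
    (((hWc j).memLp_of_ae_mem_Ioc hμ 1).integrable le_rfl).smul (ℓ j)
  refine ⟨fun i => h.zero ▸ h.mono.monotone (Nat.zero_le i), fun i j => ?_, fun i j => ?_,
    fun i φ hφ => ?_⟩
  · rw [hm, ← h.orth]
    refine integral_congr_ae ?_
    filter_upwards [hJR (W i), hJR (W j)] with x h1 h2
    rw [h1, h2]
  · rw [hQ _ _ (hWi i) (h.weak i)]
    have : ∫ s, (ℓ i • (W i : ℝ → ℝ)) s * J (R (W j)) s ∂μ =
        ℓ i * ∫ s, (W i : ℝ → ℝ) s * (W j : ℝ → ℝ) s ∂μ := by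
      rw [← integral_const_mul]
      refine integral_congr_ae ?_
      filter_upwards [hJR (W j)] with x h1
      rw [h1, Pi.smul_apply, smul_eq_mul, mul_assoc]
    rw [this, h.orth]
    simp
  · have hort : ∀ j < i, ∫ s, (W j : ℝ → ℝ) s * J φ s ∂μ = 0 := fun j hj => by
      rw [← hφ j hj, hm]
      refine integral_congr_ae ?_
      filter_upwards [hJR (W j)] with x h1
      rw [h1, mul_comm]
    rcases i with _ | i
    · rw [h.zero, zero_mul]; exact hQpos φ
    have hpos : ∀ j, 0 < ℓ (j + 1) := fun j => h.zero ▸ h.mono (Nat.succ_pos j)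
    have hf0 : ∫ s, J φ s ∂μ = 0 := by simpa [h.const] using hort 0 (Nat.succ_pos i)
    have hfint : Integrable (J φ) μ := (hJ φ).integrable (by norm_num)
    have hb := integral_solve_mul_le hμ hβ (V := fun j => (W (j + 1) : ℝ → ℝ))
      (lam := fun j => ℓ (j + 1)) hpos
      (fun a b hab => h.mono.monotone (by omega)) (fun j => (hWc _).memLp_of_ae_mem_Ioc hμ 2)
      (fun a b => by simpa using h.orth (a + 1) (b + 1))
      (fun c z hc hz hz0 => by
        obtain ⟨j, hj, hr⟩ := h.complete c z hc hz hz0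
        rcases j with _ | j
        · exact absurd hc (by rw [hj, h.zero]; exact lt_irrefl _)
        · exact ⟨j, hj, hr⟩) i (hJ φ) hf0 fun j hj => hort (j + 1) (by omega)
    have hw := isWeakSol_solve hβ hfint (by rwa [intervalIntegral_zero_one_eq hμ]) 0
    simp only [add_zero] at hw
    let z : C2 := ⟨solve μ β (J φ), mem_C2.2 hw.contDiff⟩
    have e1 : Q (R z) φ = m φ φ := by rw [hQ _ z hfint hw, hm]
    have e2 : Q (R z) (R z) = ∫ s, solve μ β (J φ) s * J φ s ∂μ := by
      rw [hQ _ z hfint hw]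
      refine integral_congr_ae ?_
      filter_upwards [hJR z] with x h1
      rw [h1, mul_comm]
    have e3 : m φ φ = ∫ s, J φ s ^ 2 ∂μ := by simp only [hm, sq]
    rw [← e3, ← e2] at hb
    have hb' : ℓ (i + 1) * Q (R z) (R z) ≤ m φ φ := by
      rwa [inv_mul_eq_div, le_div_iff₀' (hpos i)] at hb
    have hsq : 0 ≤ Q (φ - ℓ (i + 1) • R z) (φ - ℓ (i + 1) • R z) := hQpos _
    simp only [map_sub, map_smul, LinearMap.sub_apply, LinearMap.smul_apply, smul_eq_mul,
      hQsymm φ (R z), e1] at hsq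
    nlinarith [hpos i]

end EigenSystems

section CantorMeasure

open MeasureTheory

/-- The probability measure with distribution function `P` on `[0,1]`. -/
theorem exists_measure_of_continuousOn {P : ℝ → ℝ} (hc : ContinuousOn P (Icc 0 1))
    (hm : MonotoneOn P (Icc 0 1)) (h0 : P 0 = 0) (h1 : P 1 = 1) :
    ∃ μ : Measure ℝ, IsProbabilityMeasure μ ∧ NullSingletonClass μ ∧ (∀ᵐ x ∂μ, x ∈ Ioc (0 : ℝ) 1) ∧
      ∀ s ∈ Icc (0 : ℝ) 1, ∀ t ∈ Icc (0 : ℝ) 1, s ≤ t → μ.real (Ioc s t) = P t - P s := by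
  set F : ℝ → ℝ := IccExtend zero_le_one ((Icc (0 : ℝ) 1).domRestrict P) with hF
  have hFc : Continuous F := (continuousOn_iff_continuous_domRestrict.1 hc).Icc_extend'
  have hFm : Monotone F := Monotone.IccExtend _ fun x y h => hm x.2 y.2 h
  have hFP : ∀ t ∈ Icc (0 : ℝ) 1, F t = P t := fun t ht => IccExtend_of_mem _ _ ht
  let S : StieltjesFunction ℝ := ⟨F, hFm, fun x => hFc.continuousWithinAt⟩
  have hS : ∀ t, S t = F t := fun t => rfl
  have hbot : Tendsto S atBot (nhds 0) := by
    refine tendsto_const_nhds.congr' ?_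
    filter_upwards [eventually_le_atBot 0] with x hx
    rw [hS, hF, IccExtend_of_le_left _ _ hx, domRestrict_apply, h0]
  have htop : Tendsto S atTop (nhds 1) := by
    refine tendsto_const_nhds.congr' ?_
    filter_upwards [eventually_ge_atTop 1] with x hx
    rw [hS, hF, IccExtend_of_right_le _ _ hx, domRestrict_apply, h1]
  have hprob : IsProbabilityMeasure S.measure := S.isProbabilityMeasure hbot htop
  have hIoc : ∀ s ∈ Icc (0 : ℝ) 1, ∀ t ∈ Icc (0 : ℝ) 1, s ≤ t →
      S.measure.real (Ioc s t) = P t - P s := fun s hs t ht hst => by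
    rw [measureReal_def, S.measure_Ioc, hS, hS, hFP s hs, hFP t ht,
      ENNReal.toReal_ofReal (sub_nonneg.2 (hm hs ht hst))]
  refine ⟨S.measure, hprob, ⟨fun x => ?_⟩, ?_, hIoc⟩
  · rw [S.measure_singleton, (hFc.continuousAt.continuousWithinAt).leftLim_eq]
    simp [hS]
  · have h : S.measure (Ioc 0 1) = 1 := by
      have := hIoc 0 ⟨le_rfl, zero_le_one⟩ 1 ⟨zero_le_one, le_rfl⟩ zero_le_one
      rw [h0, h1, sub_zero, measureReal_def, ENNReal.toReal_eq_one_iff] at this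
      exact this
    exact (prob_compl_eq_zero_iff measurableSet_Ioc).2 h

variable {P : ℝ → ℝ} {κ : ℕ} {a : ℝ}

theorem CantorSelfSimilar.gap (h : CantorSelfSimilar P κ a) :
    0 < bb κ a ∧ κ * (a + bb κ a) = 1 + bb κ a := by
  obtain ⟨-, -, -, -, hκ, ha, ha', -, -⟩ := h
  have hκ' : (2 : ℝ) ≤ κ := by exact_mod_cast hκ
  have h2 : κ * a < 1 := by rwa [lt_div_iff₀' (by linarith)] at ha'
  have h3 : (0 : ℝ) < κ - 1 := by linarith
  refine ⟨div_pos (by linarith) h3, ?_⟩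
  rw [bb]
  field_simp
  ring

/-- The left endpoint of the `k`-th similar piece. -/
noncomputable def leftEnd (κ : ℕ) (a : ℝ) (k : ℕ) : ℝ := k * (a + bb κ a)

theorem CantorSelfSimilar.piece_subset (h : CantorSelfSimilar P κ a) {k : ℕ} (hk : k < κ) :
    0 ≤ leftEnd κ a k ∧ leftEnd κ a k + a ≤ 1 := by
  obtain ⟨hb, hs⟩ := h.gap
  have ha := h.2.2.2.2.2.1
  have hk' : (k : ℝ) + 1 ≤ κ := by exact_mod_cast hk
  refine ⟨by unfold leftEnd; positivity, ?_⟩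
  have : ((k : ℝ) + 1) * (a + bb κ a) ≤ κ * (a + bb κ a) := by gcongr
  unfold leftEnd
  linarith

/-- `μ` is the probability measure on `(0,1]` with distribution function `P`. -/
structure IsDistribution (P : ℝ → ℝ) (μ : Measure ℝ) : Prop where
  prob : IsProbabilityMeasure μ
  nullSingleton : NullSingletonClass μ
  ae_mem : ∀ᵐ x ∂μ, x ∈ Ioc (0 : ℝ) 1
  real_Ioc : ∀ s ∈ Icc (0 : ℝ) 1, ∀ t ∈ Icc (0 : ℝ) 1, s ≤ t → μ.real (Ioc s t) = P t - P s

variable {μ : Measure ℝ}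

theorem CantorSelfSimilar.real_Ioc_piece (h : CantorSelfSimilar P κ a) (hμ : IsDistribution P μ)
    {k : ℕ} (hk : k < κ) {t : ℝ} (ht : t ∈ Icc (0 : ℝ) 1) :
    μ.real (Ioc (leftEnd κ a k) (leftEnd κ a k + a * t)) = (κ : ℝ)⁻¹ * P t := by
  obtain ⟨h1, h2⟩ := h.piece_subset hk
  obtain ⟨-, -, h0, -, hκ, ha, -, hc, -⟩ := h
  obtain ⟨c, hc⟩ := hc k hk
  have hκ' : (κ : ℝ) ≠ 0 := by positivity
  have hat : a * t ≤ a := mul_le_of_le_one_right ha.le ht.2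
  have hat0 : 0 ≤ a * t := mul_nonneg ha.le ht.1
  rw [hμ.real_Ioc _ ⟨h1, by linarith⟩ _ ⟨by linarith, by linarith⟩ (by linarith)]
  have e1 := hc t ht
  have e2 := hc 0 ⟨le_rfl, zero_le_one⟩
  rw [mul_zero, add_zero, h0] at e2
  rw [leftEnd, eq_inv_mul_iff_mul_eq₀ hκ']
  linarith

theorem CantorSelfSimilar.measure_gap (h : CantorSelfSimilar P κ a) (hμ : IsDistribution P μ)
    {k : ℕ} (hk : k < κ) : μ (Ioc (leftEnd κ a k + a) (leftEnd κ a (k + 1))) = 0 := by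
  have hp := hμ.prob
  obtain ⟨hb, hs⟩ := h.gap
  have ha := h.2.2.2.2.2.1
  obtain ⟨h1, h2⟩ := h.piece_subset hk
  have hnext : leftEnd κ a (k + 1) = leftEnd κ a k + a + bb κ a := by
    unfold leftEnd; push_cast; ring
  rcases Nat.lt_or_ge (k + 1) κ with hk1 | hk1
  · obtain ⟨h3, h4⟩ := h.piece_subset hk1
    set l := leftEnd κ a k + a with hl
    set r := leftEnd κ a (k + 1) with hr
    have hlr : l < r := by linarith
    have hll : l ∈ Icc (0 : ℝ) 1 := ⟨by linarith, by linarith⟩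
    have hrr : r ∈ Icc (0 : ℝ) 1 := ⟨by linarith, by linarith⟩
    have hsub : Icc l r ⊆ Icc 0 1 := Icc_subset_Icc hll.1 hrr.2
    have hconst := h.2.2.2.2.2.2.2.2 (k + 1) (by omega) hk1
    have hcont := h.1.mono hsub
    set m := (l + r) / 2 with hm
    have hmm : m ∈ Ioo l r := ⟨by linarith, by linarith⟩
    have heq : EqOn P (fun _ => P m) (Icc l r) := by
      rw [← closure_Ioo hlr.ne]
      have e : Ioo l r = Ioo (((k + 1 : ℕ) : ℝ) * (a + bb κ a) - bb κ a)
          (((k + 1 : ℕ) : ℝ) * (a + bb κ a)) := by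
        congr 1
        change l = r - bb κ a
        linarith
      refine EqOn.of_subset_closure (s := Ioo l r) (fun x hx => ?_) (by rwa [closure_Ioo hlr.ne])
        continuousOn_const subset_closure le_rfl
      exact hconst x (e ▸ hx) m (e ▸ hmm)
    have := hμ.real_Ioc l hll r hrr hlr.le
    rw [heq ⟨le_rfl, hlr.le⟩, heq ⟨hlr.le, le_rfl⟩, sub_self] at this
    exact (measureReal_eq_zero_iff).1 this
  · have hkκ : k + 1 = κ := by omega
    have hl : leftEnd κ a k + a = 1 := by
      have : leftEnd κ a (k + 1) = 1 + bb κ a := by rw [← hs, leftEnd, hkκ]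
      linarith
    rw [hl]
    refine measure_mono_null ?_ hμ.ae_mem
    intro x hx hx'
    exact hx.1.not_ge hx'.2

theorem CantorSelfSimilar.ae_mem_piece (h : CantorSelfSimilar P κ a) (hμ : IsDistribution P μ) :
    ∀ᵐ x ∂μ, x ∈ ⋃ k ∈ Finset.range κ, Ioc (leftEnd κ a k) (leftEnd κ a k + a) := by
  obtain ⟨hb, hs⟩ := h.gap
  have ha := h.2.2.2.2.2.1
  have hgap : ∀ᵐ x ∂μ, ∀ k ∈ Finset.range κ, x ∉ Ioc (leftEnd κ a k + a) (leftEnd κ a (k + 1)) := by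
    rw [Filter.eventually_all_finset]
    intro k hk
    exact measure_eq_zero_iff_ae_notMem.1 (h.measure_gap hμ (Finset.mem_range.1 hk))
  filter_upwards [hgap, hμ.ae_mem] with x hx hx1
  have hc : 0 < a + bb κ a := by linarith
  have hceil : 0 < ⌈x / (a + bb κ a)⌉₊ := Nat.ceil_pos.2 (div_pos hx1.1 hc)
  obtain ⟨k, hk⟩ : ∃ k, ⌈x / (a + bb κ a)⌉₊ = k + 1 := ⟨_, (Nat.succ_pred_eq_of_pos hceil).symm⟩
  obtain ⟨hk1, hk2⟩ := (Nat.ceil_eq_iff (by omega)).1 hk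
  rw [lt_div_iff₀ hc] at hk1
  rw [div_le_iff₀ hc] at hk2
  simp only [Nat.add_sub_cancel] at hk1
  have hkκ : k < κ := by
    have : ⌈x / (a + bb κ a)⌉₊ ≤ κ := by
      rw [Nat.ceil_le, div_le_iff₀ hc, hs]
      linarith [hx1.2]
    omega
  have hkr := Finset.mem_range.2 hkκ
  refine mem_biUnion hkr ⟨hk1, ?_⟩
  by_contra! hcon
  exact hx k hkr ⟨hcon, hk2⟩

theorem CantorSelfSimilar.disjoint_piece (h : CantorSelfSimilar P κ a) {j k : ℕ} (hjk : j ≠ k)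
    {x : ℝ} (hx : x ∈ Ioc (leftEnd κ a k) (leftEnd κ a k + a)) :
    x ∉ Ioc (leftEnd κ a j) (leftEnd κ a j + a) := by
  obtain ⟨hb, hs⟩ := h.gap
  have ha := h.2.2.2.2.2.1
  intro hx'
  have key : ∀ i l : ℕ, i < l → leftEnd κ a i + a < leftEnd κ a l := fun i l hil => by
    have : (i : ℝ) + 1 ≤ l := by exact_mod_cast hil
    have : ((i : ℝ) + 1) * (a + bb κ a) ≤ l * (a + bb κ a) := by gcongr
    unfold leftEnd
    linarith
  rcases hjk.lt_or_gt with h1 | h1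
  · linarith [key _ _ h1, hx.1, hx'.2]
  · linarith [key _ _ h1, hx'.1, hx.2]

theorem CantorSelfSimilar.integral_eq_sum (h : CantorSelfSimilar P κ a) (hμ : IsDistribution P μ)
    {g : ℝ → ℝ} (hg : Integrable g μ) : ∫ x, g x ∂μ = ∑ k ∈ Finset.range κ,
      ∫ x in (leftEnd κ a k)..(leftEnd κ a k + a), g x ∂μ := by
  have ha := h.2.2.2.2.2.1
  rw [← Measure.restrict_eq_self_of_ae_mem (h.ae_mem_piece hμ),
    integral_biUnion_finset _ (fun _ _ => measurableSet_Ioc) (fun j _ k _ hjk =>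
      Set.disjoint_left.2 fun x hx => h.disjoint_piece hjk.symm hx) (fun _ _ => hg.integrableOn),
    Measure.restrict_eq_self_of_ae_mem (h.ae_mem_piece hμ)]
  refine Finset.sum_congr rfl fun k _ => ?_
  rw [intervalIntegral.integral_of_le (by linarith)]

theorem CantorSelfSimilar.integral_piece (h : CantorSelfSimilar P κ a) (hμ : IsDistribution P μ)
    {k : ℕ} (hk : k < κ) {g g' : ℝ → ℝ} (hg : ∀ x, HasDerivAt g (g' x) x) (hg' : Continuous g') :
    ∫ x in (leftEnd κ a k)..(leftEnd κ a k + a), g x ∂μ =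
      (κ : ℝ)⁻¹ * ∫ t, g (leftEnd κ a k + a * t) ∂μ := by
  have hp := hμ.prob
  have ha := h.2.2.2.2.2.1
  have h0 := h.2.2.1
  set l := leftEnd κ a k with hl
  have e1 := integral_mul_eq_sub_of_hasDerivAt (μ := μ) (l := l) (r := l + a) (f := fun _ => 1)
    (by linarith) (integrable_const _) hg hg'
  have e2 := integral_mul_eq_sub_of_hasDerivAt (μ := μ) (l := 0) (r := 1) (f := fun _ => 1)
    (φ := fun t => g (l + a * t)) (φ' := fun t => g' (l + a * t) * a)
    zero_le_one (integrable_const _) (fun t => (hg _).comp t (by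
      simpa using ((hasDerivAt_id t).const_mul a).const_add l)) (by fun_prop)
  have hdist : ∀ s t : ℝ, s ≤ t → ∫ _ in s..t, (1 : ℝ) ∂μ = μ.real (Ioc s t) := fun s t hst => by
    rw [intervalIntegral.integral_of_le hst]; simp
  have m1 : ∀ t ∈ Icc (0 : ℝ) 1, ∫ _ in l..(l + a * t), (1 : ℝ) ∂μ = (κ : ℝ)⁻¹ * P t := fun t ht => by
    rw [hdist _ _ (by have := mul_nonneg ha.le ht.1; linarith), h.real_Ioc_piece hμ hk ht]
  have m2 : ∀ t ∈ Icc (0 : ℝ) 1, ∫ _ in (0 : ℝ)..t, (1 : ℝ) ∂μ = P t := fun t ht => by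
    rw [hdist _ _ ht.1, hμ.real_Ioc 0 ⟨le_rfl, zero_le_one⟩ t ht ht.1, h0, sub_zero]
  simp only [one_mul] at e1 e2
  rw [intervalIntegral_zero_one_eq hμ.ae_mem] at e2
  have h1 : (1 : ℝ) ∈ Icc (0 : ℝ) 1 := ⟨zero_le_one, le_rfl⟩
  have e3 := m1 1 h1
  rw [mul_one] at e3
  have e4 : ∫ t in l..(l + a), g' t * ∫ _ in l..t, (1 : ℝ) ∂μ =
      (κ : ℝ)⁻¹ * ∫ t in (0 : ℝ)..1, g' (l + a * t) * a * ∫ _ in (0 : ℝ)..t, (1 : ℝ) ∂μ := by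
    have := intervalIntegral.smul_integral_comp_add_mul (a := 0) (b := 1)
      (fun t => g' t * ∫ _ in l..t, (1 : ℝ) ∂μ) a l
    rw [mul_zero, add_zero, mul_one] at this
    rw [← this, smul_eq_mul, ← intervalIntegral.integral_const_mul,
      ← intervalIntegral.integral_const_mul]
    refine intervalIntegral.integral_congr fun t ht => ?_
    rw [uIcc_of_le zero_le_one] at ht
    simp only [m1 t ht, m2 t ht]
    ring
  rw [e1, e2, e3, e4, m2 1 h1, mul_one]
  ring

end CantorMeasure

section WeakEigenfunctions

open MeasureTheory

theorem IsWeakSol.smul {μ : Measure ℝ} {β : ℝ} {f z : ℝ → ℝ} (r : ℝ) (h : IsWeakSol μ β f z) :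
    IsWeakSol μ β (r • f) (r • z) := by
  obtain ⟨z1, z2, -, -, -⟩ := h.contDiff.deriv_facts
  have e1 : deriv (r • z) = r • deriv z := funext fun x => ((z1 x).const_smul r).deriv
  have e2 : deriv (r • deriv z) = r • deriv (deriv z) :=
    funext fun x => ((z2 x).const_smul r).deriv
  refine ⟨contDiff_const.smul h.contDiff, fun x hx => ?_, ?_, ?_, ?_⟩
  · have e3 : ∀ t, ∫ s in (0 : ℝ)..t, (r • f) s ∂μ = r * ∫ s in (0 : ℝ)..t, f s ∂μ := fun t =>
      intervalIntegral.integral_smul r f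
    simp only [e1, e2, e3, intervalIntegral.integral_const_mul]
    simp only [Pi.smul_apply, h.second x hx, smul_eq_mul]
    ring
  · exact (intervalIntegral.integral_smul r f).trans (by rw [h.mean, smul_zero])
  · simp only [e1, e2, Pi.smul_apply, h.left, smul_eq_mul]; ring
  · simp only [e1, e2, Pi.smul_apply, h.right, smul_eq_mul]; ring

variable {μ : Measure ℝ} [IsProbabilityMeasure μ] [NullSingletonClass μ] {β : ℝ} {z w : ℝ → ℝ}

theorem IsWeakSol.sub {μ : Measure ℝ} [NullSingletonClass μ] {β : ℝ} {f g z w : ℝ → ℝ}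
    (hf : Integrable f μ) (hg : Integrable g μ)
    (h : IsWeakSol μ β f z) (h' : IsWeakSol μ β g w) : IsWeakSol μ β (f - g) (z - w) := by
  obtain ⟨z1, z2, -, -, -⟩ := h.contDiff.deriv_facts
  obtain ⟨w1, w2, -, -, -⟩ := h'.contDiff.deriv_facts
  have e1 : deriv (z - w) = deriv z - deriv w := funext fun x => ((z1 x).sub (w1 x)).deriv
  have e2 : deriv (deriv z - deriv w) = deriv (deriv z) - deriv (deriv w) :=
    funext fun x => ((z2 x).sub (w2 x)).deriv
  have e3 : ∀ t, ∫ s in (0 : ℝ)..t, (f - g) s ∂μ =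
      (∫ s in (0 : ℝ)..t, f s ∂μ) - ∫ s in (0 : ℝ)..t, g s ∂μ := fun t =>
    intervalIntegral.integral_sub hf.intervalIntegrable hg.intervalIntegrable
  refine ⟨h.contDiff.sub h'.contDiff, fun x hx => ?_, by rw [e3, h.mean, h'.mean, sub_zero], ?_, ?_⟩
  · simp only [e1, e2, e3]
    rw [intervalIntegral.integral_sub ((continuous_cumulative hf 0).intervalIntegrable _ _)
      ((continuous_cumulative hg 0).intervalIntegrable _ _)]
    simp only [Pi.sub_apply, h.second x hx, h'.second x hx]
    ring
  · simp only [e1, e2, Pi.sub_apply, h.left, h'.left]; ring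
  · simp only [e1, e2, Pi.sub_apply, h.right, h'.right]; ring

theorem neg_mul_pow_le_of_deriv {u u' : ℝ → ℝ} (hu : ∀ x, HasDerivAt u (u' x) x) (hc : Continuous u')
    {B : ℝ} {n : ℕ} (h0 : 0 ≤ u 0) (h : ∀ x ∈ Icc (0 : ℝ) 1, -(B * x ^ n) ≤ u' x) {x : ℝ}
    (hx : x ∈ Icc (0 : ℝ) 1) : -(B / (n + 1) * x ^ (n + 1)) ≤ u x := by
  have e := intervalIntegral.integral_eq_sub_of_hasDerivAt (fun t _ => hu t)
    (hc.intervalIntegrable 0 x)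
  have h1 : ∫ t in (0 : ℝ)..x, -(B * t ^ n) ≤ ∫ t in (0 : ℝ)..x, u' t :=
    intervalIntegral.integral_mono_on hx.1
      ((by fun_prop : Continuous fun t : ℝ => -(B * t ^ n)).intervalIntegrable _ _)
      (hc.intervalIntegrable _ _) fun t ht => h t ⟨ht.1, ht.2.trans hx.2⟩
  rw [e, intervalIntegral.integral_neg, intervalIntegral.integral_const_mul, integral_pow] at h1
  simp only [ne_eq, Nat.succ_ne_zero, not_false_eq_true, zero_pow, sub_zero] at h1
  calc -(B / (n + 1) * x ^ (n + 1)) = -(B * (x ^ (n + 1) / (n + 1))) := by ring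
    _ ≤ u x := by linarith

theorem neg_mul_pow_le_of_deriv' {u u' : ℝ → ℝ} (hu : ∀ x, HasDerivAt u (u' x) x)
    (hc : Continuous u') {B : ℝ} {n : ℕ} (hB : 0 ≤ B) (h0 : 0 ≤ u 0)
    (h : ∀ x ∈ Icc (0 : ℝ) 1, -(B * x ^ n) ≤ u' x) {x : ℝ}
    (hx : x ∈ Icc (0 : ℝ) 1) : -(B * x ^ n) ≤ u x := by
  refine le_trans (neg_le_neg ?_) (neg_mul_pow_le_of_deriv hu hc h0 h hx)
  have := hx.1
  have : B / (n + 1) ≤ B := div_le_self hB (by linarith [(Nat.cast_nonneg n : (0 : ℝ) ≤ n)])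
  exact mul_le_mul this (pow_le_pow_of_le_one hx.1 hx.2 n.le_succ) (by positivity) hB

theorem IsWeakSol.nonneg_of_nonneg {lam : ℝ} (hlam : 0 ≤ lam) (hβ : 0 < β)
    (hμ : ∀ᵐ x ∂μ, x ∈ Ioc (0 : ℝ) 1)
    (h : IsWeakSol μ β (lam • z) z) (h0 : z 0 = 0) (h1 : 0 ≤ deriv z 0) :
    ∀ x ∈ Icc (0 : ℝ) 1, 0 ≤ z x := by
  obtain ⟨z1, z2, zc, zc1, zc2⟩ := h.contDiff.deriv_facts
  have hint : Integrable (lam • z) μ :=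
    (((zc.memLp_of_ae_mem_Ioc hμ 1).integrable le_rfl)).smul lam
  obtain ⟨C, hC⟩ := (isCompact_Icc (a := (0 : ℝ)) (b := 1)).exists_bound_of_continuousOn
    zc.continuousOn
  have hC0 : 0 ≤ C := (norm_nonneg _).trans (hC 0 ⟨le_rfl, zero_le_one⟩)
  have hz2 : 0 ≤ deriv (deriv z) 0 := by rw [h.left]; positivity
  have key : ∀ n : ℕ, ∀ x ∈ Icc (0 : ℝ) 1, -(C * lam ^ n / n.factorial * x ^ n) ≤ z x := by
    intro n
    induction n with
    | zero =>
      intro x hx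
      simpa using neg_le_of_abs_le (hC x hx)
    | succ n ih =>
      have hF : ∀ x ∈ Icc (0 : ℝ) 1,
          -(C * lam ^ (n + 1) / n.factorial * x ^ n) ≤ cumulative μ (lam • z) x := by
        intro x hx
        set K := C * lam ^ (n + 1) / n.factorial * x ^ n with hK
        have hK0 : 0 ≤ K := by have := hx.1; positivity
        have e1 : ∫ _ in (0 : ℝ)..x, -K ∂μ ≤ cumulative μ (lam • z) x := by
          refine intervalIntegral.integral_mono_on hx.1 (integrable_const _).intervalIntegrable
            hint.intervalIntegrable fun t ht => ?_
          have ht' := ih t ⟨ht.1, ht.2.trans hx.2⟩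
          have ht0 := ht.1
          have hpow : t ^ n ≤ x ^ n := pow_le_pow_left₀ ht.1 ht.2 n
          calc -K ≤ -(C * lam ^ (n + 1) / n.factorial * t ^ n) := by rw [hK]; gcongr
            _ = lam * -(C * lam ^ n / n.factorial * t ^ n) := by ring
            _ ≤ lam * z t := by gcongr
        refine le_trans ?_ e1
        rw [intervalIntegral.integral_of_le hx.1, setIntegral_const, smul_eq_mul]
        have : μ.real (Ioc 0 x) ≤ 1 := measureReal_le_one
        nlinarith
      have hG : ∀ x ∈ Icc (0 : ℝ) 1, -(C * lam ^ (n + 1) / (n + 1).factorial * x ^ (n + 1)) ≤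
          deriv (deriv z) x := by
        intro x hx
        have := neg_mul_pow_le_of_deriv (fun x => hasDerivAt_prim (continuous_cumulative' hint) x)
          (continuous_cumulative' hint) (by simp) hF hx
        rw [h.second x hx]
        have e : C * lam ^ (n + 1) / (n + 1).factorial = C * lam ^ (n + 1) / n.factorial / (n + 1) := by
          rw [Nat.factorial_succ]; push_cast; field_simp
        rw [e]
        exact this.trans (le_add_of_nonneg_left hz2)
      intro x hx
      refine neg_mul_pow_le_of_deriv' z1 zc1 (by positivity) h0.ge (fun x hx => ?_) hx
      exact neg_mul_pow_le_of_deriv' z2 zc2 (by positivity) h1 hG hx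
  intro x hx
  have hlim : Tendsto (fun n : ℕ => -(C * ((lam * x) ^ n / n.factorial))) atTop (nhds (-(C * 0))) :=
    ((FloorSemiring.tendsto_pow_div_factorial_atTop (lam * x)).const_mul C).neg
  rw [mul_zero, neg_zero] at hlim
  refine le_of_tendsto' hlim fun n => (le_of_eq ?_).trans (key n x hx)
  rw [mul_pow]; ring

theorem IsWeakSol.eq_zero_of_apply_zero {lam : ℝ} (hlam : 0 ≤ lam) (hβ : 0 < β)
    (hμ : ∀ᵐ x ∂μ, x ∈ Ioc (0 : ℝ) 1) (h : IsWeakSol μ β (lam • z) z) (h0 : z 0 = 0) :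
    ∀ x ∈ Icc (0 : ℝ) 1, z x = 0 := by
  have hslope : ∀ z : ℝ → ℝ, IsWeakSol μ β (lam • z) z → z 0 = 0 → 0 ≤ deriv z 0 →
      deriv z 0 = 0 := by
    intro z h h0 h1
    obtain ⟨z1, z2, zc, zc1, zc2⟩ := h.contDiff.deriv_facts
    have hint : Integrable (lam • z) μ :=
      (((zc.memLp_of_ae_mem_Ioc hμ 1).integrable le_rfl)).smul lam
    have hpos := h.nonneg_of_nonneg hlam hβ hμ h0 h1
    have hFi : ∀ s ∈ Icc (0 : ℝ) 1, ∀ t ∈ Icc (0 : ℝ) 1, s ≤ t →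
        0 ≤ ∫ x in s..t, (lam • z) x ∂μ := fun s hs t ht hst =>
      intervalIntegral.integral_nonneg hst fun x hx =>
        mul_nonneg hlam (hpos x ⟨hs.1.trans hx.1, hx.2.trans ht.2⟩)
    have i0 : (0 : ℝ) ∈ Icc (0 : ℝ) 1 := ⟨le_rfl, zero_le_one⟩
    have i1 : (1 : ℝ) ∈ Icc (0 : ℝ) 1 := ⟨zero_le_one, le_rfl⟩
    have hF0 : ∀ t ∈ Icc (0 : ℝ) 1, ∫ s in (0 : ℝ)..t, (lam • z) s ∂μ = 0 := fun t ht => by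
      have e := intervalIntegral.integral_add_adjacent_intervals (μ := μ) (a := 0) (b := t) (c := 1)
        (f := lam • z) hint.intervalIntegrable hint.intervalIntegrable
      rw [h.mean] at e
      linarith [hFi 0 i0 t ht ht.1, hFi t ht 1 i1 ht.2]
    have hzz : ∀ x ∈ Icc (0 : ℝ) 1, deriv (deriv z) x = deriv (deriv z) 0 := fun x hx => by
      rw [h.second x hx, intervalIntegral.integral_congr (g := fun _ => (0 : ℝ)) fun t ht => ?_]
      · simp
      · rw [uIcc_of_le hx.1] at ht
        exact hF0 t ⟨ht.1, ht.2.trans hx.2⟩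
    have e1 := intervalIntegral.integral_eq_sub_of_hasDerivAt (fun t _ => z2 t)
      (zc2.intervalIntegrable 0 1)
    rw [intervalIntegral.integral_congr (g := fun _ => deriv (deriv z) 0) fun t ht => ?_,
      intervalIntegral.integral_const] at e1
    · have e2 := h.right
      rw [hzz 1 i1] at e2
      have e3 := h.left
      simp only [sub_zero, one_smul] at e1
      rw [e3] at e1 e2
      have e4 : deriv z 1 = -deriv z 0 := by
        have : β * (deriv z 1 + deriv z 0) = 0 := by linarith
        rcases mul_eq_zero.1 this with h | h <;> linarith
      nlinarith
    · rw [uIcc_of_le zero_le_one] at ht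
      exact hzz t ht
  have hneg : IsWeakSol μ β (lam • ((-1 : ℝ) • z)) ((-1 : ℝ) • z) := by
    rw [smul_comm]; exact h.smul (-1)
  have hneg0 : ((-1 : ℝ) • z) 0 = 0 := by simp [h0]
  have hnegd : deriv ((-1 : ℝ) • z) 0 = -deriv z 0 := by simp
  have hd : deriv z 0 = 0 := by
    rcases le_total 0 (deriv z 0) with h1 | h1
    · exact hslope z h h0 h1
    · have := hslope _ hneg hneg0 (by rw [hnegd]; linarith)
      rw [hnegd] at this
      linarith
  intro x hx
  have p1 := h.nonneg_of_nonneg hlam hβ hμ h0 hd.ge x hx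
  have p2 := hneg.nonneg_of_nonneg hlam hβ hμ hneg0 (by rw [hnegd, hd]; simp) x hx
  simp only [Pi.smul_apply, smul_eq_mul] at p2
  linarith

end WeakEigenfunctions

section WeakEigenvalues

open MeasureTheory

/-- The eigenvalues of the weak problem `z'''' = c z μ`. -/
def IsWeakEigenvalue (μ : Measure ℝ) (β c : ℝ) : Prop :=
  ∃ z, IsWeakSol μ β (c • z) z ∧ ∃ x ∈ Icc (0 : ℝ) 1, z x ≠ 0

theorem isWeakSol_const (μ : Measure ℝ) (β r : ℝ) : IsWeakSol μ β 0 fun _ => r :=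
  ⟨contDiff_const, fun x _ => by simp, by simp, by simp, by simp⟩

variable {μ : Measure ℝ} [IsProbabilityMeasure μ] [NullSingletonClass μ] {β c d : ℝ} {z w : ℝ → ℝ}

theorem IsWeakSol.integrable_smul {μ : Measure ℝ} [IsFiniteMeasure μ] {f : ℝ → ℝ}
    (h : IsWeakSol μ β f z) (hμ : ∀ᵐ x ∂μ, x ∈ Ioc (0 : ℝ) 1) (r : ℝ) : Integrable (r • z) μ :=
  ((h.contDiff.continuous.memLp_of_ae_mem_Ioc hμ 1).integrable le_rfl).smul r

theorem IsWeakSol.integral_sq_pos (hβ : 0 < β) (hμ : ∀ᵐ x ∂μ, x ∈ Ioc (0 : ℝ) 1)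
    (h : IsWeakSol μ β (c • z) z) (hz : ∃ x ∈ Icc (0 : ℝ) 1, z x ≠ 0) :
    0 < ∫ s, z s * z s ∂μ := by
  have hzc := h.contDiff.continuous
  have hint : Integrable (fun s => z s * z s) μ :=
    ((hzc.mul hzc).memLp_of_ae_mem_Ioc hμ 1).integrable le_rfl
  refine lt_of_le_of_ne (integral_nonneg fun s => mul_self_nonneg _) fun h0 => ?_
  have hae : z =ᵐ[μ] 0 := by
    filter_upwards [(integral_eq_zero_iff_of_nonneg (fun s => mul_self_nonneg _) hint).1 h0.symm]
      with s hs
    exact mul_self_eq_zero.1 hs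
  have hf : IsWeakSol μ β 0 z := h.congr_ae (hae.mono fun s hs => by simp [hs])
  have hsub := hf.sub (integrable_zero _ _ _) (integrable_zero _ _ _) (isWeakSol_const μ β (z 0))
  have hzero := IsWeakSol.eq_zero_of_apply_zero (lam := 0) le_rfl hβ hμ
    (z := z - fun _ => z 0) (by simpa using hsub) (by simp)
  obtain ⟨x, hx, hzx⟩ := hz
  have hall : ∀ x ∈ Icc (0 : ℝ) 1, z x = z 0 := fun x hx => by
    have := hzero x hx
    simpa [sub_eq_zero] using this
  rw [hall x hx] at hzx
  obtain ⟨s, hs, hs0⟩ := (hμ.and hae).exists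
  exact hzx (by rw [← hall s ⟨hs.1.le, hs.2⟩, hs0]; rfl)

theorem IsWeakSol.weak_form_smul (hμ : ∀ᵐ x ∂μ, x ∈ Ioc (0 : ℝ) 1)
    (h : IsWeakSol μ β (c • z) z) {φ : ℝ → ℝ} (hφ : ContDiff ℝ 2 φ) :
    (∫ x in (0 : ℝ)..1, deriv (deriv z) x * deriv (deriv φ) x) +
      β * (deriv z 0 * deriv φ 0 + deriv z 1 * deriv φ 1) = c * ∫ s, z s * φ s ∂μ := by
  rw [h.weak_form (h.integrable_smul hμ c) hφ, intervalIntegral_zero_one_eq hμ, ← integral_const_mul]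
  simp only [Pi.smul_apply, smul_eq_mul, mul_assoc]

theorem IsWeakSol.eigenvalue_nonneg (hβ : 0 < β) (hμ : ∀ᵐ x ∂μ, x ∈ Ioc (0 : ℝ) 1)
    (h : IsWeakSol μ β (c • z) z) (hz : ∃ x ∈ Icc (0 : ℝ) 1, z x ≠ 0) : 0 ≤ c := by
  have h1 := h.weak_form_smul hμ h.contDiff
  have h2 := h.integral_sq_pos hβ hμ hz
  have h3 : 0 ≤ ∫ x in (0 : ℝ)..1, deriv (deriv z) x * deriv (deriv z) x :=
    intervalIntegral.integral_nonneg zero_le_one fun x _ => mul_self_nonneg _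
  have h4 : 0 ≤ β * (deriv z 0 * deriv z 0 + deriv z 1 * deriv z 1) :=
    mul_nonneg hβ.le (add_nonneg (mul_self_nonneg _) (mul_self_nonneg _))
  by_contra hc
  nlinarith [not_le.1 hc]

theorem IsWeakSol.integral_mul_eq_zero (hμ : ∀ᵐ x ∂μ, x ∈ Ioc (0 : ℝ) 1)
    (h : IsWeakSol μ β (c • z) z) (h' : IsWeakSol μ β (d • w) w) (hcd : c ≠ d) :
    ∫ s, z s * w s ∂μ = 0 := by
  have h1 := h.weak_form_smul hμ h'.contDiff
  have h2 := h'.weak_form_smul hμ h.contDiff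
  have e : ∫ s, w s * z s ∂μ = ∫ s, z s * w s ∂μ := by simp only [mul_comm]
  have e' : (∫ x in (0 : ℝ)..1, deriv (deriv w) x * deriv (deriv z) x) =
      ∫ x in (0 : ℝ)..1, deriv (deriv z) x * deriv (deriv w) x := by simp only [mul_comm]
  rw [e, e'] at h2
  have : (c - d) * ∫ s, z s * w s ∂μ = 0 := by
    rw [sub_mul, ← h1, ← h2]; ring
  exact (mul_eq_zero.1 this).resolve_left (sub_ne_zero.2 hcd)

theorem IsWeakSol.exists_eq_mul (hβ : 0 < β) (hμ : ∀ᵐ x ∂μ, x ∈ Ioc (0 : ℝ) 1) (hc : 0 ≤ c)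
    (h : IsWeakSol μ β (c • z) z) (h' : IsWeakSol μ β (c • w) w)
    (hw : ∃ x ∈ Icc (0 : ℝ) 1, w x ≠ 0) : ∃ r : ℝ, ∀ x ∈ Icc (0 : ℝ) 1, z x = r * w x := by
  have hw0 : w 0 ≠ 0 := fun h0 => by
    obtain ⟨x, hx, hne⟩ := hw
    exact hne (h'.eq_zero_of_apply_zero hc hβ hμ h0 x hx)
  have h1 := h'.smul (z 0 / w 0)
  have h2 := h.sub (h.integrable_smul hμ c)
    ((h'.integrable_smul hμ c).smul (z 0 / w 0)) h1
  rw [smul_comm, ← smul_sub] at h2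
  refine ⟨z 0 / w 0, fun x hx => sub_eq_zero.1 ?_⟩
  have := h2.eq_zero_of_apply_zero hc hβ hμ (by simp [div_mul_cancel₀ _ hw0]) x hx
  simpa using this

theorem exists_eigenSystem (hβ : 0 < β) (hμ : ∀ᵐ x ∂μ, x ∈ Ioc (0 : ℝ) 1) {ℓ : ℕ → ℝ}
    (hℓ : StrictMono ℓ) (hrange : range ℓ = {c | IsWeakEigenvalue μ β c}) :
    ∃ W, EigenSystem μ β ℓ W := by
  have heig : ∀ j, IsWeakEigenvalue μ β (ℓ j) := fun j => by
    have : ℓ j ∈ range ℓ := ⟨j, rfl⟩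
    rwa [hrange, mem_ofPred_eq] at this
  have hone : IsWeakEigenvalue μ β 0 :=
    ⟨fun _ => 1, by simpa using isWeakSol_const μ β 1, 0, ⟨le_rfl, zero_le_one⟩, one_ne_zero⟩
  have hzero : ℓ 0 = 0 := by
    have : (0 : ℝ) ∈ range ℓ := by rw [hrange, mem_ofPred_eq]; exact hone
    obtain ⟨j, hj⟩ := this
    obtain ⟨z, hz, hz'⟩ := heig 0
    exact le_antisymm (hj ▸ hℓ.monotone (Nat.zero_le j)) (hz.eigenvalue_nonneg hβ hμ hz')
  have hnorm : ∀ j, ∃ w : C2, IsWeakSol μ β (ℓ j • (w : ℝ → ℝ)) w ∧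
      ∫ s, (w : ℝ → ℝ) s * (w : ℝ → ℝ) s ∂μ = 1 ∧ (j = 0 → ∀ x, (w : ℝ → ℝ) x = 1) := by
    intro j
    rcases Nat.eq_zero_or_pos j with rfl | hj
    · exact ⟨⟨fun _ => 1, mem_C2.2 contDiff_const⟩, by simpa [hzero] using isWeakSol_const μ β 1,
        by simp, fun _ _ => rfl⟩
    · obtain ⟨z, hz, hz'⟩ := heig j
      have hpos := hz.integral_sq_pos hβ hμ hz'
      have hs := hz.smul (√(∫ s, z s * z s ∂μ))⁻¹
      rw [smul_comm] at hs
      refine ⟨⟨_, mem_C2.2 hs.contDiff⟩, hs, ?_, fun h => absurd h hj.ne'⟩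
      simp only [Pi.smul_apply, smul_eq_mul]
      have e : ∀ r s, r * z s * (r * z s) = r ^ 2 * (z s * z s) := fun r s => by ring
      simp only [e, integral_const_mul]
      rw [inv_pow, Real.sq_sqrt hpos.le, inv_mul_cancel₀ hpos.ne']
  choose W hW hW1 hW0 using hnorm
  have hne : ∀ j, ∃ x ∈ Icc (0 : ℝ) 1, (W j : ℝ → ℝ) x ≠ 0 := fun j => by
    by_contra! hall
    have : ∫ s, (W j : ℝ → ℝ) s * (W j : ℝ → ℝ) s ∂μ = 0 := by
      rw [integral_congr_ae (g := fun _ => (0 : ℝ)) (hμ.mono fun x hx => by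
        simp only [hall x ⟨hx.1.le, hx.2⟩, mul_zero])]
      simp
    rw [hW1] at this
    exact one_ne_zero this
  refine ⟨W, hzero, hW0 0 rfl, hℓ, hW, fun i j => ?_, fun c z hc hz hz' => ?_⟩
  · split_ifs with hij
    · rw [hij, hW1]
    · exact (hW i).integral_mul_eq_zero hμ (hW j) (hℓ.injective.ne hij)
  · have : c ∈ range ℓ := by rw [hrange, mem_ofPred_eq]; exact ⟨z, hz, hz'⟩
    obtain ⟨j, rfl⟩ := this
    exact ⟨j, rfl, hz.exists_eq_mul hβ hμ hc.le (hW j) (hne j)⟩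

end WeakEigenvalues

section ClassicalEigenvalues

open MeasureTheory

theorem eqOn_Icc_of_hasDerivWithinAt {f g f' g' : ℝ → ℝ} {l r : ℝ} (hlr : l < r)
    (hf : ∀ x ∈ Icc l r, HasDerivWithinAt f (f' x) (Icc l r) x)
    (hg : ∀ x, HasDerivAt g (g' x) x) (h' : EqOn f' g' (Icc l r)) (h0 : f l = g l) :
    EqOn f g (Icc l r) := by
  have hd : ∀ x ∈ Icc l r, HasDerivWithinAt (f - g) 0 (Icc l r) x := fun x hx => by
    simpa [h' hx] using (hf x hx).sub (hg x).hasDerivWithinAt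
  intro x hx
  have := constant_of_derivWithin_zero (f := f - g) (a := l) (b := r)
    (fun x hx => (hd x hx).differentiableWithinAt)
    (fun x hx => (hd x ⟨hx.1, hx.2.le⟩).derivWithin (uniqueDiffOn_Icc hlr x ⟨hx.1, hx.2.le⟩))
    x hx
  simpa [h0, sub_eq_zero] using this

theorem eqOn_derivWithin_Icc {f g g' : ℝ → ℝ} (h : EqOn f g (Icc 0 1))
    (hg : ∀ x, HasDerivAt g (g' x) x) : EqOn (derivWithin f (Icc 0 1)) g' (Icc 0 1) := fun x hx =>
  ((hg x).hasDerivWithinAt.congr h (h hx)).derivWithin (uniqueDiffOn_Icc zero_lt_one x hx)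

/-- `u` is a function on the line with continuous third derivative `u3`. -/
structure HasThreeDerivs (u u1 u2 u3 : ℝ → ℝ) : Prop where
  first : ∀ x, HasDerivAt u (u1 x) x
  second : ∀ x, HasDerivAt u1 (u2 x) x
  third : ∀ x, HasDerivAt u2 (u3 x) x
  cont : Continuous u3

variable {u u1 u2 u3 y : ℝ → ℝ}

theorem hasThreeDerivs_prim (hc : Continuous u3) (c c1 c2 : ℝ) :
    HasThreeDerivs (fun x => c + prim (fun x => c1 + prim (fun x => c2 + prim u3 x) x) x)
      (fun x => c1 + prim (fun x => c2 + prim u3 x) x) (fun x => c2 + prim u3 x) u3 := by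
  have h2 : Continuous fun x => c2 + prim u3 x := continuous_const.add (continuous_prim hc)
  have h1 : Continuous fun x => c1 + prim (fun x => c2 + prim u3 x) x :=
    continuous_const.add (continuous_prim h2)
  exact ⟨fun x => (hasDerivAt_prim h1 x).const_add c, fun x => (hasDerivAt_prim h2 x).const_add c1,
    fun x => (hasDerivAt_prim hc x).const_add c2, hc⟩

theorem HasThreeDerivs.contDiff_two (h : HasThreeDerivs u u1 u2 u3) : ContDiff ℝ 2 u :=
  contDiff_two_of_hasDerivAt h.first h.second
    (continuous_iff_continuousAt.2 fun x => (h.third x).continuousAt)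

theorem HasThreeDerivs.contDiff (h : HasThreeDerivs u u1 u2 u3) : ContDiff ℝ 3 u := by
  rw [show (3 : WithTop ℕ∞) = 2 + 1 by norm_num, contDiff_succ_iff_deriv,
    show deriv u = u1 from funext fun x => (h.first x).deriv]
  exact ⟨fun x => (h.first x).differentiableAt, by simp,
    contDiff_two_of_hasDerivAt h.second h.third h.cont⟩

theorem HasThreeDerivs.eqOn (h : HasThreeDerivs u u1 u2 u3) (hy : EqOn y u (Icc 0 1)) :
    ContDiffOn ℝ 3 y (Icc 0 1) ∧ EqOn (Y1 y) u1 (Icc 0 1) ∧ EqOn (Y2 y) u2 (Icc 0 1) ∧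
      EqOn (Y3 y) u3 (Icc 0 1) := by
  have h1 : EqOn (Y1 y) u1 (Icc 0 1) := eqOn_derivWithin_Icc hy h.first
  have h1' : EqOn (iteratedDerivWithin 1 y (Icc 0 1)) u1 (Icc 0 1) := fun x hx => by
    rw [iteratedDerivWithin_one]; exact h1 hx
  have h2 : EqOn (Y2 y) u2 (Icc 0 1) := fun x hx => by
    rw [Y2, iteratedDerivWithin_succ]; exact eqOn_derivWithin_Icc h1' h.second hx
  have h3 : EqOn (Y3 y) u3 (Icc 0 1) := fun x hx => by
    rw [Y3, iteratedDerivWithin_succ]; exact eqOn_derivWithin_Icc h2 h.third hx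
  exact ⟨h.contDiff.contDiffOn.congr hy, h1, h2, h3⟩

theorem exists_hasThreeDerivs (h : ContDiffOn ℝ 3 y (Icc 0 1)) :
    ∃ u u1 u2 u3, HasThreeDerivs u u1 u2 u3 ∧ EqOn y u (Icc 0 1) := by
  have hI := uniqueDiffOn_Icc (zero_lt_one (α := ℝ))
  have hd : ∀ n : ℕ, n < 3 → ∀ x ∈ Icc (0 : ℝ) 1,
      HasDerivWithinAt (iteratedDerivWithin n y (Icc 0 1))
        (iteratedDerivWithin (n + 1) y (Icc 0 1) x) (Icc 0 1) x := fun n hn x hx => by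
    rw [iteratedDerivWithin_succ]
    exact (h.differentiableOn_iteratedDerivWithin (by exact_mod_cast hn) hI x hx).hasDerivWithinAt
  have h3 : ContinuousOn (iteratedDerivWithin 3 y (Icc 0 1)) (Icc 0 1) :=
    h.continuousOn_iteratedDerivWithin le_rfl hI
  have hc : Continuous (IccExtend zero_le_one ((Icc (0 : ℝ) 1).domRestrict
      (iteratedDerivWithin 3 y (Icc 0 1)))) :=
    (continuousOn_iff_continuous_domRestrict.1 h3).Icc_extend'
  set u3 := IccExtend zero_le_one ((Icc (0 : ℝ) 1).domRestrict (iteratedDerivWithin 3 y (Icc 0 1)))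
  have e3 : EqOn (iteratedDerivWithin 3 y (Icc 0 1)) u3 (Icc 0 1) := fun x hx =>
    (IccExtend_of_mem zero_le_one
      ((Icc (0 : ℝ) 1).domRestrict (iteratedDerivWithin 3 y (Icc 0 1))) hx).symm
  have H := hasThreeDerivs_prim hc (y 0) (iteratedDerivWithin 1 y (Icc 0 1) 0)
    (iteratedDerivWithin 2 y (Icc 0 1) 0)
  refine ⟨_, _, _, u3, H, ?_⟩
  have e2 := eqOn_Icc_of_hasDerivWithinAt zero_lt_one (hd 2 (by norm_num)) H.third e3 (by simp)
  have e1 := eqOn_Icc_of_hasDerivWithinAt zero_lt_one (hd 1 (by norm_num)) H.second e2 (by simp)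
  have := eqOn_Icc_of_hasDerivWithinAt zero_lt_one (hd 0 (by norm_num)) H.first e1 (by simp)
  simpa only [iteratedDerivWithin_zero] using this

theorem isEigenvalue_iff_isWeakEigenvalue {P : ℝ → ℝ} {μ : Measure ℝ} [IsProbabilityMeasure μ]
    [NullSingletonClass μ] (hμ : IsDistribution P μ) (hP0 : P 0 = 0) {β : ℝ} (hβ : 0 < β) (c : ℝ) :
    IsEigenvalue P 0 β c ↔ IsWeakEigenvalue μ β c := by
  have i0 : (0 : ℝ) ∈ Icc (0 : ℝ) 1 := ⟨le_rfl, zero_le_one⟩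
  have i1 : (1 : ℝ) ∈ Icc (0 : ℝ) 1 := ⟨zero_le_one, le_rfl⟩
  have hone : Integrable (fun _ : ℝ => (1 : ℝ)) μ := integrable_const 1
  set p : ℝ → ℝ := cumulative μ fun _ => 1 with hp
  have hpc : Continuous p := continuous_cumulative' hone
  have hpP : EqOn p P (Icc 0 1) := fun x hx => by
    have := hμ.real_Ioc 0 i0 x hx hx.1
    rw [hP0, sub_zero] at this
    rw [hp, cumulative, intervalIntegral.integral_of_le hx.1, setIntegral_const, smul_eq_mul, mul_one,
      this]
  have hcum : ∀ {z z' : ℝ → ℝ}, (∀ x, HasDerivAt z (z' x) x) → Continuous z' → ∀ x ∈ Icc (0 : ℝ) 1,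
      cumulative μ (c • z) x = c * (p x * z x) - c * prim (fun t => p t * z' t) x := by
    intro z z' hz hz' x hx
    have h1 := integral_mul_eq_sub_of_hasDerivAt hx.1 hone hz hz'
    have h2 : cumulative μ (c • z) x = c * ∫ s in (0 : ℝ)..x, 1 * z s ∂μ := by
      simp only [one_mul]; exact intervalIntegral.integral_smul c z
    rw [h2, h1, prim, mul_sub]
    simp only [hp, cumulative, mul_comm]
  constructor
  · rintro ⟨y, ⟨x₀, hx₀, hne⟩, ⟨hy, hsol⟩, b1, b2, b3, b4⟩
    obtain ⟨u, u1, u2, u3, hu, hyu⟩ := exists_hasThreeDerivs hy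
    obtain ⟨-, e1, e2, e3⟩ := hu.eqOn hyu
    have c1 : Continuous u1 := continuous_iff_continuousAt.2 fun x => (hu.second x).continuousAt
    rw [e1 i0, e2 i0, zero_mul, add_zero] at b1
    rw [e3 i0, zero_mul, add_zero] at b2
    rw [e1 i1, e2 i1, zero_mul, add_zero] at b3
    rw [e3 i1, zero_mul, sub_zero] at b4
    have t0 : u3 0 = 0 := (mul_eq_zero.1 b2).resolve_left (neg_ne_zero.2 hβ.ne')
    have t1 : u3 1 = 0 := (mul_eq_zero.1 b4).resolve_left (neg_ne_zero.2 hβ.ne')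
    have key := eqOn_Icc_of_hasDerivWithinAt zero_lt_one hsol
      (fun x => (hasDerivAt_prim (hpc.mul c1) x).const_mul (-c))
      (fun x hx => by simp only [e1 hx, Pi.mul_apply, hpP hx]; ring) (by
        simp only [e3 i0, t0, hP0, prim_zero_right]; ring)
    have hF : EqOn u3 (cumulative μ (c • u)) (Icc 0 1) := fun x hx => by
      have := key hx
      rw [hcum hu.first c1 x hx, ← e3 hx, hpP hx, ← hyu hx]
      simp only [Pi.mul_def] at this
      linarith
    have d1 : deriv u = u1 := funext fun x => (hu.first x).deriv
    have d2 : deriv u1 = u2 := funext fun x => (hu.second x).deriv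
    refine ⟨u, ⟨hu.contDiff_two, fun x hx => ?_, (hF i1).symm.trans t1, ?_, ?_⟩, x₀, hx₀,
      hyu hx₀ ▸ hne⟩
    · rw [d1, d2, ← sub_eq_iff_eq_add', ← intervalIntegral.integral_eq_sub_of_hasDerivAt
        (fun x _ => hu.third x) (hu.cont.intervalIntegrable 0 x)]
      refine intervalIntegral.integral_congr fun t ht => ?_
      rw [uIcc_of_le hx.1] at ht
      exact hF ⟨ht.1, ht.2.trans hx.2⟩
    · rw [d1, d2]; linarith
    · rw [d1, d2]; linarith
  · rintro ⟨z, hz, hne⟩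
    obtain ⟨z1, z2, zc, zc1, zc2⟩ := hz.contDiff.deriv_facts
    have hint : Integrable (c • z) μ := hz.integrable_smul hμ.ae_mem c
    have hu := hasThreeDerivs_prim (continuous_cumulative' hint) (z 0) (deriv z 0)
      (deriv (deriv z) 0)
    have e2 : EqOn (deriv (deriv z)) _ (Icc 0 1) := fun x hx => hz.second x hx
    have e1 := eqOn_Icc_of_hasDerivWithinAt zero_lt_one (fun x _ => (z2 x).hasDerivWithinAt) hu.second e2
      (by simp)
    have e0 := eqOn_Icc_of_hasDerivWithinAt zero_lt_one (fun x _ => (z1 x).hasDerivWithinAt) hu.first e1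
      (by simp)
    obtain ⟨hcd, f1, f2, f3⟩ := hu.eqOn e0
    replace f1 : EqOn (Y1 z) (deriv z) (Icc 0 1) := fun x hx => (f1 hx).trans (e1 hx).symm
    replace f2 : EqOn (Y2 z) (deriv (deriv z)) (Icc 0 1) := fun x hx => (f2 hx).trans (e2 hx).symm
    refine ⟨z, hne, ⟨hcd, fun x hx => ?_⟩, ?_, ?_, ?_, ?_⟩
    · have h1 := ((hasDerivAt_prim (hpc.mul zc1) x).const_mul (-c)).hasDerivWithinAt
        (s := Icc (0 : ℝ) 1)
      have h2 : EqOn (fun t => Y3 z t - c * P t * z t) (fun t => -c * prim (p * deriv z) t)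
          (Icc 0 1) := fun t ht => by
        simp only [f3 ht, hcum z1 zc1 t ht, hpP ht, Pi.mul_def]
        ring
      refine (h1.congr h2 (h2 hx)).congr_deriv ?_
      rw [f1 hx, Pi.mul_apply, hpP hx]; ring
    · rw [f1 i0, f2 i0, hz.left]; ring
    · rw [f3 i0, cumulative, intervalIntegral.integral_same]; ring
    · rw [f1 i1, f2 i1, hz.right]; ring
    · rw [f3 i1, cumulative, hz.mean]; ring

end ClassicalEigenvalues

section Forms

open MeasureTheory

theorem C2.deriv_add (φ ψ : C2) : deriv ((φ + ψ : C2) : ℝ → ℝ) = deriv φ + deriv ψ :=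
  funext fun x => (((C2.contDiff φ).deriv_facts.1 x).add ((C2.contDiff ψ).deriv_facts.1 x)).deriv

theorem C2.deriv_smul (r : ℝ) (φ : C2) : deriv ((r • φ : C2) : ℝ → ℝ) = r • deriv φ :=
  funext fun x => (((C2.contDiff φ).deriv_facts.1 x).const_smul r).deriv

theorem C2.deriv_deriv_add (φ ψ : C2) :
    deriv (deriv ((φ + ψ : C2) : ℝ → ℝ)) = deriv (deriv φ) + deriv (deriv ψ) := by
  rw [C2.deriv_add]
  exact funext fun x =>
    (((C2.contDiff φ).deriv_facts.2.1 x).add ((C2.contDiff ψ).deriv_facts.2.1 x)).deriv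

theorem C2.deriv_deriv_smul (r : ℝ) (φ : C2) :
    deriv (deriv ((r • φ : C2) : ℝ → ℝ)) = r • deriv (deriv φ) := by
  rw [C2.deriv_smul]
  exact funext fun x => (((C2.contDiff φ).deriv_facts.2.1 x).const_smul r).deriv

theorem C2.continuous_deriv_deriv (φ : C2) : Continuous (deriv (deriv (φ : ℝ → ℝ))) :=
  (C2.contDiff φ).deriv_facts.2.2.2.2

/-- Evaluation at a point. -/
noncomputable def C2.eval (x : ℝ) : C2 →ₗ[ℝ] ℝ where
  toFun φ := (φ : ℝ → ℝ) x
  map_add' _ _ := rfl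
  map_smul' _ _ := rfl

/-- The derivative at a point. -/
noncomputable def C2.slope (x : ℝ) : C2 →ₗ[ℝ] ℝ where
  toFun φ := deriv (φ : ℝ → ℝ) x
  map_add' φ ψ := by rw [C2.deriv_add]; rfl
  map_smul' r φ := by rw [C2.deriv_smul]; rfl

theorem C2.intervalIntegrable_deriv_deriv_mul (φ ψ : C2) : IntervalIntegrable
    (fun x => deriv (deriv (φ : ℝ → ℝ)) x * deriv (deriv (ψ : ℝ → ℝ)) x) volume 0 1 :=
  ((C2.continuous_deriv_deriv φ).mul (C2.continuous_deriv_deriv ψ)).intervalIntegrable 0 1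

/-- The bending energy `∫ φ'' ψ''` on `[0,1]`. -/
noncomputable def C2.energy : LinearMap.BilinForm ℝ C2 :=
  LinearMap.mk₂ ℝ (fun φ ψ => ∫ x in (0 : ℝ)..1,
      deriv (deriv (φ : ℝ → ℝ)) x * deriv (deriv (ψ : ℝ → ℝ)) x)
    (fun φ₁ φ₂ ψ => by
      rw [C2.deriv_deriv_add, ← intervalIntegral.integral_add
        (C2.intervalIntegrable_deriv_deriv_mul φ₁ ψ)
        (C2.intervalIntegrable_deriv_deriv_mul φ₂ ψ)]
      simp only [Pi.add_apply, add_mul])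
    (fun r φ ψ => by
      rw [C2.deriv_deriv_smul, ← intervalIntegral.integral_smul]
      simp only [Pi.smul_apply, smul_mul_assoc])
    (fun φ ψ₁ ψ₂ => by
      rw [C2.deriv_deriv_add, ← intervalIntegral.integral_add
        (C2.intervalIntegrable_deriv_deriv_mul φ ψ₁)
        (C2.intervalIntegrable_deriv_deriv_mul φ ψ₂)]
      simp only [Pi.add_apply, mul_add])
    (fun r φ ψ => by
      rw [C2.deriv_deriv_smul, ← intervalIntegral.integral_smul]
      simp only [Pi.smul_apply, mul_smul_comm])

theorem C2.energy_apply (φ ψ : C2) : C2.energy φ ψ =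
    ∫ x in (0 : ℝ)..1, deriv (deriv (φ : ℝ → ℝ)) x * deriv (deriv (ψ : ℝ → ℝ)) x := rfl

theorem C2.energy_comm (φ ψ : C2) : C2.energy φ ψ = C2.energy ψ φ := by
  simp only [C2.energy_apply, mul_comm]

theorem C2.energy_self_nonneg (φ : C2) : 0 ≤ C2.energy φ φ :=
  intervalIntegral.integral_nonneg zero_le_one fun _ _ => mul_self_nonneg _

variable {μ : Measure ℝ}

theorem C2.integrable_mul {μ : Measure ℝ} [IsFiniteMeasure μ] (hμ : ∀ᵐ x ∂μ, x ∈ Ioc (0 : ℝ) 1)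
    (φ ψ : C2) : Integrable (fun s => (φ : ℝ → ℝ) s * (ψ : ℝ → ℝ) s) μ :=
  (((C2.contDiff φ).continuous.mul (C2.contDiff ψ).continuous).memLp_of_ae_mem_Ioc hμ
    1).integrable le_rfl

/-- The form `∫ φ ψ dμ`. -/
noncomputable def C2.mass (μ : Measure ℝ) [IsFiniteMeasure μ] (hμ : ∀ᵐ x ∂μ, x ∈ Ioc (0 : ℝ) 1) :
    LinearMap.BilinForm ℝ C2 :=
  LinearMap.mk₂ ℝ (fun φ ψ => ∫ s, (φ : ℝ → ℝ) s * (ψ : ℝ → ℝ) s ∂μ)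
    (fun φ₁ φ₂ ψ => by
      rw [← integral_add (C2.integrable_mul hμ φ₁ ψ) (C2.integrable_mul hμ φ₂ ψ)]
      simp only [Submodule.coe_add, Pi.add_apply, add_mul])
    (fun r φ ψ => by
      rw [← integral_smul]
      simp only [Submodule.coe_smul, Pi.smul_apply, smul_mul_assoc])
    (fun φ ψ₁ ψ₂ => by
      rw [← integral_add (C2.integrable_mul hμ φ ψ₁) (C2.integrable_mul hμ φ ψ₂)]
      simp only [Submodule.coe_add, Pi.add_apply, mul_add])
    (fun r φ ψ => by
      rw [← integral_smul]
      simp only [Submodule.coe_smul, Pi.smul_apply, mul_smul_comm])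

/-- The quadratic form of the weak problem with boundary parameter `β`. -/
noncomputable def C2.form (β : ℝ) : LinearMap.BilinForm ℝ C2 :=
  C2.energy + β • (LinearMap.BilinForm.linMulLin (C2.slope 0) (C2.slope 0) +
    LinearMap.BilinForm.linMulLin (C2.slope 1) (C2.slope 1))

theorem C2.form_apply (β : ℝ) (φ ψ : C2) : C2.form β φ ψ = C2.energy φ ψ +
    β * (C2.slope 0 φ * C2.slope 0 ψ + C2.slope 1 φ * C2.slope 1 ψ) := rfl

theorem C2.energy_le_form {β : ℝ} (hβ : 0 ≤ β) (φ : C2) : C2.energy φ φ ≤ C2.form β φ φ := by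
  rw [C2.form_apply]
  have := mul_nonneg hβ (add_nonneg (mul_self_nonneg (C2.slope 0 φ)) (mul_self_nonneg (C2.slope 1 φ)))
  linarith

theorem EigenSystem.spectralData_form [IsProbabilityMeasure μ] [NullSingletonClass μ] {β : ℝ}
    {ℓ : ℕ → ℝ} {W : ℕ → C2} (h : EigenSystem μ β ℓ W) (hμ : ∀ᵐ x ∂μ, x ∈ Ioc (0 : ℝ) 1)
    (hβ : 0 < β) : SpectralData (C2.form β) (C2.mass μ hμ) ℓ W := by
  refine h.spectralData hμ hβ (Y := C2) (J := fun φ : C2 => (φ : ℝ → ℝ)) (R := id) (fun φ ψ => ?_)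
    (fun φ => (C2.energy_self_nonneg φ).trans (C2.energy_le_form hβ.le φ)) (fun f z hf hz φ => ?_)
    (fun φ => (C2.contDiff φ).continuous.memLp_of_ae_mem_Ioc hμ 2) (fun z => ae_eq_refl _)
    (fun φ ψ => rfl)
  · rw [C2.form_apply, C2.form_apply, C2.energy_comm]; ring
  · rw [← intervalIntegral_zero_one_eq hμ, ← hz.weak_form hf (C2.contDiff φ)]
    rfl

end Forms

section Traces

open MeasureTheory

theorem sq_integral_abs_le {α : Type*} [MeasurableSpace α] {ν : Measure α} [IsProbabilityMeasure ν]
    {w : α → ℝ} (h : Integrable w ν) (h2 : Integrable (fun x => w x * w x) ν) :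
    (∫ x, |w x| ∂ν) ^ 2 ≤ ∫ x, w x * w x ∂ν := by
  set c := ∫ x, |w x| ∂ν with hc
  have h0 : 0 ≤ ∫ x, (w x * w x - (2 * c * |w x| - c ^ 2)) ∂ν :=
    integral_nonneg fun x => by
      have : w x * w x = |w x| * |w x| := (abs_mul_abs_self _).symm
      simp only [Pi.zero_apply, this]
      nlinarith [sq_nonneg (|w x| - c)]
  have h3 : Integrable (fun x => 2 * c * |w x|) ν := h.abs.const_mul _
  have h4 : Integrable (fun x => 2 * c * |w x| - c ^ 2) ν := h3.sub (integrable_const _)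
  rw [integral_sub h2 h4, integral_sub h3 (integrable_const _), integral_const_mul, ← hc] at h0
  simp only [integral_const, probReal_univ, one_smul] at h0
  nlinarith

theorem abs_deriv_sub_le (u : C2) {s t : ℝ} (hs : s ∈ Icc (0 : ℝ) 1) (ht : t ∈ Icc (0 : ℝ) 1) :
    |deriv (u : ℝ → ℝ) t - deriv (u : ℝ → ℝ) s| ≤ √(C2.energy u u) := by
  have hc := C2.continuous_deriv_deriv u
  have hp : IsProbabilityMeasure (volume.restrict (Ioc (0 : ℝ) 1)) := ⟨by simp⟩
  have h1 := sq_integral_abs_le (ν := volume.restrict (Ioc (0 : ℝ) 1)) hc.integrableOn_Ioc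
    (hc.mul hc).integrableOn_Ioc
  rw [← intervalIntegral.integral_eq_sub_of_hasDerivAt
    (fun x _ => (C2.contDiff u).deriv_facts.2.1 x) (hc.intervalIntegrable s t)]
  refine (intervalIntegral.norm_integral_le_integral_norm_uIoc
    (f := deriv (deriv (u : ℝ → ℝ)))).trans ?_
  refine (setIntegral_mono_set hc.norm.integrableOn_Ioc (ae_of_all _ fun _ => norm_nonneg _)
    (Ioc_subset_Ioc (le_min hs.1 ht.1) (max_le hs.2 ht.2)).eventuallyLE).trans ?_
  refine Real.le_sqrt_of_sq_le (h1.trans_eq ?_)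
  rw [C2.energy_apply, intervalIntegral.integral_of_le zero_le_one]

variable {μ : Measure ℝ} [IsProbabilityMeasure μ] [NullSingletonClass μ]

theorem exists_pos_variance (hμ : ∀ᵐ x ∂μ, x ∈ Ioc (0 : ℝ) 1) :
    0 < ∫ x, (x - ∫ y, y ∂μ) * (x - ∫ y, y ∂μ) ∂μ := by
  set m := ∫ y, y ∂μ
  have hint : Integrable (fun x : ℝ => (x - m) * (x - m)) μ :=
    (((by fun_prop : Continuous fun x : ℝ => (x - m) * (x - m))).memLp_of_ae_mem_Ioc hμ
      1).integrable le_rfl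
  refine lt_of_le_of_ne (integral_nonneg fun s => mul_self_nonneg _) fun h0 => ?_
  have h1 := (integral_eq_zero_iff_of_nonneg (fun s => mul_self_nonneg _) hint).1 h0.symm
  have h2 : ∀ᵐ x ∂μ, x ≠ m := measure_eq_zero_iff_ae_notMem.1 (measure_singleton m)
  obtain ⟨x, hx1, hx2⟩ := (h1.and h2).exists
  exact hx2 (sub_eq_zero.1 (mul_self_eq_zero.1 hx1))

/-- Trace inequalities: boundary values and slopes are controlled by the energy and the mass. -/
theorem exists_trace_bound (hμ : ∀ᵐ x ∂μ, x ∈ Ioc (0 : ℝ) 1) : ∃ C, 0 ≤ C ∧ ∀ u : C2,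
    C2.eval 0 u ^ 2 ≤ C * (C2.energy u u + C2.mass μ hμ u u) ∧
    C2.eval 1 u ^ 2 ≤ C * (C2.energy u u + C2.mass μ hμ u u) ∧
    C2.slope 0 u ^ 2 ≤ C * (C2.energy u u + C2.mass μ hμ u u) ∧
    C2.slope 1 u ^ 2 ≤ C * (C2.energy u u + C2.mass μ hμ u u) := by
  have hV := exists_pos_variance hμ
  set m := ∫ y, y ∂μ with hm
  set V := ∫ x, (x - m) * (x - m) ∂μ with hVdef
  have hci : ∀ {g : ℝ → ℝ}, Continuous g → Integrable g μ := fun hg =>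
    (hg.memLp_of_ae_mem_Ioc hμ 1).integrable le_rfl
  have hm01 : m ∈ Icc (0 : ℝ) 1 := by
    constructor
    · exact integral_nonneg_of_ae (hμ.mono fun x hx => hx.1.le)
    · have := integral_mono_ae (hci continuous_id) (integrable_const (1 : ℝ))
        (hμ.mono fun x hx => hx.2)
      simpa using this
  refine ⟨(2 + V⁻¹) ^ 2 * 2, by positivity, fun u => ?_⟩
  obtain ⟨u1, u2, uc, uc1, uc2⟩ := (C2.contDiff u).deriv_facts
  set E := C2.energy u u
  set N := C2.mass μ hμ u u with hN
  have hE : 0 ≤ E := C2.energy_self_nonneg u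
  have hN0 : 0 ≤ N := integral_nonneg fun s => mul_self_nonneg _
  have i0 : (0 : ℝ) ∈ Icc (0 : ℝ) 1 := ⟨le_rfl, zero_le_one⟩
  have i1 : (1 : ℝ) ∈ Icc (0 : ℝ) 1 := ⟨zero_le_one, le_rfl⟩
  have hL1 : ∫ x, |(u : ℝ → ℝ) x| ∂μ ≤ √N :=
    Real.le_sqrt_of_sq_le (sq_integral_abs_le (hci uc) (hci (uc.mul uc)))
  set S := √E + √N with hS
  have hS0 : 0 ≤ S := by positivity
  have hSsq : S ^ 2 ≤ 2 * (E + N) := by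
    nlinarith [Real.sq_sqrt hE, Real.sq_sqrt hN0, sq_nonneg (√E - √N)]
  set B := deriv (u : ℝ → ℝ) 0 with hB
  -- the linear part is controlled by testing against `x - m`
  have hρ : ∀ x ∈ Icc (0 : ℝ) 1,
      |(u : ℝ → ℝ) x - (u : ℝ → ℝ) m - B * (x - m)| ≤ √E := fun x hx => by
    have := Convex.norm_image_sub_le_of_norm_hasDerivWithin_le (s := Icc (0 : ℝ) 1)
      (f := fun x => (u : ℝ → ℝ) x - B * x) (f' := fun x => deriv (u : ℝ → ℝ) x - B) (C := √E)
      (fun x _ => ((u1 x).sub ((hasDerivAt_id x).const_mul B)).hasDerivWithinAt.congr_deriv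
        (by simp)) (fun x hx => abs_deriv_sub_le u i0 hx) (convex_Icc 0 1) hm01 hx
    have h1 : ‖x - m‖ ≤ 1 := abs_le.2 ⟨by linarith [hx.1, hm01.2], by linarith [hx.2, hm01.1]⟩
    have h2 : (u : ℝ → ℝ) x - (u : ℝ → ℝ) m - B * (x - m) =
        (u : ℝ → ℝ) x - B * x - ((u : ℝ → ℝ) m - B * m) := by ring
    rw [h2]
    exact this.trans (mul_le_of_le_one_right (Real.sqrt_nonneg _) h1)
  have hmean : ∫ x, (x - m) ∂μ = 0 := by
    rw [integral_sub (hci (g := fun x => x) continuous_id) (integrable_const _)]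
    simp [hm]
  have hBV : B * V = (∫ x, (u : ℝ → ℝ) x * (x - m) ∂μ) -
      ∫ x, ((u : ℝ → ℝ) x - (u : ℝ → ℝ) m - B * (x - m)) * (x - m) ∂μ := by
    have e : ∀ x, ((u : ℝ → ℝ) x - (u : ℝ → ℝ) m - B * (x - m)) * (x - m) =
        (u : ℝ → ℝ) x * (x - m) - ((u : ℝ → ℝ) m * (x - m) + B * ((x - m) * (x - m))) :=
      fun x => by ring
    simp only [e]
    rw [integral_sub (hci (by fun_prop)) (hci (by fun_prop)),
      integral_add (hci (by fun_prop)) (hci (by fun_prop)), integral_const_mul, integral_const_mul,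
      hmean]
    ring
  have hxm : ∀ x ∈ Ioc (0 : ℝ) 1, |x - m| ≤ 1 := fun x hx =>
    abs_le.2 ⟨by linarith [hx.1, hm01.2], by linarith [hx.2, hm01.1]⟩
  have hB1 : |∫ x, (u : ℝ → ℝ) x * (x - m) ∂μ| ≤ √N := by
    refine (abs_integral_le_integral_abs.trans ?_).trans hL1
    refine integral_mono_ae (hci (by fun_prop)) (hci uc.abs) (hμ.mono fun x hx => ?_)
    simp only [abs_mul]
    exact mul_le_of_le_one_right (abs_nonneg _) (hxm x hx)
  have hB2 : |∫ x, ((u : ℝ → ℝ) x - (u : ℝ → ℝ) m - B * (x - m)) * (x - m) ∂μ| ≤ √E := by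
    refine abs_integral_le_integral_abs.trans ?_
    have := integral_mono_ae (hci (g := fun x =>
      |((u : ℝ → ℝ) x - (u : ℝ → ℝ) m - B * (x - m)) * (x - m)|) (by fun_prop))
      (integrable_const √E) (hμ.mono fun x hx => by
        simp only [abs_mul]
        exact (mul_le_of_le_one_right (abs_nonneg _) (hxm x hx)).trans (hρ x ⟨hx.1.le, hx.2⟩))
    simpa using this
  have hBabs : |B| ≤ V⁻¹ * S := by
    rw [inv_mul_eq_div, le_div_iff₀ hV, ← abs_of_pos hV, ← abs_mul, hBV]
    exact (abs_sub _ _).trans (by linarith)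
  have hslope : ∀ t ∈ Icc (0 : ℝ) 1, |deriv (u : ℝ → ℝ) t| ≤ (1 + V⁻¹) * S := fun t ht => by
    have h1 := abs_deriv_sub_le u i0 ht
    have h2 := abs_add_le (deriv (u : ℝ → ℝ) t - B) B
    rw [sub_add_cancel] at h2
    have : √E ≤ S := le_add_of_nonneg_right (Real.sqrt_nonneg _)
    linarith
  have heval : ∀ t ∈ Icc (0 : ℝ) 1, |(u : ℝ → ℝ) t| ≤ (2 + V⁻¹) * S := fun t ht => by
    have h1 : ∀ x ∈ Ioc (0 : ℝ) 1, |(u : ℝ → ℝ) t - (u : ℝ → ℝ) x| ≤ (1 + V⁻¹) * S := fun x hx => by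
      have := Convex.norm_image_sub_le_of_norm_hasDerivWithin_le (s := Icc (0 : ℝ) 1)
        (f := (u : ℝ → ℝ)) (fun x _ => (u1 x).hasDerivWithinAt) hslope (convex_Icc 0 1)
        ⟨hx.1.le, hx.2⟩ ht
      have h1 : ‖t - x‖ ≤ 1 := abs_le.2 ⟨by linarith [hx.2, ht.1], by linarith [hx.1, ht.2]⟩
      exact this.trans (mul_le_of_le_one_right (by positivity) h1)
    have h2 := integral_mono_ae (integrable_const |(u : ℝ → ℝ) t|)
      ((integrable_const ((1 + V⁻¹) * S)).add (hci uc.abs)) (hμ.mono fun x hx => by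
        have h3 := abs_add_le ((u : ℝ → ℝ) t - (u : ℝ → ℝ) x) ((u : ℝ → ℝ) x)
        rw [sub_add_cancel] at h3
        exact h3.trans (add_le_add (h1 x hx) le_rfl))
    simp only [Pi.add_apply] at h2
    rw [integral_add (integrable_const _) (hci uc.abs)] at h2
    simp only [integral_const, probReal_univ, one_smul] at h2
    have : √N ≤ S := le_add_of_nonneg_left (Real.sqrt_nonneg _)
    linarith
  have hfin : ∀ r : ℝ, |r| ≤ (2 + V⁻¹) * S → r ^ 2 ≤ (2 + V⁻¹) ^ 2 * 2 * (E + N) := fun r hr => by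
    rw [← sq_abs]
    calc |r| ^ 2 ≤ ((2 + V⁻¹) * S) ^ 2 := by gcongr
      _ = (2 + V⁻¹) ^ 2 * S ^ 2 := by ring
      _ ≤ (2 + V⁻¹) ^ 2 * (2 * (E + N)) := by gcongr
      _ = _ := by ring
  have hle : (1 + V⁻¹) * S ≤ (2 + V⁻¹) * S := by gcongr; norm_num
  exact ⟨hfin _ (heval 0 i0), hfin _ (heval 1 i1), hfin _ ((hslope 0 i0).trans hle),
    hfin _ ((hslope 1 i1).trans hle)⟩

end Traces

section Affine

open MeasureTheory

/-- The function `t ↦ φ (c + s t)`. -/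
noncomputable def C2.affineComp (c s : ℝ) (φ : C2) : C2 :=
  ⟨fun t => (φ : ℝ → ℝ) (c + s * t), mem_C2.2 ((C2.contDiff φ).comp (by fun_prop))⟩

theorem C2.affineComp_apply (c s : ℝ) (φ : C2) (t : ℝ) :
    (C2.affineComp c s φ : ℝ → ℝ) t = (φ : ℝ → ℝ) (c + s * t) := rfl

theorem C2.deriv_affineComp (c s : ℝ) (φ : C2) (t : ℝ) :
    deriv (C2.affineComp c s φ : ℝ → ℝ) t = s * deriv (φ : ℝ → ℝ) (c + s * t) := by
  have h1 : HasDerivAt (fun t => c + s * t) s t := by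
    simpa using ((hasDerivAt_id t).const_mul s).const_add c
  have := ((C2.contDiff φ).deriv_facts.1 (c + s * t)).comp t h1
  rw [mul_comm]
  exact this.deriv

theorem C2.deriv_deriv_affineComp (c s : ℝ) (φ : C2) (t : ℝ) :
    deriv (deriv (C2.affineComp c s φ : ℝ → ℝ)) t = s ^ 2 * deriv (deriv (φ : ℝ → ℝ)) (c + s * t) := by
  have h1 : HasDerivAt (fun t => c + s * t) s t := by
    simpa using ((hasDerivAt_id t).const_mul s).const_add c
  have := (((C2.contDiff φ).deriv_facts.2.1 (c + s * t)).comp t h1).const_mul s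
  rw [funext fun t => C2.deriv_affineComp c s φ t]
  refine this.deriv.trans ?_
  ring

theorem C2.affineComp_neg_inv {l a : ℝ} (ha : a ≠ 0) (φ : C2) :
    C2.affineComp (-l / a) a⁻¹ (C2.affineComp l a φ) = φ := by
  refine Subtype.ext (funext fun t => ?_)
  rw [C2.affineComp_apply, C2.affineComp_apply,
    show l + a * (-l / a + a⁻¹ * t) = t by field_simp; ring]

theorem C2.integral_deriv_deriv_mul_affineComp {l a : ℝ} (ha : 0 < a) (z φ : C2) :
    ∫ x in l..l + a, deriv (deriv (z : ℝ → ℝ)) x *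
        deriv (deriv (C2.affineComp (-l / a) a⁻¹ φ : ℝ → ℝ)) x =
      a⁻¹ ^ 3 * C2.energy (C2.affineComp l a z) φ := by
  have h := intervalIntegral.integral_comp_add_mul (a := 0) (b := 1) (fun x =>
    deriv (deriv (z : ℝ → ℝ)) x * deriv (deriv (C2.affineComp (-l / a) a⁻¹ φ : ℝ → ℝ)) x) ha.ne' l
  have e : ∀ t, deriv (deriv (z : ℝ → ℝ)) (l + a * t) *
      deriv (deriv (C2.affineComp (-l / a) a⁻¹ φ : ℝ → ℝ)) (l + a * t) = a⁻¹ ^ 4 *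
      (deriv (deriv (C2.affineComp l a z : ℝ → ℝ)) t * deriv (deriv (φ : ℝ → ℝ)) t) := fun t => by
    rw [C2.deriv_deriv_affineComp, C2.deriv_deriv_affineComp,
      show -l / a + a⁻¹ * (l + a * t) = t by field_simp; ring]
    field_simp
  simp only [e, intervalIntegral.integral_const_mul, mul_zero, add_zero, mul_one,
    smul_eq_mul] at h
  rw [← C2.energy_apply] at h
  rw [← mul_right_inj' (inv_ne_zero ha.ne'), ← h]
  ring

variable {μ : Measure ℝ} [NullSingletonClass μ] {β : ℝ} {f z : ℝ → ℝ}

/-- On an interval without mass a weak solution is a cubic polynomial. -/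
theorem IsWeakSol.eq_of_measure_eq_zero (h : IsWeakSol μ β f z) (hf : Integrable f μ) {l r : ℝ}
    (hl : 0 ≤ l) (hlr : l < r) (hr : r ≤ 1) (hμ : μ (Ioc l r) = 0) :
    cumulative μ f r = cumulative μ f l ∧
    deriv (deriv z) r = deriv (deriv z) l + cumulative μ f l * (r - l) ∧
    deriv z r = deriv z l + deriv (deriv z) l * (r - l) + cumulative μ f l * (r - l) ^ 2 / 2 ∧
    z r = z l + deriv z l * (r - l) + deriv (deriv z) l * (r - l) ^ 2 / 2 +
      cumulative μ f l * (r - l) ^ 3 / 6 := by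
  obtain ⟨z1, z2, -, -, -⟩ := h.contDiff.deriv_facts
  set F := cumulative μ f l with hF
  set A := deriv (deriv z) l with hA
  have hFc := continuous_cumulative' hf
  have hconst : EqOn (cumulative μ f) (fun _ => F) (Icc l r) := fun t ht => by
    have h1 : ∫ s in l..t, f s ∂μ = 0 := by
      rw [intervalIntegral.integral_of_le ht.1]
      exact setIntegral_measure_zero _ (measure_mono_null (Ioc_subset_Ioc_right ht.2) hμ)
    have h2 := intervalIntegral.integral_add_adjacent_intervals (μ := μ) (f := f) (a := 0) (b := l)
      (c := t) hf.intervalIntegrable hf.intervalIntegrable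
    rw [h1, add_zero] at h2
    exact h2.symm
  have hsecond : ∀ x ∈ Icc l r, deriv (deriv z) x =
      deriv (deriv z) 0 + prim (cumulative μ f) x := fun x hx =>
    h.second x ⟨hl.trans hx.1, hx.2.trans hr⟩
  have i1 : l ∈ Icc l r := ⟨le_rfl, hlr.le⟩
  have i2 : r ∈ Icc l r := ⟨hlr.le, le_rfl⟩
  have d : ∀ x, HasDerivAt (fun x => x - l) 1 x := fun x => (hasDerivAt_id x).sub_const l
  have e2 : EqOn (deriv (deriv z)) (fun x => A + F * (x - l)) (Icc l r) := by
    have := eqOn_Icc_of_hasDerivWithinAt hlr (fun x _ => ((hasDerivAt_prim hFc x).const_add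
      (deriv (deriv z) 0)).hasDerivWithinAt) (fun x => ((d x).const_mul F).const_add A)
      (fun x hx => by rw [hconst hx, mul_one]) (by rw [← hsecond l i1, sub_self, mul_zero, add_zero])
    exact fun x hx => (hsecond x hx).trans (this hx)
  have e1 : EqOn (deriv z) (fun x => deriv z l + A * (x - l) + F * (x - l) ^ 2 / 2) (Icc l r) :=
    eqOn_Icc_of_hasDerivWithinAt hlr (fun x _ => (z2 x).hasDerivWithinAt)
      (fun x => (((d x).const_mul A).const_add (deriv z l)).add
        ((((d x).pow 2).const_mul F).div_const 2))
      (fun x hx => by rw [e2 hx]; simp; ring) (by simp)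
  have e0 : EqOn z (fun x => z l + deriv z l * (x - l) + A * (x - l) ^ 2 / 2 +
      F * (x - l) ^ 3 / 6) (Icc l r) :=
    eqOn_Icc_of_hasDerivWithinAt hlr (fun x _ => (z1 x).hasDerivWithinAt)
      (fun x => ((((d x).const_mul (deriv z l)).const_add (z l)).add
        ((((d x).pow 2).const_mul A).div_const 2)).add ((((d x).pow 3).const_mul F).div_const 6))
      (fun x hx => by rw [e1 hx]; simp; ring) (by simp)
  exact ⟨hconst i2, e2 i2, e1 i2, e0 i2⟩

end Affine

section Pieces

open MeasureTheory

/-- The restrictions of `z` to the similar pieces, rescaled to `[0,1]`. -/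
noncomputable def restrictPieces (κ : ℕ) (a : ℝ) (z : C2) (k : ℕ) : C2 :=
  C2.affineComp (leftEnd κ a k) a z

/-- The rescaling of `φ` from `[0,1]` to the `k`-th similar piece. -/
noncomputable def onPiece (κ : ℕ) (a : ℝ) (k : ℕ) (φ : C2) : C2 :=
  C2.affineComp (-leftEnd κ a k / a) a⁻¹ φ

/-- The function on the union of the similar pieces that is given by `φ k` on the `k`-th one. -/
noncomputable def gluePieces (κ : ℕ) (a : ℝ) (φ : ℕ → C2) (x : ℝ) : ℝ :=
  ∑ k ∈ Finset.range κ, (Ioc (leftEnd κ a k) (leftEnd κ a k + a)).indicator (onPiece κ a k (φ k)) x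

theorem onPiece_apply_add_mul {κ : ℕ} {a : ℝ} (ha : a ≠ 0) (k : ℕ) (φ : C2) (t : ℝ) :
    (onPiece κ a k φ : ℝ → ℝ) (leftEnd κ a k + a * t) = (φ : ℝ → ℝ) t := by
  rw [onPiece, C2.affineComp_apply,
    show -leftEnd κ a k / a + a⁻¹ * (leftEnd κ a k + a * t) = t by field_simp; ring]

theorem deriv_onPiece_add_mul {κ : ℕ} {a : ℝ} (ha : a ≠ 0) (k : ℕ) (φ : C2) (t : ℝ) :
    deriv (onPiece κ a k φ : ℝ → ℝ) (leftEnd κ a k + a * t) = a⁻¹ * deriv (φ : ℝ → ℝ) t := by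
  rw [onPiece, C2.deriv_affineComp]
  congr 2
  field_simp
  ring

namespace CantorSelfSimilar

variable {P : ℝ → ℝ} {κ : ℕ} {a : ℝ} {μ : Measure ℝ}

theorem gluePieces_eq (h : CantorSelfSimilar P κ a) (φ : ℕ → C2) {k : ℕ} (hk : k < κ) {x : ℝ}
    (hx : x ∈ Ioc (leftEnd κ a k) (leftEnd κ a k + a)) :
    gluePieces κ a φ x = (onPiece κ a k (φ k) : ℝ → ℝ) x := by
  rw [gluePieces, Finset.sum_eq_single_of_mem k (Finset.mem_range.2 hk) fun j _ hj =>
    indicator_of_notMem (h.disjoint_piece hj hx) _, indicator_of_mem hx]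

theorem memLp_gluePieces (hμ : IsDistribution P μ) (φ : ℕ → C2) (p : ENNReal) :
    MemLp (gluePieces κ a φ) p μ := by
  have := hμ.prob
  exact memLp_finsetSum _ fun k _ => ((C2.contDiff (onPiece κ a k (φ k))).continuous.memLp_of_ae_mem_Ioc
    hμ.ae_mem p).indicator measurableSet_Ioc

theorem gluePieces_restrictPieces (h : CantorSelfSimilar P κ a) (hμ : IsDistribution P μ) (z : C2) :
    gluePieces κ a (restrictPieces κ a z) =ᵐ[μ] z := by
  filter_upwards [h.ae_mem_piece hμ] with x hx
  simp only [mem_iUnion, Finset.mem_range] at hx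
  obtain ⟨k, hk, hx⟩ := hx
  rw [h.gluePieces_eq _ hk hx, onPiece, restrictPieces, C2.affineComp_neg_inv h.2.2.2.2.2.1.ne']

theorem integral_mul_gluePieces (h : CantorSelfSimilar P κ a) (hμ : IsDistribution P μ) {f : ℝ → ℝ}
    (hf : Integrable f μ) (φ : ℕ → C2) :
    ∫ x, f x * gluePieces κ a φ x ∂μ = ∑ k ∈ Finset.range κ,
      ∫ x in leftEnd κ a k..leftEnd κ a k + a, f x * (onPiece κ a k (φ k) : ℝ → ℝ) x ∂μ := by
  have ha := h.2.2.2.2.2.1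
  have hi : Integrable (fun x => f x * gluePieces κ a φ x) μ :=
    hf.mul_of_top_left (memLp_gluePieces hμ φ _)
  rw [h.integral_eq_sum hμ hi]
  refine Finset.sum_congr rfl fun k hk => ?_
  rw [intervalIntegral.integral_of_le (by linarith), intervalIntegral.integral_of_le (by linarith)]
  refine setIntegral_congr_fun measurableSet_Ioc fun x hx => ?_
  simp only [h.gluePieces_eq φ (Finset.mem_range.1 hk) hx]

theorem integral_gluePieces_mul_gluePieces (h : CantorSelfSimilar P κ a) (hμ : IsDistribution P μ)
    (φ ψ : ℕ → C2) : ∫ x, gluePieces κ a φ x * gluePieces κ a ψ x ∂μ =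
      ∑ k ∈ Finset.range κ, (κ : ℝ)⁻¹ * ∫ t, (φ k : ℝ → ℝ) t * (ψ k : ℝ → ℝ) t ∂μ := by
  have := hμ.prob
  have ha := h.2.2.2.2.2.1
  rw [h.integral_mul_gluePieces hμ ((memLp_gluePieces hμ φ 1).integrable le_rfl)]
  refine Finset.sum_congr rfl fun k hk => ?_
  have hk := Finset.mem_range.1 hk
  obtain ⟨φ1, -, φc, φc1, -⟩ := (C2.contDiff (onPiece κ a k (φ k))).deriv_facts
  obtain ⟨ψ1, -, ψc, ψc1, -⟩ := (C2.contDiff (onPiece κ a k (ψ k))).deriv_facts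
  have e := h.integral_piece hμ hk (fun x => (φ1 x).mul (ψ1 x)) (by fun_prop)
  simp only [Pi.mul_apply, onPiece_apply_add_mul ha.ne'] at e
  rw [← e, intervalIntegral.integral_of_le (by linarith),
    intervalIntegral.integral_of_le (by linarith)]
  refine setIntegral_congr_fun measurableSet_Ioc fun x hx => ?_
  simp only [h.gluePieces_eq φ hk hx]

end CantorSelfSimilar

/-- The sum of a form over the first `κ` components. -/
noncomputable def sumForm (κ : ℕ) (B : LinearMap.BilinForm ℝ C2) : LinearMap.BilinForm ℝ (ℕ → C2) :=
  ∑ k ∈ Finset.range κ, B.compl₁₂ (LinearMap.proj k) (LinearMap.proj k)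

theorem sumForm_apply (κ : ℕ) (B : LinearMap.BilinForm ℝ C2) (φ ψ : ℕ → C2) :
    sumForm κ B φ ψ = ∑ k ∈ Finset.range κ, B (φ k) (ψ k) := by
  simp [sumForm, LinearMap.sum_apply]

/-- The change of slope across the gap between the pieces `k` and `k + 1`. -/
noncomputable def gapSlope (a : ℝ) (k : ℕ) : (ℕ → C2) →ₗ[ℝ] ℝ :=
  a⁻¹ • (C2.slope 0 ∘ₗ LinearMap.proj (k + 1) - C2.slope 1 ∘ₗ LinearMap.proj k)

/-- The deviation of the increment across the gap from the one of a parabola. -/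
noncomputable def gapJump (a b : ℝ) (k : ℕ) : (ℕ → C2) →ₗ[ℝ] ℝ :=
  C2.eval 0 ∘ₗ LinearMap.proj (k + 1) - C2.eval 1 ∘ₗ LinearMap.proj k -
    (b / (2 * a)) • (C2.slope 1 ∘ₗ LinearMap.proj k + C2.slope 0 ∘ₗ LinearMap.proj (k + 1))

/-- The quadratic form of the problem with parameter `β`, minimised over the gaps, in terms of the
rescaled restrictions to the pieces. -/
noncomputable def coupledForm (κ : ℕ) (a b β : ℝ) : LinearMap.BilinForm ℝ (ℕ → C2) :=
  a⁻¹ ^ 3 • sumForm κ C2.energy +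
  (β * a⁻¹ ^ 2) • (LinearMap.BilinForm.linMulLin (C2.slope 0 ∘ₗ LinearMap.proj 0)
      (C2.slope 0 ∘ₗ LinearMap.proj 0) +
    LinearMap.BilinForm.linMulLin (C2.slope 1 ∘ₗ LinearMap.proj (κ - 1))
      (C2.slope 1 ∘ₗ LinearMap.proj (κ - 1))) +
  ∑ k ∈ Finset.range (κ - 1), (b⁻¹ • LinearMap.BilinForm.linMulLin (gapSlope a k) (gapSlope a k) +
    (12 / b ^ 3) • LinearMap.BilinForm.linMulLin (gapJump a b k) (gapJump a b k))

theorem gapSlope_apply (a : ℝ) (k : ℕ) (φ : ℕ → C2) :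
    gapSlope a k φ = a⁻¹ * (C2.slope 0 (φ (k + 1)) - C2.slope 1 (φ k)) := rfl

theorem gapJump_apply (a b : ℝ) (k : ℕ) (φ : ℕ → C2) :
    gapJump a b k φ = C2.eval 0 (φ (k + 1)) - C2.eval 1 (φ k) -
      b / (2 * a) * (C2.slope 1 (φ k) + C2.slope 0 (φ (k + 1))) := rfl

theorem coupledForm_apply (κ : ℕ) (a b β : ℝ) (φ ψ : ℕ → C2) : coupledForm κ a b β φ ψ =
    a⁻¹ ^ 3 * (∑ k ∈ Finset.range κ, C2.energy (φ k) (ψ k)) +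
    β * a⁻¹ ^ 2 * (C2.slope 0 (φ 0) * C2.slope 0 (ψ 0) +
      C2.slope 1 (φ (κ - 1)) * C2.slope 1 (ψ (κ - 1))) +
    ∑ k ∈ Finset.range (κ - 1), (b⁻¹ * (gapSlope a k φ * gapSlope a k ψ) +
      12 / b ^ 3 * (gapJump a b k φ * gapJump a b k ψ)) := by
  simp [coupledForm, sumForm_apply, LinearMap.sum_apply, LinearMap.BilinForm.linMulLin_apply]
  ring

theorem coupledForm_comm (κ : ℕ) (a b β : ℝ) (φ ψ : ℕ → C2) :
    coupledForm κ a b β φ ψ = coupledForm κ a b β ψ φ := by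
  simp only [coupledForm_apply, C2.energy_comm, mul_comm]

theorem energy_le_coupledForm {κ : ℕ} {a b β : ℝ} (hb : 0 < b) (hβ : 0 ≤ β)
    (φ : ℕ → C2) : a⁻¹ ^ 3 * ∑ k ∈ Finset.range κ, C2.energy (φ k) (φ k) ≤
      coupledForm κ a b β φ φ := by
  rw [coupledForm_apply, add_assoc]
  refine le_add_of_nonneg_right (add_nonneg (mul_nonneg (by positivity) (add_nonneg
    (mul_self_nonneg _) (mul_self_nonneg _))) (Finset.sum_nonneg fun k _ => ?_))
  have := mul_self_nonneg (gapSlope a k φ)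
  have := mul_self_nonneg (gapJump a b k φ)
  positivity

end Pieces

section Coupling

open MeasureTheory

variable {P : ℝ → ℝ} {κ : ℕ} {a β : ℝ} {μ : Measure ℝ} {f : ℝ → ℝ} {z : C2}

theorem leftEnd_zero (κ : ℕ) (a : ℝ) : leftEnd κ a 0 = 0 := by simp [leftEnd]

theorem leftEnd_succ (κ : ℕ) (a : ℝ) (k : ℕ) :
    leftEnd κ a (k + 1) = leftEnd κ a k + a + bb κ a := by
  simp only [leftEnd]; push_cast; ring

theorem eval_restrictPieces (κ : ℕ) (a : ℝ) (z : C2) (k : ℕ) (t : ℝ) :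
    C2.eval t (restrictPieces κ a z k) = (z : ℝ → ℝ) (leftEnd κ a k + a * t) := rfl

theorem slope_restrictPieces (κ : ℕ) (a : ℝ) (z : C2) (k : ℕ) (t : ℝ) :
    C2.slope t (restrictPieces κ a z k) = a * deriv (z : ℝ → ℝ) (leftEnd κ a k + a * t) :=
  C2.deriv_affineComp _ _ _ _

/-- The boundary term at the point `t` of the `k`-th piece in the integration by parts formula. -/
noncomputable def pieceFlux (μ : Measure ℝ) (κ : ℕ) (a : ℝ) (f : ℝ → ℝ) (z : C2) (φ : ℕ → C2)
    (t : ℝ) (k : ℕ) : ℝ :=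
  deriv (deriv (z : ℝ → ℝ)) (leftEnd κ a k + a * t) * (a⁻¹ * C2.slope t (φ k)) -
    cumulative μ f (leftEnd κ a k + a * t) * C2.eval t (φ k)

namespace CantorSelfSimilar

theorem energy_restrictPieces (h : CantorSelfSimilar P κ a) (hμ : IsDistribution P μ)
    (hf : Integrable f μ) (hz : IsWeakSol μ β f z) (φ : ℕ → C2) {k : ℕ} (hk : k < κ) :
    a⁻¹ ^ 3 * C2.energy (restrictPieces κ a z k) (φ k) =
      pieceFlux μ κ a f z φ 1 k - pieceFlux μ κ a f z φ 0 k +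
      ∫ x in leftEnd κ a k..leftEnd κ a k + a, f x * (onPiece κ a k (φ k) : ℝ → ℝ) x ∂μ := by
  have := hμ.prob
  have := hμ.nullSingleton
  have ha := h.2.2.2.2.2.1
  obtain ⟨h0, h1⟩ := h.piece_subset hk
  have e1 := onPiece_apply_add_mul (κ := κ) ha.ne' k (φ k) 1
  have e0 := onPiece_apply_add_mul (κ := κ) ha.ne' k (φ k) 0
  have d1 := deriv_onPiece_add_mul (κ := κ) ha.ne' k (φ k) 1
  have d0 := deriv_onPiece_add_mul (κ := κ) ha.ne' k (φ k) 0
  rw [mul_one] at e1 d1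
  rw [mul_zero, add_zero] at e0 d0
  rw [restrictPieces, ← C2.integral_deriv_deriv_mul_affineComp ha,
    hz.integral_second_mul hf (C2.contDiff _) h0 (by linarith) h1]
  change (_ * deriv (onPiece κ a k (φ k) : ℝ → ℝ) _ - _ * (onPiece κ a k (φ k) : ℝ → ℝ) _) -
    (_ * deriv (onPiece κ a k (φ k) : ℝ → ℝ) _ - _ * (onPiece κ a k (φ k) : ℝ → ℝ) _) + _ = _
  rw [e1, e0, d1, d0, pieceFlux, pieceFlux, mul_one, mul_zero, add_zero]
  rfl

theorem pieceFlux_sub (h : CantorSelfSimilar P κ a) (hμ : IsDistribution P μ)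
    (hf : Integrable f μ) (hz : IsWeakSol μ β f z) (φ : ℕ → C2) {k : ℕ} (hk : k + 1 < κ) :
    pieceFlux μ κ a f z φ 0 (k + 1) - pieceFlux μ κ a f z φ 1 k =
      (bb κ a)⁻¹ * (gapSlope a k (restrictPieces κ a z) * gapSlope a k φ) +
      12 / bb κ a ^ 3 * (gapJump a (bb κ a) k (restrictPieces κ a z) * gapJump a (bb κ a) k φ) := by
  have := hμ.prob
  have := hμ.nullSingleton
  have ha := h.2.2.2.2.2.1
  have hb := h.gap.1
  have hs := leftEnd_succ κ a k
  obtain ⟨h0, -⟩ := h.piece_subset (k := k) (by omega)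
  obtain ⟨-, h1⟩ := h.piece_subset hk
  obtain ⟨q3, q2, q1, q0⟩ := hz.eq_of_measure_eq_zero hf (l := leftEnd κ a k + a)
    (r := leftEnd κ a (k + 1)) (by linarith) (by linarith) (by linarith)
    (h.measure_gap hμ (by omega))
  have hd : leftEnd κ a (k + 1) - (leftEnd κ a k + a) = bb κ a := by linarith
  rw [hd] at q2 q1 q0
  simp only [pieceFlux, gapSlope_apply, gapJump_apply, eval_restrictPieces, slope_restrictPieces,
    mul_one, mul_zero, add_zero, q3, q2, q1, q0]
  field_simp
  ring

/-- Restricting a weak solution to the similar pieces diagonalises the right-hand side. -/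
theorem coupledForm_restrictPieces (h : CantorSelfSimilar P κ a) (hμ : IsDistribution P μ)
    (hf : Integrable f μ) (hz : IsWeakSol μ β f z) (φ : ℕ → C2) :
    coupledForm κ a (bb κ a) β (restrictPieces κ a z) φ = ∫ x, f x * gluePieces κ a φ x ∂μ := by
  have ha := h.2.2.2.2.2.1
  have hsum : ∀ n, ∑ k ∈ Finset.range (n + 1),
      (pieceFlux μ κ a f z φ 1 k - pieceFlux μ κ a f z φ 0 k) =
      pieceFlux μ κ a f z φ 1 n - pieceFlux μ κ a f z φ 0 0 - ∑ k ∈ Finset.range n,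
        (pieceFlux μ κ a f z φ 0 (k + 1) - pieceFlux μ κ a f z φ 1 k) := fun n => by
    induction n with
    | zero => simp
    | succ n ih => rw [Finset.sum_range_succ, ih, Finset.sum_range_succ _ n]; ring
  obtain ⟨n, rfl⟩ : ∃ n, κ = n + 1 := ⟨κ - 1, by have := h.2.2.2.2.1; omega⟩
  have hlast : leftEnd (n + 1) a n + a = 1 := by
    have h1 := leftEnd_succ (n + 1) a n
    have h2 := h.gap.2
    rw [leftEnd] at h1
    linarith
  have f0 : pieceFlux μ (n + 1) a f z φ 0 0 =
      β * a⁻¹ ^ 2 * (C2.slope 0 (restrictPieces (n + 1) a z 0) * C2.slope 0 (φ 0)) := by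
    rw [pieceFlux, slope_restrictPieces, leftEnd_zero, mul_zero, add_zero, hz.left, cumulative,
      intervalIntegral.integral_same]
    field_simp
    ring
  have f1 : pieceFlux μ (n + 1) a f z φ 1 n =
      -(β * a⁻¹ ^ 2 * (C2.slope 1 (restrictPieces (n + 1) a z n) * C2.slope 1 (φ n))) := by
    rw [pieceFlux, slope_restrictPieces, mul_one, hlast, hz.right, cumulative, hz.mean]
    field_simp
    ring
  rw [h.integral_mul_gluePieces hμ hf, coupledForm_apply, Finset.mul_sum,
    Finset.sum_congr rfl fun k hk => h.energy_restrictPieces hμ hf hz φ (Finset.mem_range.1 hk),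
    Finset.sum_add_distrib, hsum, f0, f1, Nat.add_sub_cancel,
    ← Finset.sum_congr rfl fun k hk => h.pieceFlux_sub hμ hf hz φ
      (Nat.add_lt_add_right (Finset.mem_range.1 hk) 1)]
  ring

theorem spectralData_coupledForm (h : CantorSelfSimilar P κ a) (hμ : IsDistribution P μ)
    [IsProbabilityMeasure μ] (hβ : 0 < β) {ℓ : ℕ → ℝ} {W : ℕ → C2}
    (hW : EigenSystem μ β ℓ W) :
    SpectralData (coupledForm κ a (bb κ a) β) ((κ : ℝ)⁻¹ • sumForm κ (C2.mass μ hμ.ae_mem)) ℓ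
      (fun i => restrictPieces κ a (W i)) := by
  have := hμ.nullSingleton
  have ha := h.2.2.2.2.2.1
  refine hW.spectralData hμ.ae_mem hβ (J := gluePieces κ a) (coupledForm_comm κ a _ β) (fun φ => ?_)
    (fun f z hf hz φ => h.coupledForm_restrictPieces hμ hf hz φ)
    (fun φ => memLp_gluePieces hμ φ 2) (fun z => h.gluePieces_restrictPieces hμ z) (fun φ ψ => ?_)
  · refine le_trans ?_ (energy_le_coupledForm h.gap.1 hβ.le φ)
    exact mul_nonneg (by positivity) (Finset.sum_nonneg fun k _ => C2.energy_self_nonneg _)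
  · rw [h.integral_gluePieces_mul_gluePieces hμ, LinearMap.smul_apply, LinearMap.smul_apply,
      sumForm_apply, smul_eq_mul, Finset.mul_sum]
    rfl

end CantorSelfSimilar

end Coupling

section Decoupling

open MeasureTheory

theorem sumForm_single_right {κ : ℕ} (B : LinearMap.BilinForm ℝ C2) (φ : ℕ → C2) {k : ℕ}
    (hk : k < κ) (v : C2) : sumForm κ B φ (Pi.single k v) = B (φ k) v := by
  rw [sumForm_apply, Finset.sum_eq_single_of_mem k (Finset.mem_range.2 hk) fun j _ hj => by
    rw [Pi.single_eq_of_ne hj, map_zero], Pi.single_eq_same]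

/-- `κ` uncoupled copies of a problem have the same eigenvalues, each repeated `κ` times. -/
theorem SpectralData.sumForm {B N : LinearMap.BilinForm ℝ C2} {ℓ : ℕ → ℝ} {W : ℕ → C2}
    (h : SpectralData B N ℓ W) {κ : ℕ} (hκ : 0 < κ) {c : ℝ} (hc : 0 ≤ c) :
    SpectralData (c • sumForm κ B) ((κ : ℝ)⁻¹ • sumForm κ N) (fun i => κ * c * ℓ (i / κ))
      (fun i => Pi.single (i % κ) (√κ • W (i / κ))) := by
  have hκ' : (κ : ℝ) ≠ 0 := by positivity
  have hsq : √(κ : ℝ) * √κ = κ := Real.mul_self_sqrt (by positivity)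
  have hiff : ∀ i j : ℕ, i = j ↔ j % κ = i % κ ∧ i / κ = j / κ := fun i j =>
    ⟨by rintro rfl; simp, fun ⟨h1, h2⟩ => by rw [← Nat.div_add_mod i κ, ← Nat.div_add_mod j κ, h1, h2]⟩
  have key : ∀ (A : LinearMap.BilinForm ℝ C2) (d : ℕ → ℝ),
      (∀ i j, A (W i) (W j) = if i = j then d i else 0) → ∀ i j,
      _root_.sumForm κ A (Pi.single (i % κ) (√κ • W (i / κ))) (Pi.single (j % κ) (√κ • W (j / κ))) =
        if i = j then κ * d (i / κ) else 0 := fun A d hA i j => by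
    rw [sumForm_single_right A _ (Nat.mod_lt j hκ)]
    by_cases h1 : j % κ = i % κ
    · rw [h1, Pi.single_eq_same]
      simp only [map_smul, LinearMap.smul_apply, hA, smul_eq_mul, hiff i j, h1, true_and]
      split_ifs
      · rw [← mul_assoc, hsq]
      · simp
    · rw [Pi.single_eq_of_ne h1, if_neg fun e => h1 ((hiff i j).1 e).1]
      simp
  refine ⟨fun i => mul_nonneg (by positivity) (h.nonneg _), fun i j => ?_, fun i j => ?_,
    fun i φ hφ => ?_⟩
  · rw [LinearMap.smul_apply, LinearMap.smul_apply, key N (fun _ => 1) h.orthonormal, smul_eq_mul]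
    split_ifs
    · field_simp
    · simp
  · rw [LinearMap.smul_apply, LinearMap.smul_apply, key B ℓ h.diagonal, smul_eq_mul]
    split_ifs
    · ring
    · simp
  · have hpiece : ∀ k ∈ Finset.range κ, ℓ (i / κ) * N (φ k) (φ k) ≤ B (φ k) (φ k) := fun k hk => by
      have hk := Finset.mem_range.1 hk
      refine h.lower_bound _ _ fun j hj => ?_
      have hlt : j * κ + k < i := by
        have : (j + 1) * κ ≤ i / κ * κ := Nat.mul_le_mul_right κ hj
        have := Nat.div_mul_le_self i κ
        rw [add_mul] at *
        omega
      have h1 : (j * κ + k) % κ = k := by rw [mul_comm, Nat.mul_add_mod, Nat.mod_eq_of_lt hk]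
      have h2 : (j * κ + k) / κ = j := by
        rw [mul_comm, Nat.mul_add_div hκ, Nat.div_eq_of_lt hk, add_zero]
      have := hφ _ hlt
      rw [h1, h2, LinearMap.smul_apply, LinearMap.smul_apply, sumForm_single_right N _ hk, map_smul,
        smul_eq_mul, smul_eq_mul] at this
      have hs : √(κ : ℝ) ≠ 0 := by positivity
      simpa [hκ', hs] using this
    simp only [LinearMap.smul_apply, sumForm_apply, smul_eq_mul]
    calc κ * c * ℓ (i / κ) * ((κ : ℝ)⁻¹ * ∑ k ∈ Finset.range κ, N (φ k) (φ k))
        = c * ∑ k ∈ Finset.range κ, ℓ (i / κ) * N (φ k) (φ k) := by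
          rw [← Finset.mul_sum]; field_simp
      _ ≤ _ := mul_le_mul_of_nonneg_left (Finset.sum_le_sum hpiece) hc

/-- Boundary values and slopes on the pieces. -/
noncomputable def pieceTrace (κ : ℕ) (p : Fin 4 × Fin κ) : (ℕ → C2) →ₗ[ℝ] ℝ :=
  ![C2.eval 0, C2.eval 1, C2.slope 0, C2.slope 1] p.1 ∘ₗ LinearMap.proj (p.2 : ℕ)

theorem sq_trace_le_sum {κ k : ℕ} (hk : k < κ) (φ : ℕ → C2) :
    C2.eval 0 (φ k) ^ 2 ≤ ∑ p : Fin 4 × Fin κ, pieceTrace κ p φ ^ 2 ∧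
    C2.eval 1 (φ k) ^ 2 ≤ ∑ p : Fin 4 × Fin κ, pieceTrace κ p φ ^ 2 ∧
    C2.slope 0 (φ k) ^ 2 ≤ ∑ p : Fin 4 × Fin κ, pieceTrace κ p φ ^ 2 ∧
    C2.slope 1 (φ k) ^ 2 ≤ ∑ p : Fin 4 × Fin κ, pieceTrace κ p φ ^ 2 := by
  have key : ∀ i : Fin 4, pieceTrace κ (i, ⟨k, hk⟩) φ ^ 2 ≤
      ∑ p : Fin 4 × Fin κ, pieceTrace κ p φ ^ 2 := fun i =>
    Finset.single_le_sum (f := fun p => pieceTrace κ p φ ^ 2) (fun _ _ => sq_nonneg _)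
      (Finset.mem_univ _)
  exact ⟨key 0, key 1, key 2, key 3⟩

theorem coupledForm_le {κ : ℕ} (hκ : 0 < κ) {a b β : ℝ} (hb : 0 < b) (hβ : 0 ≤ β) :
    ∃ K, 0 ≤ K ∧ ∀ φ, coupledForm κ a b β φ φ ≤
      a⁻¹ ^ 3 * ∑ k ∈ Finset.range κ, C2.energy (φ k) (φ k) +
        K * ∑ p : Fin 4 × Fin κ, pieceTrace κ p φ ^ 2 := by
  set c := b / (2 * a)
  refine ⟨β * a⁻¹ ^ 2 * 2 + (κ - 1 : ℕ) *
    (b⁻¹ * (4 * a⁻¹ ^ 2) + 12 / b ^ 3 * (8 + 8 * c ^ 2)), by positivity, fun φ => ?_⟩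
  set S := ∑ p : Fin 4 × Fin κ, pieceTrace κ p φ ^ 2 with hS
  obtain ⟨-, -, h0, -⟩ := sq_trace_le_sum hκ φ
  obtain ⟨-, -, -, h1⟩ := sq_trace_le_sum (κ := κ) (k := κ - 1) (by omega) φ
  rw [← hS] at h0 h1
  have hgap : ∀ k ∈ Finset.range (κ - 1), b⁻¹ * (gapSlope a k φ * gapSlope a k φ) +
      12 / b ^ 3 * (gapJump a b k φ * gapJump a b k φ) ≤
      (b⁻¹ * (4 * a⁻¹ ^ 2) + 12 / b ^ 3 * (8 + 8 * c ^ 2)) * S := fun k hk => by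
    have hk := Finset.mem_range.1 hk
    obtain ⟨-, q1, -, q3⟩ := sq_trace_le_sum (κ := κ) (k := k) (by omega) φ
    obtain ⟨r0, -, r2, -⟩ := sq_trace_le_sum (κ := κ) (k := k + 1) (by omega) φ
    rw [← hS] at q1 q3 r0 r2
    rw [gapSlope_apply, gapJump_apply]
    set e0 := C2.eval 0 (φ (k + 1))
    set e1 := C2.eval 1 (φ k)
    set s0 := C2.slope 0 (φ (k + 1))
    set s1 := C2.slope 1 (φ k)
    have g1 : a⁻¹ * (s0 - s1) * (a⁻¹ * (s0 - s1)) ≤ 4 * a⁻¹ ^ 2 * S := by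
      have : (s0 - s1) ^ 2 ≤ 4 * S := by nlinarith [sq_nonneg (s0 + s1)]
      calc _ = a⁻¹ ^ 2 * (s0 - s1) ^ 2 := by ring
        _ ≤ a⁻¹ ^ 2 * (4 * S) := by gcongr
        _ = _ := by ring
    have g2 : (e0 - e1 - c * (s1 + s0)) * (e0 - e1 - c * (s1 + s0)) ≤ (8 + 8 * c ^ 2) * S := by
      have p1 : (e0 - e1) ^ 2 ≤ 4 * S := by nlinarith [sq_nonneg (e0 + e1)]
      have p2 : (s1 + s0) ^ 2 ≤ 4 * S := by nlinarith [sq_nonneg (s0 - s1)]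
      calc _ ≤ 2 * (e0 - e1) ^ 2 + 2 * (c ^ 2 * (s1 + s0) ^ 2) := by
            nlinarith [sq_nonneg (e0 - e1 + c * (s1 + s0))]
        _ ≤ 2 * (4 * S) + 2 * (c ^ 2 * (4 * S)) := by gcongr
        _ = _ := by ring
    calc _ ≤ b⁻¹ * (4 * a⁻¹ ^ 2 * S) + 12 / b ^ 3 * ((8 + 8 * c ^ 2) * S) := by gcongr
      _ = _ := by ring
  rw [coupledForm_apply]
  have hsum := Finset.sum_le_sum hgap
  rw [Finset.sum_const, Finset.card_range, nsmul_eq_mul] at hsum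
  have hbd : β * a⁻¹ ^ 2 * (C2.slope 0 (φ 0) * C2.slope 0 (φ 0) +
      C2.slope 1 (φ (κ - 1)) * C2.slope 1 (φ (κ - 1))) ≤ β * a⁻¹ ^ 2 * (2 * S) := by
    gcongr
    nlinarith
  linarith

theorem sumForm_form_le {κ : ℕ} {c β : ℝ} (hc : 0 ≤ c) (hβ : 0 ≤ β) :
    ∃ K, 0 ≤ K ∧ ∀ φ, (c • sumForm κ (C2.form β)) φ φ ≤
      c * ∑ k ∈ Finset.range κ, C2.energy (φ k) (φ k) +
        K * ∑ p : Fin 4 × Fin κ, pieceTrace κ p φ ^ 2 := by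
  refine ⟨c * (κ * (β * 2)), by positivity, fun φ => ?_⟩
  set S := ∑ p : Fin 4 × Fin κ, pieceTrace κ p φ ^ 2 with hS
  have hk : ∀ k ∈ Finset.range κ, C2.form β (φ k) (φ k) ≤
      C2.energy (φ k) (φ k) + β * 2 * S := fun k hk => by
    obtain ⟨-, -, h0, h1⟩ := sq_trace_le_sum (Finset.mem_range.1 hk) φ
    rw [← hS] at h0 h1
    rw [C2.form_apply, mul_assoc]
    gcongr
    linarith [sq (C2.slope 0 (φ k)), sq (C2.slope 1 (φ k))]
  simp only [LinearMap.smul_apply, sumForm_apply, smul_eq_mul]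
  calc _ ≤ c * ∑ k ∈ Finset.range κ, (C2.energy (φ k) (φ k) + β * 2 * S) := by
        gcongr with k hk'; exact hk k hk'
    _ = _ := by rw [Finset.sum_add_distrib, Finset.sum_const, Finset.card_range, nsmul_eq_mul]; ring

theorem exists_pieceTrace_bound {μ : Measure ℝ} [IsProbabilityMeasure μ] [NullSingletonClass μ]
    (hμ : ∀ᵐ x ∂μ, x ∈ Ioc (0 : ℝ) 1) {κ : ℕ} {c : ℝ} (hc : 0 < c) :
    ∃ C, 0 ≤ C ∧ ∀ (p : Fin 4 × Fin κ) φ, pieceTrace κ p φ ^ 2 ≤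
      C * (c * ∑ k ∈ Finset.range κ, C2.energy (φ k) (φ k) +
        ((κ : ℝ)⁻¹ • sumForm κ (C2.mass μ hμ)) φ φ) := by
  obtain ⟨C, hC, h⟩ := exists_trace_bound hμ
  refine ⟨C * (c⁻¹ + κ), by positivity, fun ⟨i, k, hk⟩ φ => ?_⟩
  have hκ : 0 < (κ : ℝ) := by exact_mod_cast (Nat.zero_le k).trans_lt hk
  have hi : pieceTrace κ (i, ⟨k, hk⟩) φ ^ 2 ≤
      C * (C2.energy (φ k) (φ k) + C2.mass μ hμ (φ k) (φ k)) := by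
    obtain ⟨h0, h1, h2, h3⟩ := h (φ k)
    fin_cases i
    exacts [h0, h1, h2, h3]
  have hm : ∀ k, 0 ≤ C2.mass μ hμ (φ k) (φ k) := fun k => integral_nonneg fun _ => mul_self_nonneg _
  have hE := Finset.single_le_sum (f := fun k => C2.energy (φ k) (φ k))
    (fun _ _ => C2.energy_self_nonneg _) (Finset.mem_range.2 hk)
  have hM := Finset.single_le_sum (f := fun k => C2.mass μ hμ (φ k) (φ k))
    (fun _ _ => hm _) (Finset.mem_range.2 hk)
  simp only [LinearMap.smul_apply, sumForm_apply, smul_eq_mul] at *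
  set E := ∑ k ∈ Finset.range κ, C2.energy (φ k) (φ k)
  set N := ∑ k ∈ Finset.range κ, C2.mass μ hμ (φ k) (φ k)
  have hE0 : 0 ≤ E := (C2.energy_self_nonneg _).trans hE
  have hN0 : 0 ≤ N := (hm k).trans hM
  refine hi.trans ?_
  rw [mul_assoc]
  refine mul_le_mul_of_nonneg_left ?_ hC
  have e : (c⁻¹ + κ) * (c * E + (κ : ℝ)⁻¹ * N) = E + N + (κ * (c * E) + c⁻¹ * ((κ : ℝ)⁻¹ * N)) := by
    field_simp
    ring
  rw [e]
  have : 0 ≤ κ * (c * E) + c⁻¹ * ((κ : ℝ)⁻¹ * N) := by positivity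
  linarith

end Decoupling

section Asymptotics

open MeasureTheory

/-- The eigenvalues are asymptotically those of `κ` uncoupled rescaled copies of the problem. -/
theorem CantorSelfSimilar.summable_abs_log_add_one_sub {P : ℝ → ℝ} {κ : ℕ} {a : ℝ}
    (h : CantorSelfSimilar P κ a) {μ : Measure ℝ} (hμ : IsDistribution P μ) {β β' : ℝ}
    (hβ : 0 < β) (hβ' : 0 < β') {ℓ ℓ' : ℕ → ℝ} {W W' : ℕ → C2} (hW : EigenSystem μ β ℓ W)
    (hW' : EigenSystem μ β' ℓ' W') :
    Summable fun i => |Real.log (ℓ i + 1) - Real.log (κ * a⁻¹ ^ 3 * ℓ' (i / κ) + 1)| := by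
  have := hμ.prob
  have := hμ.nullSingleton
  have ha := h.2.2.2.2.2.1
  have hκ : 0 < κ := by have := h.2.2.2.2.1; omega
  have hc : 0 < a⁻¹ ^ 3 := by positivity
  obtain ⟨K, hK, hQ⟩ := coupledForm_le hκ (a := a) h.gap.1 hβ.le
  obtain ⟨K', hK', hQ'⟩ := sumForm_form_le (κ := κ) hc.le hβ'.le
  obtain ⟨C, hC, hl⟩ := exists_pieceTrace_bound hμ.ae_mem (κ := κ) hc
  refine SpectralData.summable_abs_log_sub ((hW'.spectralData_form hμ.ae_mem hβ').sumForm hκ hc.le)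
    (h.spectralData_coupledForm hμ hβ hW) (s := Finset.univ) (add_nonneg hK hK') hC (fun φ => ?_)
    (fun φ => (hQ' φ).trans ?_) (energy_le_coupledForm h.gap.1 hβ.le) (fun φ => (hQ φ).trans ?_) hl
  · simp only [LinearMap.smul_apply, sumForm_apply, smul_eq_mul]
    exact mul_le_mul_of_nonneg_left (Finset.sum_le_sum fun k _ => C2.energy_le_form hβ'.le _) hc.le
  · gcongr; exact le_add_of_nonneg_left hK
  · gcongr; exact le_add_of_nonneg_right hK'

theorem log_sub_log_le {δ x y : ℝ} (hδ : 0 < δ) (hx : δ ≤ x) (hxy : x ≤ y) :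
    Real.log y - Real.log x ≤ (1 + δ⁻¹) * (Real.log (y + 1) - Real.log (x + 1)) := by
  have hx0 : 0 < x := hδ.trans_le hx
  have hs : 0 ≤ (y - x) / (x + 1) := div_nonneg (sub_nonneg.2 hxy) (by linarith)
  have h1 := one_add_mul_self_le_rpow_one_add (s := (y - x) / (x + 1)) (by linarith)
    (p := 1 + δ⁻¹) (le_add_of_nonneg_right (by positivity))
  rw [← Real.log_div (by linarith) hx0.ne', ← Real.log_div (by linarith) (by linarith),
    ← Real.log_rpow (div_pos (by linarith) (by linarith))]
  refine Real.log_le_log (div_pos (by linarith) hx0) ?_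
  have e : (y + 1) / (x + 1) = 1 + (y - x) / (x + 1) := by field_simp; ring
  rw [e]
  refine le_trans ?_ h1
  have h2 : x⁻¹ ≤ (1 + δ⁻¹) / (x + 1) := by
    rw [inv_eq_one_div, div_le_div_iff₀ hx0 (by linarith)]
    have : 1 ≤ δ⁻¹ * x := by rwa [inv_mul_eq_div, one_le_div hδ]
    linarith
  calc y / x = 1 + (y - x) * x⁻¹ := by field_simp; ring
    _ ≤ 1 + (y - x) * ((1 + δ⁻¹) / (x + 1)) := by
      gcongr
    _ = _ := by ring

theorem abs_log_sub_log_le {δ x y : ℝ} (hδ : 0 < δ) (hx : δ ≤ x) (hy : δ ≤ y) :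
    |Real.log x - Real.log y| ≤ (1 + δ⁻¹) * |Real.log (x + 1) - Real.log (y + 1)| := by
  wlog hxy : y ≤ x generalizing x y
  · rw [abs_sub_comm, abs_sub_comm (Real.log (x + 1))]
    exact this hy hx (le_of_not_ge hxy)
  rw [abs_of_nonneg (sub_nonneg.2 (Real.log_le_log (by linarith) hxy)),
    abs_of_nonneg (sub_nonneg.2 (Real.log_le_log (by linarith) (by linarith)))]
  exact log_sub_log_le hδ hy hxy

theorem summable_abs_log_sub_comp {ℓ ℓ' : ℕ → ℝ} (hℓ : StrictMono ℓ) (h0 : ℓ 0 = 0)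
    (hℓ' : StrictMono ℓ') (h0' : ℓ' 0 = 0) {κ : ℕ} (hκ : 0 < κ) {c : ℝ} (hc : 0 < c)
    (h : Summable fun i => |Real.log (ℓ i + 1) - Real.log (c * ℓ' (i / κ) + 1)|) {e : ℕ → ℕ}
    (he : Function.Injective e) (hκe : ∀ n, κ ≤ e n) :
    Summable fun n => |Real.log (ℓ (e n)) - Real.log (c * ℓ' (e n / κ))| := by
  have h1 : 0 < ℓ 1 := h0 ▸ hℓ zero_lt_one
  have h1' : 0 < ℓ' 1 := h0' ▸ hℓ' zero_lt_one
  refine .of_nonneg_of_le (fun _ => abs_nonneg _) (fun n => abs_log_sub_log_le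
    (δ := min (ℓ 1) (c * ℓ' 1)) (lt_min h1 (by positivity))
    ((min_le_left _ _).trans (hℓ.monotone (hκ.trans_le (hκe n))))
    ((min_le_right _ _).trans (mul_le_mul_of_nonneg_left (hℓ'.monotone
      ((Nat.one_le_div_iff hκ).2 (hκe n))) hc.le))) ((h.comp_injective he).mul_left _)

end Asymptotics

theorem stmt17 (P : ℝ → ℝ) (κ : ℕ) (a : ℝ) (hP : CantorSelfSimilar P κ a)
    (M Λ : ℕ → ℝ)
    (hMmono : StrictMono M)
    (hMrange : Set.range M = {lam : ℝ | IsEigenvalue P 0 (2 * a / bb κ a) lam})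
    (hΛmono : StrictMono Λ)
    (hΛrange : Set.range Λ = {lam : ℝ | IsEigenvalue P 0 (2 / bb κ a) lam}) :
    Summable (fun n : ℕ =>
      |Real.log (M (κ * (n + 2) - 1)) - Real.log (M (κ * (n + 1)))|) ∧
    Summable (fun n : ℕ =>
      |Real.log (Λ (κ * (n + 1))) - Real.log (M (κ * (n + 1)))|) := by
  have ha := hP.2.2.2.2.2.1
  have hb := hP.gap.1
  have hκ2 : 2 ≤ κ := hP.2.2.2.2.1
  have hκ : 0 < κ := by omega
  obtain ⟨μ, hprob, hnull, hmem, hIoc⟩ :=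
    exists_measure_of_continuousOn hP.1 hP.2.1 hP.2.2.1 hP.2.2.2.1
  have hμ : IsDistribution P μ := ⟨hprob, hnull, hmem, hIoc⟩
  have hsys : ∀ {β : ℝ} {ℓ : ℕ → ℝ}, 0 < β → StrictMono ℓ →
      range ℓ = {lam | IsEigenvalue P 0 β lam} → ∃ W, EigenSystem μ β ℓ W := fun hβ hℓ hr =>
    exists_eigenSystem hβ hmem hℓ
      (hr.trans (by simp only [isEigenvalue_iff_isWeakEigenvalue hμ hP.2.2.1 hβ]))
  have hβM : 0 < 2 * a / bb κ a := by positivity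
  have hβΛ : 0 < 2 / bb κ a := by positivity
  obtain ⟨W, hW⟩ := hsys hβM hMmono hMrange
  obtain ⟨V, hV⟩ := hsys hβΛ hΛmono hΛrange
  have hc : 0 < κ * a⁻¹ ^ 3 := by positivity
  have hinj : Function.Injective fun n => κ * (n + 1) := fun m n h => by
    simpa [hκ.ne'] using h
  have hle : ∀ n, κ ≤ κ * (n + 1) := fun n => Nat.le_mul_of_pos_right κ n.succ_pos
  have hinj' : Function.Injective fun n => κ * (n + 2) - 1 := fun m n h => by
    have h1 : ∀ n, 0 < κ * (n + 2) := fun n => by positivity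
    have : κ * (m + 2) = κ * (n + 2) := by have := h1 m; have := h1 n; simp only at h; omega
    simpa [hκ.ne'] using this
  have hle' : ∀ n, κ ≤ κ * (n + 2) - 1 := fun n => by
    have := hle n
    rw [show κ * (n + 2) = κ * (n + 1) + κ by ring]
    omega
  have hdiv : ∀ n, κ * (n + 1) / κ = n + 1 := fun n => Nat.mul_div_cancel_left _ hκ
  have hdiv' : ∀ n, (κ * (n + 2) - 1) / κ = n + 1 := fun n => by
    rw [show κ * (n + 2) - 1 = κ * (n + 1) + (κ - 1) by
      rw [show κ * (n + 2) = κ * (n + 1) + κ by ring]; omega, Nat.mul_add_div hκ,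
      Nat.div_eq_of_lt (by omega), add_zero]
  have hM := hP.summable_abs_log_add_one_sub hμ hβM hβM hW hW
  have hΛ := hP.summable_abs_log_add_one_sub hμ hβΛ hβM hV hW
  have s1 := summable_abs_log_sub_comp hMmono hW.zero hMmono hW.zero hκ hc hM hinj hle
  have s2 := summable_abs_log_sub_comp hMmono hW.zero hMmono hW.zero hκ hc hM hinj' hle'
  have s3 := summable_abs_log_sub_comp hΛmono hV.zero hMmono hW.zero hκ hc hΛ hinj hle
  simp only [hdiv, hdiv'] at s1 s2 s3
  refine ⟨.of_nonneg_of_le (fun _ => abs_nonneg _) (fun n => ?_) (s2.add s1),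
    .of_nonneg_of_le (fun _ => abs_nonneg _) (fun n => ?_) (s3.add s1)⟩
  all_goals
    rw [abs_sub_comm (Real.log (M (κ * (n + 1)))) (Real.log (κ * a⁻¹ ^ 3 * M (n + 1)))]
    exact abs_sub_le _ _ _
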